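/- Let f(X_1,...,X_n) = \sum_{1\le i\le j\le n} a_{ij}X_iX_j with a_{ij} \in \mathbb{Z} be a nondegenerate integral quadratic form in n \ge 5 variables (the associated rational symmetric matrix has nonzero determinant) which is indefinite: there exist x, y \in \mathbb{Z}^n with f(x) > 0 and f(y) < 0. Assume that for every prime p, f is \mathbb{Z}_p-universal, i.e., for every a \in \mathbb{Z}_p there exists z \in \mathbb{Z}_p^n with f(z) = a (this condition is equivalent to every integer being represented by the genus of f, since f is indefinite). Then every nonzero integer a is primitively represented by f: there exists x \in \mathbb{Z}^n with f(x) = a and gcd(x_1,...,x_n) = 1. -/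

import Mathlib

/-! Local theory over p-adic integers -/
namespace LocalPart

section node
variable {p : ℕ} [hp : Fact p.Prime] {M : Type*} [AddCommGroup M] [Module ℤ_[p] M]

/-- primitive vectors -/
def Prim (p : ℕ) [Fact p.Prime] {M : Type*} [AddCommGroup M] [Module ℤ_[p] M] (x : M) : Prop :=
  ∀ y : M, x ≠ (p : ℤ_[p]) • y

def Rep (Q : QuadraticMap ℤ_[p] M ℤ_[p]) (t : ℤ_[p]) : Prop :=
  ∃ x, Prim p x ∧ Q x = t

def Big (r : ℕ) (S : Submodule ℤ_[p] M) : Prop :=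
  ∀ l : List (M →ₗ[ℤ_[p]] ℤ_[p]), l.length < r → ∃ z ∈ S, Prim p z ∧ ∀ φ ∈ l, φ z = 0

structure Node (Q : QuadraticMap ℤ_[p] M ℤ_[p]) {A : Type} (F : A → ℤ_[p]) (o : A → Prop)
    (S : Submodule ℤ_[p] M) (r : ℕ) : Prop where
  univ : ∀ t, ∃ a, ∃ s ∈ S, F a + Q s = t
  real : ∀ a, ∀ s ∈ S, (o a ∨ Prim p s) → Rep Q (F a + Q s)
  big : Big r S
  pure : ∀ y : M, (p : ℤ_[p]) • y ∈ S → y ∈ S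

variable {Q : QuadraticMap ℤ_[p] M ℤ_[p]} {A : Type} {F : A → ℤ_[p]} {o : A → Prop}
    {S : Submodule ℤ_[p] M} {r : ℕ}

noncomputable def orth (Q : QuadraticMap ℤ_[p] M ℤ_[p]) (S : Submodule ℤ_[p] M) (e : M) : Submodule ℤ_[p] M :=
  S ⊓ LinearMap.ker (Q.polarBilin e)

lemma mem_orth {e s : M} : s ∈ orth Q S e ↔ s ∈ S ∧ QuadraticMap.polar Q e s = 0 := by
  simp [orth]

lemma pne : (p : ℤ_[p]) ≠ 0 := by
  have := hp.out.ne_zero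
  exact_mod_cast this

lemma big_orth {e : M} (h : Big (r+1) S) : Big r (orth Q S e) := by
  intro l hl
  obtain ⟨z, hz, hz1, hz2⟩ := h (Q.polarBilin e :: l) (by simpa using hl)
  refine ⟨z, ?_, hz1, fun φ hφ => hz2 φ (by simp [hφ])⟩
  rw [mem_orth]
  exact ⟨hz, by simpa using hz2 (Q.polarBilin e) (by simp)⟩

lemma pure_orth {e : M} (h : ∀ y : M, (p : ℤ_[p]) • y ∈ S → y ∈ S) :
    ∀ y : M, (p : ℤ_[p]) • y ∈ orth Q S e → y ∈ orth Q S e := by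
  intro y hy
  rw [mem_orth] at hy ⊢
  refine ⟨h y hy.1, ?_⟩
  have := hy.2
  rw [QuadraticMap.polar_smul_right, smul_eq_mul] at this
  exact (mul_eq_zero.1 this).resolve_left pne

lemma Node.exists_prim (h : Node Q F o S (r+1)) : ∃ z ∈ S, Prim p z := by
  obtain ⟨z, hz, h1, -⟩ := h.big [] (by simp)
  exact ⟨z, hz, h1⟩

lemma Node.map (h : Node Q F o S r) {A' : Type} {F' : A' → ℤ_[p]} {o' : A' → Prop}
    (h1 : ∀ a, ∃ a', F' a' = F a) (h2 : ∀ a', ∃ a, F a = F' a' ∧ (o' a' → o a)) :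
    Node Q F' o' S r where
  univ t := by
    obtain ⟨a, s, hs, h3⟩ := h.univ t
    obtain ⟨a', h4⟩ := h1 a
    exact ⟨a', s, hs, by rw [h4, h3]⟩
  real a' s hs h3 := by
    obtain ⟨a, h4, h5⟩ := h2 a'
    rw [← h4]
    exact h.real a s hs (h3.imp_left h5)
  big := h.big
  pure := h.pure

lemma Node.split (h : Node Q F o S (r+1)) {e : M} (he : e ∈ S) {π c : ℤ_[p]} (hπ : π ≠ 0)
    (h2 : (2 : ℤ_[p]) ≠ 0)
    (hc : IsUnit c) (hQ : Q e = π * c) (hB : ∀ s ∈ S, 2 * π ∣ QuadraticMap.polar Q e s) :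
    Node Q (fun a : A × ℤ_[p] => F a.1 + π * c * a.2 ^ 2) (fun a => o a.1 ∨ IsUnit a.2)
      (orth Q S e) r := by
  obtain ⟨c', hc'⟩ := hc.exists_right_inv
  have hee : QuadraticMap.polar Q e e = 2 * π * c := by
    rw [QuadraticMap.polar_self, hQ, nsmul_eq_mul]; push_cast; ring
  have hdec : ∀ s ∈ S, ∃ x : ℤ_[p], ∃ s' ∈ orth Q S e, s = x • e + s' := by
    intro s hs
    obtain ⟨k, hk⟩ := hB s hs
    refine ⟨k * c', s - (k * c') • e, ?_, by abel⟩
    rw [mem_orth]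
    refine ⟨S.sub_mem hs (S.smul_mem _ he), ?_⟩
    rw [QuadraticMap.polar_sub_right, QuadraticMap.polar_smul_right, hee, hk, smul_eq_mul]
    linear_combination (-2 * π * k) * hc'
  have hval : ∀ (x : ℤ_[p]), ∀ s ∈ orth Q S e, Q (x • e + s) = π * c * x ^ 2 + Q s := by
    intro x s hs
    rw [mem_orth] at hs
    rw [QuadraticMap.map_add Q, QuadraticMap.map_smul, QuadraticMap.polar_smul_left, hs.2, hQ]
    simp only [smul_eq_mul]; ring
  refine ⟨?_, ?_, big_orth h.big, pure_orth h.pure⟩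
  · intro t
    obtain ⟨a, s, hs, h3⟩ := h.univ t
    obtain ⟨x, s', hs', rfl⟩ := hdec s hs
    refine ⟨(a, x), s', hs', ?_⟩
    rw [hval x s' hs'] at h3
    rw [← h3]; ring
  · rintro ⟨a, x⟩ s hs ho
    have h4 : F a + π * c * x ^ 2 + Q s = F a + Q (x • e + s) := by rw [hval x s hs]; ring
    dsimp only at ho ⊢
    rw [h4]
    have hs0 := (mem_orth.1 hs)
    have hxs : x • e + s ∈ S := S.add_mem (S.smul_mem _ he) hs0.1
    refine h.real a _ hxs ?_
    rw [or_assoc] at ho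
    refine ho.imp_right fun ho y hy => ?_
    have hyS : y ∈ S := h.pure y (hy ▸ hxs)
    obtain ⟨x', s', hs', rfl⟩ := hdec y hyS
    have hs0' := (mem_orth.1 hs')
    have hx : x = p * x' := by
      have h5 := congrArg (fun v => QuadraticMap.polar Q e v) hy
      simp only [QuadraticMap.polar_add_right, QuadraticMap.polar_smul_right, hee, hs0.2, hs0'.2,
        smul_eq_mul, add_zero] at h5
      have h6 : 2 * π * c ≠ 0 := mul_ne_zero (mul_ne_zero h2 hπ) hc.ne_zero
      apply mul_right_cancel₀ h6
      rw [h5]; ring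
    rcases ho with ho | ho
    · rw [hx] at ho
      have := isUnit_of_mul_isUnit_left ho
      exact PadicInt.prime_p.not_isUnit this
    · apply ho s'
      rw [hx, smul_add, smul_smul] at hy
      exact add_left_cancel hy

lemma Node.splitP (h : Node Q F o S (r+2)) {e g : M} (he : e ∈ S) (hg : g ∈ S)
    {π c b d : ℤ_[p]} (hπ : π ≠ 0)
    (hc : IsUnit (4 * c * d - b ^ 2)) (hQe : Q e = π * c) (hQg : Q g = π * d)
    (heg : QuadraticMap.polar Q e g = π * b)
    (hB : ∀ s ∈ S, π ∣ QuadraticMap.polar Q e s) (hB' : ∀ s ∈ S, π ∣ QuadraticMap.polar Q g s) :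
    Node Q (fun a : A × ℤ_[p] × ℤ_[p] => F a.1 + π * (c * a.2.1 ^ 2 + b * a.2.1 * a.2.2
      + d * a.2.2 ^ 2)) (fun a => o a.1 ∨ IsUnit a.2.1 ∨ IsUnit a.2.2)
      (orth Q (orth Q S e) g) r := by
  obtain ⟨D, hD⟩ := hc.exists_right_inv
  have hee : QuadraticMap.polar Q e e = 2 * π * c := by
    rw [QuadraticMap.polar_self, hQe, nsmul_eq_mul]; push_cast; ring
  have hgg : QuadraticMap.polar Q g g = 2 * π * d := by
    rw [QuadraticMap.polar_self, hQg, nsmul_eq_mul]; push_cast; ring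
  have hge : QuadraticMap.polar Q g e = π * b := by rw [QuadraticMap.polar_comm, heg]
  have hdec : ∀ s ∈ S, ∃ x y : ℤ_[p], ∃ s' ∈ orth Q (orth Q S e) g, s = x • e + y • g + s' := by
    intro s hs
    obtain ⟨k, hk⟩ := hB s hs
    obtain ⟨l, hl⟩ := hB' s hs
    refine ⟨(2 * d * k - b * l) * D, (2 * c * l - b * k) * D,
      s - (((2 * d * k - b * l) * D) • e + ((2 * c * l - b * k) * D) • g), ?_, by abel⟩
    rw [mem_orth, mem_orth]
    refine ⟨⟨S.sub_mem hs (S.add_mem (S.smul_mem _ he) (S.smul_mem _ hg)), ?_⟩, ?_⟩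
    · rw [QuadraticMap.polar_sub_right, QuadraticMap.polar_add_right, QuadraticMap.polar_smul_right,
        QuadraticMap.polar_smul_right, hee, heg, hk, smul_eq_mul, smul_eq_mul]
      linear_combination (-π * k) * hD
    · rw [QuadraticMap.polar_sub_right, QuadraticMap.polar_add_right, QuadraticMap.polar_smul_right,
        QuadraticMap.polar_smul_right, hgg, hge, hl, smul_eq_mul, smul_eq_mul]
      linear_combination (-π * l) * hD
  have hval : ∀ (x y : ℤ_[p]), ∀ s ∈ orth Q (orth Q S e) g,
      Q (x • e + y • g + s) = π * (c * x ^ 2 + b * x * y + d * y ^ 2) + Q s := by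
    intro x y s hs
    rw [mem_orth, mem_orth] at hs
    rw [QuadraticMap.map_add Q, QuadraticMap.map_add Q, QuadraticMap.map_smul, QuadraticMap.map_smul,
      QuadraticMap.polar_add_left, QuadraticMap.polar_smul_left, QuadraticMap.polar_smul_left,
      QuadraticMap.polar_smul_left, QuadraticMap.polar_smul_right, heg, hs.1.2, hs.2, hQe, hQg]
    simp only [smul_eq_mul]; ring
  refine ⟨?_, ?_, big_orth (big_orth h.big), pure_orth (pure_orth h.pure)⟩
  · intro t
    obtain ⟨a, s, hs, h3⟩ := h.univ t
    obtain ⟨x, y, s', hs', rfl⟩ := hdec s hs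
    refine ⟨(a, x, y), s', hs', ?_⟩
    rw [hval x y s' hs'] at h3
    rw [← h3]; ring
  · rintro ⟨a, x, y⟩ s hs ho
    have h4 : F a + π * (c * x ^ 2 + b * x * y + d * y ^ 2) + Q s = F a + Q (x • e + y • g + s) := by
      rw [hval x y s hs]; ring
    dsimp only at ho ⊢
    rw [h4]
    have hs0 := (mem_orth.1 hs)
    have hs1 := (mem_orth.1 hs0.1)
    have hxs : x • e + y • g + s ∈ S :=
      S.add_mem (S.add_mem (S.smul_mem _ he) (S.smul_mem _ hg)) hs1.1
    refine h.real a _ hxs ?_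
    rw [or_assoc] at ho
    refine ho.imp_right fun ho z hz => ?_
    have hzS : z ∈ S := h.pure z (hz ▸ hxs)
    obtain ⟨x', y', s', hs', rfl⟩ := hdec z hzS
    have hs0' := (mem_orth.1 hs')
    have hs1' := (mem_orth.1 hs0'.1)
    have h5 := congrArg (fun v => QuadraticMap.polar Q e v) hz
    have h6 := congrArg (fun v => QuadraticMap.polar Q g v) hz
    simp only [QuadraticMap.polar_add_right, QuadraticMap.polar_smul_right, hee, hgg, heg, hge,
      hs0.2, hs0'.2, hs1.2, hs1'.2, smul_eq_mul, add_zero] at h5 h6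
    have h5' : 2 * c * x + b * y = p * (2 * c * x' + b * y') := by
      apply mul_left_cancel₀ hπ; linear_combination h5
    have h6' : b * x + 2 * d * y = p * (b * x' + 2 * d * y') := by
      apply mul_left_cancel₀ hπ; linear_combination h6
    have hx : x = p * x' := by
      apply mul_left_cancel₀ hc.ne_zero
      linear_combination 2 * d * h5' - b * h6'
    have hy : y = p * y' := by
      apply mul_left_cancel₀ hc.ne_zero
      linear_combination 2 * c * h6' - b * h5'
    rcases ho with (ho | ho) | ho
    · rw [hx] at ho
      exact PadicInt.prime_p.not_isUnit (isUnit_of_mul_isUnit_left ho)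
    · rw [hy] at ho
      exact PadicInt.prime_p.not_isUnit (isUnit_of_mul_isUnit_left ho)
    · apply ho s'
      rw [hx, hy, smul_add, smul_add, smul_smul, smul_smul] at hz
      exact add_left_cancel hz

end node
end LocalPart
namespace LocalPart

section hensel
variable {p : ℕ} [hp : Fact p.Prime]

lemma quad_root {A b C t0 : ℤ_[p]} (h : (p : ℤ_[p]) ∣ A * t0 ^ 2 + b * t0 + C)
    (h' : IsUnit (2 * A * t0 + b)) : ∃ t, A * t ^ 2 + b * t + C = 0 ∧ (p : ℤ_[p]) ∣ t - t0 := by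
  let P : Polynomial ℤ_[p] := Polynomial.C A * Polynomial.X ^ 2 + Polynomial.C b * Polynomial.X
    + Polynomial.C C
  have e1 : ∀ t, P.aeval t = A * t ^ 2 + b * t + C := by
    intro t; simp [P]
  have e2 : ∀ t, P.derivative.aeval t = 2 * A * t + b := by
    intro t; simp [P]; ring
  have hn : ‖P.aeval t0‖ < ‖P.derivative.aeval t0‖ ^ 2 := by
    rw [e1, e2, PadicInt.isUnit_iff.1 h']
    simpa using PadicInt.norm_lt_one_iff_dvd _ |>.2 h
  obtain ⟨z, hz, hz1, -⟩ := hensels_lemma hn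
  rw [e1] at hz
  rw [e2, PadicInt.isUnit_iff.1 h'] at hz1
  exact ⟨z, hz, (PadicInt.norm_lt_one_iff_dvd _).1 hz1⟩

lemma not_unit_iff {x : ℤ_[p]} : ¬ IsUnit x ↔ (p : ℤ_[p]) ∣ x := by
  rw [PadicInt.not_isUnit_iff, PadicInt.norm_lt_one_iff_dvd]

lemma unit_iff {x : ℤ_[p]} : IsUnit x ↔ ¬ (p : ℤ_[p]) ∣ x := by
  rw [← not_unit_iff, not_not]

lemma unit_of_dvd_sub {x y : ℤ_[p]} (h : (p : ℤ_[p]) ∣ x - y) (hy : IsUnit y) : IsUnit x := by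
  rw [unit_iff] at hy ⊢
  intro hx
  exact hy (by simpa using dvd_sub hx h)

/-- every element is a power of p times a unit -/
lemma val_decomp {x : ℤ_[p]} (hx : x ≠ 0) : ∃ (k : ℕ) (u : ℤ_[p]), IsUnit u ∧ x = p ^ k * u :=
  ⟨x.valuation, PadicInt.unitCoeff hx, Units.isUnit _, by
    conv_lhs => rw [PadicInt.unitCoeff_spec hx]
    ring⟩

end hensel

section node
variable {p : ℕ} [hp : Fact p.Prime] {M : Type*} [AddCommGroup M] [Module ℤ_[p] M]
variable {Q : QuadraticMap ℤ_[p] M ℤ_[p]} {A : Type} {F : A → ℤ_[p]} {o : A → Prop}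
    {S : Submodule ℤ_[p] M} {r : ℕ}

lemma dvd_polar {π : ℤ_[p]} (hS : ∀ s ∈ S, π ∣ Q s) {x y : M} (hx : x ∈ S) (hy : y ∈ S) :
    π ∣ QuadraticMap.polar Q x y := by
  unfold QuadraticMap.polar
  exact dvd_sub (dvd_sub (hS _ (S.add_mem hx hy)) (hS _ hx)) (hS _ hy)

/-- hyperbolic situation at level π -/
lemma Node.hyp (h : Node Q F o S r) {π : ℤ_[p]} (hπ : π ≠ 0) (hS : ∀ s ∈ S, π ∣ Q s)
    {x y : M} (hx : x ∈ S) (hy : y ∈ S) (hxx : π * p ∣ Q x) {u : ℤ_[p]} (hu : IsUnit u)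
    (hxy : QuadraticMap.polar Q x y = π * u) (a : A) (τ : ℤ_[p]) : Rep Q (F a + π * τ) := by
  obtain ⟨b, hb⟩ := hS y hy
  obtain ⟨c, hc⟩ := hxx
  obtain ⟨u', hu'⟩ := hu.exists_right_inv
  obtain ⟨t, ht, -⟩ := quad_root (p := p) (A := p * c) (b := u) (C := b - τ) (t0 := (τ - b) * u')
    (by
      have : ↑p * c * ((τ - b) * u') ^ 2 + u * ((τ - b) * u') + (b - τ)
         = p * (c * ((τ - b) * u') ^ 2) := by linear_combination (τ - b) * hu'
      rw [this]; exact dvd_mul_right _ _)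
    (unit_of_dvd_sub (y := u) ⟨2 * c * ((τ - b) * u'), by ring⟩ hu)
  have hmem : t • x + y ∈ S := S.add_mem (S.smul_mem _ hx) hy
  have hval : Q (t • x + y) = π * τ := by
    rw [QuadraticMap.map_add Q, QuadraticMap.map_smul, QuadraticMap.polar_smul_left, hxy, hb, hc]
    simp only [smul_eq_mul]
    linear_combination π * ht
  rw [← hval]
  apply h.real a _ hmem (Or.inr _)
  intro z hz
  have hzS : z ∈ S := h.pure z (hz ▸ hmem)
  obtain ⟨k, hk⟩ := dvd_polar hS hx hzS
  have h1 := congrArg (fun v => QuadraticMap.polar Q x v) hz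
  simp only [QuadraticMap.polar_add_right, QuadraticMap.polar_smul_right, QuadraticMap.polar_self,
    hk, hxy, hc, smul_eq_mul, nsmul_eq_mul] at h1
  have h2 : u = p * (k - t * (2 * c)) := by
    apply mul_left_cancel₀ hπ
    push_cast at h1
    linear_combination h1
  rw [unit_iff] at hu
  exact hu ⟨_, h2⟩

/-- step of the splitting, p odd. -/
lemma Node.stepOdd (h : Node Q F o S (r+1)) {π : ℤ_[p]} (hπ : π ≠ 0) (h2 : IsUnit (2 : ℤ_[p]))
    (hS : ∀ s ∈ S, π ∣ Q s) : (∀ s ∈ S, π * p ∣ Q s) ∨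
    ∃ c : ℤ_[p], IsUnit c ∧ ∃ S', S' ≤ S ∧ Node Q (fun a : A × ℤ_[p] => F a.1 + π * c * a.2 ^ 2)
      (fun a => o a.1 ∨ IsUnit a.2) S' r := by
  by_cases hn : ∀ s ∈ S, π * p ∣ Q s
  · exact Or.inl hn
  push Not at hn
  obtain ⟨e, he, hn⟩ := hn
  obtain ⟨c, hc⟩ := hS e he
  refine Or.inr ⟨c, ?_, orth Q S e, inf_le_left, h.split he hπ h2.ne_zero ?_ hc ?_⟩
  · rw [unit_iff]; intro hd; apply hn; rw [hc]; exact mul_dvd_mul_left _ hd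
  · rw [unit_iff]; intro hd; apply hn; rw [hc]; exact mul_dvd_mul_left _ hd
  · intro s hs
    rw [h2.mul_left_dvd]
    exact dvd_polar hS he hs

end node

section odd
variable {p : ℕ} [hp : Fact p.Prime]

lemma unit_two (hp2 : p ≠ 2) : IsUnit (2 : ℤ_[p]) := by
  rw [PadicInt.isUnit_iff]
  have := (PadicInt.norm_int_lt_one_iff_dvd (p := p) 2)
  have h2 : ¬ ((p : ℤ) ∣ 2) := by
    intro h
    have : p ∣ 2 := by exact_mod_cast h
    exact hp2 ((Nat.prime_dvd_prime_iff_eq hp.out Nat.prime_two).1 this)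
  have h3 : ¬ ‖((2:ℤ) : ℤ_[p])‖ < 1 := fun h => h2 (this.1 h)
  push_cast at h3
  exact le_antisymm (PadicInt.norm_le_one _) (not_lt.1 h3)

lemma toZMod_eq_zero {x : ℤ_[p]} : PadicInt.toZMod x = 0 ↔ (p : ℤ_[p]) ∣ x := by
  rw [← RingHom.mem_ker, PadicInt.ker_toZMod, PadicInt.maximalIdeal_eq_span_p,
    Ideal.mem_span_singleton]

lemma toZMod_surj (x : ZMod p) : ∃ y : ℤ_[p], PadicInt.toZMod y = x :=
  ZMod.ringHom_surjective (PadicInt.toZMod (p := p)) x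

lemma sq_hensel (hp2 : p ≠ 2) {c x r : ℤ_[p]} (hc : IsUnit c) (hx : IsUnit x)
    (h : (p : ℤ_[p]) ∣ c * x ^ 2 - r) : ∃ y, IsUnit y ∧ c * y ^ 2 = r := by
  obtain ⟨t, ht, h1⟩ := quad_root (p := p) (A := c) (b := 0) (C := -r) (t0 := x) (by simpa [sub_eq_add_neg] using h)
    (by simpa using ((unit_two hp2).mul hc).mul hx)
  exact ⟨t, unit_of_dvd_sub h1 hx, by linear_combination ht⟩

/-- all elements by ternary, with some unit -/
lemma ternary_odd (hp2 : p ≠ 2) {a b c : ℤ_[p]} (ha : IsUnit a) (hb : IsUnit b) (hc : IsUnit c)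
    (τ : ℤ_[p]) : ∃ x y z, a * x ^ 2 + b * y ^ 2 + c * z ^ 2 = τ ∧ IsUnit z := by
  have key : ∀ τ : ℤ_[p], ∃ x y, (p : ℤ_[p]) ∣ a * x ^ 2 + b * y ^ 2 - τ := by
    intro τ
    have hodd : Fintype.card (ZMod p) % 2 = 1 := by
      rw [ZMod.card]
      exact (hp.out.eq_two_or_odd).resolve_left hp2
    have ha0 : PadicInt.toZMod a ≠ 0 := by rw [Ne, toZMod_eq_zero]; exact unit_iff.1 ha
    have hb0 : PadicInt.toZMod b ≠ 0 := by rw [Ne, toZMod_eq_zero]; exact unit_iff.1 hb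
    obtain ⟨x, y, hxy⟩ := FiniteField.exists_root_sum_quadratic
      (f := Polynomial.C (PadicInt.toZMod a) * Polynomial.X ^ 2 + Polynomial.C 0 * Polynomial.X
        + Polynomial.C 0)
      (g := Polynomial.C (PadicInt.toZMod b) * Polynomial.X ^ 2 + Polynomial.C 0 * Polynomial.X
        + Polynomial.C (-PadicInt.toZMod τ))
      (Polynomial.degree_quadratic ha0) (Polynomial.degree_quadratic hb0) hodd
    obtain ⟨x', rfl⟩ := toZMod_surj x
    obtain ⟨y', rfl⟩ := toZMod_surj y
    refine ⟨x', y', ?_⟩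
    rw [← toZMod_eq_zero]
    simp at hxy ⊢
    linear_combination hxy
  obtain ⟨x, y, hxy⟩ := key (τ - c)
  obtain ⟨z, hz, hz1⟩ := sq_hensel hp2 hc isUnit_one (r := τ - a * x ^ 2 - b * y ^ 2) (by
    have : c * 1 ^ 2 - (τ - a * x ^ 2 - b * y ^ 2) = a * x ^ 2 + b * y ^ 2 - (τ - c) := by ring
    rw [this]; exact hxy)
  exact ⟨x, y, z, by rw [hz1]; ring, hz⟩

lemma binary_odd (hp2 : p ≠ 2) {a b τ : ℤ_[p]} (ha : IsUnit a) (hb : IsUnit b) (hτ : IsUnit τ) :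
    ∃ x y, a * x ^ 2 + b * y ^ 2 = τ := by
  obtain ⟨x, y, z, h, hz⟩ := ternary_odd hp2 ha hb hτ.neg 0
  obtain ⟨z', hz'⟩ := hz.exists_right_inv
  exact ⟨x * z', y * z', by linear_combination z' ^ 2 * h + τ * (z * z' + 1) * hz'⟩

lemma exists_nonsq (hp2 : p ≠ 2) : ∃ u : ℤ_[p], IsUnit u ∧ ∀ x, ¬ (p : ℤ_[p]) ∣ x ^ 2 - u := by
  obtain ⟨u, hu⟩ := FiniteField.exists_nonsquare (F := ZMod p) (by rwa [ZMod.ringChar_zmod_n])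
  obtain ⟨u', rfl⟩ := toZMod_surj u
  refine ⟨u', ?_, ?_⟩
  · rw [unit_iff, ← toZMod_eq_zero]
    intro h; rw [h] at hu; exact hu ⟨0, by simp⟩
  · intro x h
    rw [← toZMod_eq_zero] at h
    apply hu
    simp at h
    exact ⟨PadicInt.toZMod x, by linear_combination -h⟩

lemma quaternary_odd (hp2 : p ≠ 2) {a b c d : ℤ_[p]} (ha : IsUnit a) (hb : IsUnit b)
    (hc : IsUnit c) (hd : IsUnit d) (τ : ℤ_[p]) :
    ∃ x y z w, a * x ^ 2 + b * y ^ 2 + p * (c * z ^ 2 + d * w ^ 2) = τ := by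
  by_cases h0 : τ = 0
  · exact ⟨0, 0, 0, 0, by simp [h0]⟩
  obtain ⟨k, u, hu, rfl⟩ := val_decomp h0
  rcases Nat.even_or_odd' k with ⟨j, rfl | rfl⟩
  · obtain ⟨x, y, h⟩ := binary_odd hp2 ha hb hu
    exact ⟨p ^ j * x, p ^ j * y, 0, 0, by rw [← h]; ring⟩
  · obtain ⟨x, y, h⟩ := binary_odd hp2 hc hd hu
    exact ⟨0, 0, p ^ j * x, p ^ j * y, by rw [← h]; ring⟩

variable {M : Type*} [AddCommGroup M] [Module ℤ_[p] M]

theorem local_odd (hp2 : p ≠ 2) {Q : QuadraticMap ℤ_[p] M ℤ_[p]} (hQ : ∀ t, ∃ x, Q x = t)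
    (hbig : Big (p := p) 5 (⊤ : Submodule ℤ_[p] M)) (m : ℤ_[p]) : Rep Q (p ^ 2 * m) := by
  have h2 := unit_two hp2
  obtain ⟨ν, hν, hν'⟩ := exists_nonsq hp2
  have N0 : Node Q (fun _ : Unit => 0) (fun _ => False) ⊤ (4 + 1) :=
    ⟨fun t => by obtain ⟨x, hx⟩ := hQ t; exact ⟨(), x, trivial, by simpa using hx⟩,
     fun _ s _ h => ⟨s, by simpa using h, by simp⟩, hbig, fun _ _ => trivial⟩
  have hp0 : (p : ℤ_[p]) ≠ 0 := pne
  rcases N0.stepOdd one_ne_zero h2 (fun s _ => one_dvd _) with h | ⟨c1, hc1, S1, -, N1⟩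
  · exfalso
    obtain ⟨_, s, hs, h1⟩ := N0.univ 1
    have := h s hs
    rw [zero_add] at h1
    rw [h1, one_mul] at this
    exact PadicInt.prime_p.not_isUnit (isUnit_of_dvd_one this)
  rcases N1.stepOdd one_ne_zero h2 (fun s _ => one_dvd _) with h | ⟨c2, hc2, S2, -, N2⟩
  · exfalso
    obtain ⟨a, s, hs, h1⟩ := N1.univ (c1 * ν)
    obtain ⟨k, hk⟩ := h s hs
    apply hν' a.2
    rw [← hc1.dvd_mul_left]
    exact ⟨-k, by linear_combination h1 - hk⟩
  rcases N2.stepOdd one_ne_zero h2 (fun s _ => one_dvd _) with h | ⟨c3, hc3, S3, -, N3⟩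
  swap
  · obtain ⟨x, y, z, h, hz⟩ := ternary_odd hp2 hc1 hc2 hc3 (p ^ 2 * m)
    have := N3.real ((((), x), y), z) 0 (zero_mem _) (Or.inl (by simp [hz]))
    convert this using 1
    rw [← h]; simp
  simp only [one_mul] at h
  by_cases hiso : ∃ x y, IsUnit x ∧ (p : ℤ_[p]) ∣ c1 * x ^ 2 + c2 * y ^ 2
  · obtain ⟨x, y, hx, hxy⟩ := hiso
    obtain ⟨x', hx', h3⟩ := sq_hensel hp2 hc1 hx (r := p ^ 2 * m - c2 * y ^ 2) (by
      have : c1 * x ^ 2 - (p ^ 2 * m - c2 * y ^ 2) = c1 * x ^ 2 + c2 * y ^ 2 - p * (p * m) := by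
        ring
      rw [this]; exact dvd_sub hxy (dvd_mul_right _ _))
    have := N2.real (((), x'), y) 0 (zero_mem _) (Or.inl (by simp [hx']))
    convert this using 1
    simp; linear_combination -h3
  push Not at hiso
  have haniso : ∀ x y, (p : ℤ_[p]) ∣ c1 * x ^ 2 + c2 * y ^ 2 → (p : ℤ_[p]) ∣ x ∧ (p : ℤ_[p]) ∣ y := by
    intro x y hxy
    have hx : (p : ℤ_[p]) ∣ x := by
      by_contra hx; exact hiso x y (unit_iff.2 hx) hxy
    refine ⟨hx, ?_⟩
    have : (p : ℤ_[p]) ∣ c2 * y ^ 2 := by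
      have := dvd_sub hxy ((dvd_pow hx two_ne_zero).mul_left c1)
      simpa using this
    rw [hc2.dvd_mul_left] at this
    exact PadicInt.prime_p.dvd_of_dvd_pow this
  have hpp : ∀ x y, (p : ℤ_[p]) ∣ c1 * x ^ 2 + c2 * y ^ 2 →
      ∃ k, c1 * x ^ 2 + c2 * y ^ 2 = p ^ 2 * k := by
    intro x y hxy
    obtain ⟨⟨x', rfl⟩, ⟨y', rfl⟩⟩ := haniso x y hxy
    exact ⟨c1 * x' ^ 2 + c2 * y' ^ 2, by ring⟩
  rcases N2.stepOdd hp0 h2 h with h' | ⟨c3, hc3, S3, hS3, N3⟩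
  · exfalso
    obtain ⟨a, s, hs, h1⟩ := N2.univ p
    obtain ⟨k, hk⟩ := h' s hs
    simp only [zero_add, one_mul] at h1
    obtain ⟨l, hl⟩ := hpp a.1.2 a.2 ⟨1 - p * k, by linear_combination h1 - hk⟩
    have : (p : ℤ_[p]) * (p * (l + k)) = p * 1 := by linear_combination h1 - hl - hk
    have := mul_left_cancel₀ hp0 this
    exact PadicInt.prime_p.not_isUnit (isUnit_of_dvd_one ⟨_, this.symm⟩)
  rcases N3.stepOdd hp0 h2 (fun s hs => h s (hS3 hs)) with h' | ⟨c4, hc4, S4, hS4, N4⟩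
  · exfalso
    obtain ⟨a, s, hs, h1⟩ := N3.univ (p * (c3 * ν))
    obtain ⟨k, hk⟩ := h' s hs
    simp only [zero_add, one_mul] at h1
    obtain ⟨l, hl⟩ := hpp a.1.1.2 a.1.2 ⟨c3 * ν - c3 * a.2 ^ 2 - p * k, by
      linear_combination h1 - hk⟩
    apply hν' a.2
    rw [← hc3.dvd_mul_left]
    refine ⟨-l - k, ?_⟩
    apply mul_left_cancel₀ hp0
    linear_combination h1 - hl - hk
  by_cases h5 : ∀ s ∈ S4, (p : ℤ_[p]) * p ∣ Q s
  · obtain ⟨z, hz, hz1⟩ := N4.exists_prim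
    obtain ⟨d, hd⟩ := h5 z hz
    obtain ⟨x, y, w, v, hq⟩ := quaternary_odd hp2 hc1 hc2 hc3 hc4 (m - d)
    have := N4.real (((((), p * x), p * y), p * w), p * v) z hz (Or.inr hz1)
    convert this using 1
    simp only [hd]
    linear_combination - (p : ℤ_[p]) ^ 2 * hq
  · push Not at h5
    obtain ⟨s, hs, h5⟩ := h5
    obtain ⟨d, hd⟩ := h s (hS3 (hS4 hs))
    have hdu : IsUnit d := by
      rw [unit_iff]; intro h6; apply h5; rw [hd]; exact mul_dvd_mul_left _ h6
    obtain ⟨x, y, z, hq, hz⟩ := ternary_odd hp2 hdu hc4 hc3 (p * m)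
    have := N4.real (((((), 0), 0), z), y) (x • s) (S4.smul_mem _ hs) (Or.inl (by simp [hz]))
    convert this using 1
    rw [QuadraticMap.map_smul, hd]
    simp only [smul_eq_mul]
    linear_combination - (p : ℤ_[p]) * hq

end odd
end LocalPart
namespace LocalPart
section two

lemma two_ne : (2 : ℤ_[2]) ≠ 0 := by simp

lemma two_not_unit : ¬ IsUnit (2 : ℤ_[2]) := by
  simpa using (PadicInt.prime_p (p := 2)).not_isUnit

lemma even_or_unit (x : ℤ_[2]) : (∃ k, x = 2 * k) ∨ IsUnit x := by
  by_cases h : IsUnit x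
  · exact Or.inr h
  · left
    have := not_unit_iff.1 h
    simpa [Dvd.dvd] using this

lemma not_unit_two_mul (k : ℤ_[2]) : ¬ IsUnit (2 * k) := fun h =>
  two_not_unit (isUnit_of_mul_isUnit_left h)

lemma unit_odd {u : ℤ_[2]} (h : IsUnit u) : ∃ k, u = 2 * k + 1 := by
  have h2 : PadicInt.toZMod u = 1 := by
    have : PadicInt.toZMod u ≠ 0 := by rw [Ne, toZMod_eq_zero]; exact unit_iff.1 h
    revert this
    generalize PadicInt.toZMod u = z
    revert z
    decide
  have h3 : PadicInt.toZMod (u - 1) = 0 := by rw [map_sub, h2]; simp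
  rw [toZMod_eq_zero] at h3
  obtain ⟨k, hk⟩ := h3
  exact ⟨k, by push_cast at hk; linear_combination hk⟩

lemma odd_unit (k : ℤ_[2]) : IsUnit (2 * k + 1) :=
  unit_of_dvd_sub (p := 2) (y := 1) ⟨k, by push_cast; ring⟩ isUnit_one

lemma unit_sub_even {u k : ℤ_[2]} (h : IsUnit u) : IsUnit (u - 2 * k) := by
  obtain ⟨l, rfl⟩ := unit_odd h
  convert odd_unit (l - k) using 1; ring

lemma even_sub_unit {u k : ℤ_[2]} (h : IsUnit u) : IsUnit (2 * k - u) := by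
  have := (unit_sub_even (k := k) h).neg
  convert this using 1; ring

lemma unit_sub_unit {u v : ℤ_[2]} (h : IsUnit u) (h' : IsUnit v) : ∃ k, u - v = 2 * k := by
  obtain ⟨k, rfl⟩ := unit_odd h
  obtain ⟨l, rfl⟩ := unit_odd h'
  exact ⟨k - l, by ring⟩

lemma unit_add_unit {u v : ℤ_[2]} (h : IsUnit u) (h' : IsUnit v) : ∃ k, u + v = 2 * k := by
  obtain ⟨k, rfl⟩ := unit_odd h
  obtain ⟨l, rfl⟩ := unit_odd h'
  exact ⟨k + l + 1, by ring⟩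

lemma sq8 {c r k : ℤ_[2]} (hc : IsUnit c) (h : r = c + 8 * k) : ∃ t, IsUnit t ∧ c * t ^ 2 = r := by
  obtain ⟨c', hc'⟩ := hc.exists_right_inv
  obtain ⟨s, hs, -⟩ := quad_root (p := 2) (A := 1) (b := 1) (C := -2 * (c' * k)) (t0 := 0)
    ⟨-(c' * k), by push_cast; ring⟩ (by simp)
  refine ⟨2 * s + 1, odd_unit s, ?_⟩
  rw [h]
  linear_combination 4 * c * hs + 8 * k * hc'

lemma solve4 {c0 c c' t s : ℤ_[2]} (h0 : IsUnit c0) (h1 : IsUnit c) (h2 : IsUnit c')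
    (ht : t - c0 = 2 * s) : ∃ x y z, IsUnit x ∧ c0 * x ^ 2 + 4 * c * y ^ 2 + 2 * c' * z ^ 2 = t := by
  have key : ∃ y z k, t - 4 * c * y ^ 2 - 2 * c' * z ^ 2 = c0 + 8 * k := by
    have even : ∀ s', ∃ y k, 4 * s' - 4 * c * y ^ 2 = 8 * k := by
      intro s'
      rcases even_or_unit s' with ⟨k, rfl⟩ | hs'
      · exact ⟨0, k, by ring⟩
      · obtain ⟨k, hk⟩ := unit_sub_unit hs' h1
        exact ⟨1, k, by linear_combination 4 * hk⟩
    rcases even_or_unit s with ⟨s', rfl⟩ | hs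
    · obtain ⟨y, k, hk⟩ := even s'
      exact ⟨y, 0, k, by linear_combination ht + hk⟩
    · obtain ⟨s', hs'⟩ := unit_sub_unit hs h2
      obtain ⟨y, k, hk⟩ := even s'
      exact ⟨y, 1, k, by linear_combination ht + 2 * hs' + hk⟩
  obtain ⟨y, z, k, hk⟩ := key
  obtain ⟨x, hx, hx'⟩ := sq8 h0 hk
  exact ⟨x, y, z, hx, by rw [hx']; ring⟩

def Ev (r : ℤ_[2]) : Prop := r = 0 ∨ ∃ (j : ℕ) (u : ℤ_[2]), IsUnit u ∧ r = 4 ^ j * u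

lemma Ev.zero : Ev 0 := Or.inl rfl
lemma Ev.unit {u : ℤ_[2]} (h : IsUnit u) : Ev u := Or.inr ⟨0, u, h, by simp⟩
lemma Ev.four {r : ℤ_[2]} (h : Ev r) : Ev (4 * r) := by
  rcases h with rfl | ⟨j, u, hu, rfl⟩
  · left; simp
  · exact Or.inr ⟨j + 1, u, hu, by ring⟩
lemma Ev.cases {r : ℤ_[2]} (h : Ev r) : IsUnit r ∨ ∃ r', Ev r' ∧ r = 4 * r' := by
  rcases h with rfl | ⟨j, u, hu, rfl⟩
  · right; exact ⟨0, Ev.zero, by simp⟩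
  · cases j with
    | zero => left; simpa using hu
    | succ j => right; exact ⟨4 ^ j * u, Or.inr ⟨j, u, hu, rfl⟩, by ring⟩

lemma plane_unit {c b d x y : ℤ_[2]} (hc : IsUnit c) (hb : IsUnit b) (hd : IsUnit d)
    (h : IsUnit x ∨ IsUnit y) : IsUnit (c * x ^ 2 + b * x * y + d * y ^ 2) := by
  obtain ⟨c, rfl⟩ := unit_odd hc
  obtain ⟨b, rfl⟩ := unit_odd hb
  obtain ⟨d, rfl⟩ := unit_odd hd
  rcases even_or_unit x with ⟨x, rfl⟩ | hx
  · have hy := h.resolve_left (not_unit_two_mul x)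
    obtain ⟨y, rfl⟩ := unit_odd hy
    convert odd_unit (2 * (2 * c + 1) * x ^ 2 + (2 * b + 1) * x * (2 * y + 1)
      + d * (2 * y + 1) ^ 2 + 2 * y ^ 2 + 2 * y) using 1
    ring
  · obtain ⟨x, rfl⟩ := unit_odd hx
    rcases even_or_unit y with ⟨y, rfl⟩ | hy
    · convert odd_unit (2 * (2 * d + 1) * y ^ 2 + (2 * b + 1) * y * (2 * x + 1)
        + c * (2 * x + 1) ^ 2 + 2 * x ^ 2 + 2 * x) using 1
      ring
    · obtain ⟨y, rfl⟩ := unit_odd hy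
      convert odd_unit (c * (2 * x + 1) ^ 2 + d * (2 * y + 1) ^ 2 + b * (2 * x + 1) * (2 * y + 1)
        + 2 * x ^ 2 + 2 * x + 2 * y ^ 2 + 2 * y + 1 + 2 * x * y + x + y) using 1
      ring

lemma plane_ev {c b d : ℤ_[2]} (hc : IsUnit c) (hb : IsUnit b) (hd : IsUnit d) (x y : ℤ_[2]) :
    Ev (c * x ^ 2 + b * x * y + d * y ^ 2) := by
  have key : ∀ (k : ℕ) (x' y' : ℤ_[2]), IsUnit x' ∨ IsUnit y' → x = 2 ^ k * x' → y = 2 ^ k * y' →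
      Ev (c * x ^ 2 + b * x * y + d * y ^ 2) := by
    intro k x' y' h hx hy
    refine Or.inr ⟨k, _, plane_unit hc hb hd h, ?_⟩
    rw [hx, hy, show (4 : ℤ_[2]) = 2 ^ 2 by norm_num, ← pow_mul]; ring
  by_cases hx : x = 0
  · by_cases hy : y = 0
    · left; simp [hx, hy]
    · obtain ⟨k, u, hu, h⟩ := val_decomp hy
      exact key k 0 u (Or.inr hu) (by simp [hx]) (by simpa using h)
  · obtain ⟨k, u, hu, h⟩ := val_decomp hx
    by_cases hy : y = 0
    · exact key k u 0 (Or.inl hu) (by simpa using h) (by simp [hy])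
    · obtain ⟨l, v, hv, h'⟩ := val_decomp hy
      rcases le_total k l with hkl | hkl
      · obtain ⟨i, rfl⟩ := Nat.exists_eq_add_of_le hkl
        exact key k u (2 ^ i * v) (Or.inl hu) (by simpa using h)
          (by rw [h']; push_cast; ring)
      · obtain ⟨i, rfl⟩ := Nat.exists_eq_add_of_le hkl
        exact key l (2 ^ i * u) v (Or.inr hv) (by rw [h]; push_cast; ring) (by simpa using h')

lemma plane_rep {c b d r : ℤ_[2]} (hc : IsUnit c) (hb : IsUnit b) (hr : Ev r) :
    ∃ x y, c * x ^ 2 + b * x * y + d * y ^ 2 = r ∧ (IsUnit r → IsUnit x ∨ IsUnit y) := by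
  rcases hr with rfl | ⟨j, u, hu, rfl⟩
  · exact ⟨0, 0, by simp, by simp⟩
  · obtain ⟨l, hl⟩ := unit_sub_unit hc hu
    obtain ⟨y, hy, -⟩ := quad_root (p := 2) (A := d) (b := b) (C := c - u) (t0 := 0)
      ⟨l, by push_cast; linear_combination hl⟩ (by simpa using hb)
    refine ⟨2 ^ j, 2 ^ j * y, ?_, ?_⟩
    · have h4 : (4 : ℤ_[2]) ^ j = 2 ^ (2 * j) := by rw [pow_mul]; norm_num
      rw [h4]
      linear_combination 2 ^ (2 * j) * hy
    · intro h
      left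
      cases j with
      | zero => simp
      | succ j =>
        exfalso
        apply not_unit_two_mul (2 * (4 ^ j * u))
        convert h using 1; ring

variable {M : Type*} [AddCommGroup M] [Module ℤ_[2] M]
variable {Q : QuadraticMap ℤ_[2] M ℤ_[2]} {A : Type} {F : A → ℤ_[2]} {o : A → Prop}
    {S : Submodule ℤ_[2] M} {r : ℕ}

lemma unit_of_not_dvd {π x : ℤ_[2]} (hn : ¬ 2 * π ∣ π * x) : IsUnit x := by
  rcases even_or_unit x with ⟨k, rfl⟩ | h
  · exact absurd ⟨k, by ring⟩ hn
  · exact h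

lemma Node.stepB (h : Node Q F o S (r+1)) {π π' : ℤ_[2]} (hππ : π' = 2 * π) (hπ : π ≠ 0)
    (hS : ∀ s ∈ S, π ∣ Q s) (hB : ∀ x ∈ S, ∀ y ∈ S, π' ∣ QuadraticMap.polar Q x y) :
    (∀ s ∈ S, π' ∣ Q s) ∨
    ∃ c : ℤ_[2], IsUnit c ∧ ∃ S', S' ≤ S ∧ Node Q (fun a : A × ℤ_[2] => F a.1 + π * c * a.2 ^ 2)
      (fun a => o a.1 ∨ IsUnit a.2) S' r := by
  subst hππ
  by_cases hn : ∀ s ∈ S, 2 * π ∣ Q s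
  · exact Or.inl hn
  push Not at hn
  obtain ⟨e, he, hn⟩ := hn
  obtain ⟨c, hc⟩ := hS e he
  have hcu : IsUnit c := unit_of_not_dvd (hc ▸ hn)
  exact Or.inr ⟨c, hcu, orth Q S e, inf_le_left, h.split he hπ two_ne hcu hc (hB e he)⟩

lemma Node.step2 (h : Node Q F o S (r+2)) {π π' : ℤ_[2]} (hππ : π' = 2 * π) (hπ : π ≠ 0)
    (hS : ∀ s ∈ S, π ∣ Q s) {T : ℤ_[2]} (hT : π ∣ T) (a0 : A) (ha0 : F a0 = 0) :
    Rep Q T ∨ (∀ s ∈ S, π' ∣ Q s) ∨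
    (∃ c : ℤ_[2], IsUnit c ∧ ∃ S', S' ≤ S ∧ (∀ x ∈ S, ∀ y ∈ S, π' ∣ QuadraticMap.polar Q x y) ∧
      Node Q (fun a : A × ℤ_[2] => F a.1 + π * c * a.2 ^ 2)
      (fun a => o a.1 ∨ IsUnit a.2) S' (r+1)) ∨
    (∃ S', S' ≤ S ∧ (∀ s ∈ S', π' ∣ Q s) ∧
      Node Q (fun a : A × {r : ℤ_[2] // Ev r} => F a.1 + π * a.2)
      (fun a => o a.1 ∨ IsUnit (a.2 : ℤ_[2])) S' r) := by
  by_cases hB : ∀ x ∈ S, ∀ y ∈ S, π' ∣ QuadraticMap.polar Q x y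
  · rcases h.stepB hππ hπ hS hB with h1 | ⟨c, hc, S', hS', hN⟩
    · exact Or.inr (Or.inl h1)
    · exact Or.inr (Or.inr (Or.inl ⟨c, hc, S', hS', hB, hN⟩))
  subst hππ
  push Not at hB
  obtain ⟨x, hx, y, hy, hB⟩ := hB
  obtain ⟨τ, rfl⟩ := hT
  obtain ⟨b, hb⟩ := dvd_polar hS hx hy
  have hbu : IsUnit b := unit_of_not_dvd (hb ▸ hB)
  have hyp : ∀ x y b, x ∈ S → y ∈ S → IsUnit b → QuadraticMap.polar Q x y = π * b →
      2 * π ∣ Q x → Rep Q (π * τ) := by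
    intro x y b hx hy hbu hb hxx
    have := h.hyp hπ hS hx hy (by push_cast; rwa [mul_comm]) hbu hb a0 τ
    rwa [ha0, zero_add] at this
  by_cases hxx : 2 * π ∣ Q x
  · exact Or.inl (hyp x y b hx hy hbu hb hxx)
  by_cases hyy : 2 * π ∣ Q y
  · exact Or.inl (hyp y x b hy hx hbu (by rw [QuadraticMap.polar_comm, hb]) hyy)
  obtain ⟨c, hc⟩ := hS x hx
  obtain ⟨d, hd⟩ := hS y hy
  have hcu : IsUnit c := unit_of_not_dvd (hc ▸ hxx)
  have hdu : IsUnit d := unit_of_not_dvd (hd ▸ hyy)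
  have hN := h.splitP hx hy hπ (by
    have := (unit_sub_even (k := 2 * c * d) (hbu.pow 2)).neg
    convert this using 1; ring) hc hd hb (fun s hs => dvd_polar hS hx hs)
    (fun s hs => dvd_polar hS hy hs)
  by_cases hs : ∀ s ∈ orth Q (orth Q S x) y, 2 * π ∣ Q s
  · refine Or.inr (Or.inr (Or.inr ⟨_, inf_le_left.trans inf_le_left, hs, hN.map ?_ ?_⟩))
    · rintro ⟨a, x, y⟩
      exact ⟨(a, ⟨_, plane_ev hcu hbu hdu x y⟩), rfl⟩
    · rintro ⟨a, r, hr⟩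
      obtain ⟨x, y, hxy, h1⟩ := plane_rep (d := d) hcu hbu hr
      refine ⟨(a, x, y), ?_, ?_⟩
      · simp only [hxy]
      · exact Or.imp_right h1
  · left
    push Not at hs
    obtain ⟨s, hs, hs1⟩ := hs
    have hs2 := mem_orth.1 hs
    have hs3 := mem_orth.1 hs2.1
    obtain ⟨f, hf⟩ := hS s hs3.1
    have hfu : IsUnit f := unit_of_not_dvd (hf ▸ hs1)
    obtain ⟨k, hk⟩ := unit_add_unit hcu hfu
    refine hyp (x + s) y b (S.add_mem hx hs3.1) hy hbu ?_ ?_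
    · rw [QuadraticMap.polar_add_left, hb, QuadraticMap.polar_comm Q s y, hs2.2, add_zero]
    · rw [QuadraticMap.map_add Q, hs3.2, hc, hf]
      exact ⟨k, by linear_combination π * hk⟩

/-- plane at level π finishing -/
lemma Node.planeFin {π : ℤ_[2]} (h : Node Q (fun a : A × {r : ℤ_[2] // Ev r} => F a.1 + π * a.2)
      (fun a => o a.1 ∨ IsUnit (a.2 : ℤ_[2])) S r) (a0 a1 : A) (h0 : F a0 = 0) {u : ℤ_[2]}
      (hu : IsUnit u) (h1 : F a1 = π * u) (τ : ℤ_[2]) : Rep Q (π * τ) := by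
  rcases even_or_unit τ with ⟨k, rfl⟩ | hτ
  · have hk := even_sub_unit (k := k) hu
    have := h.real (a1, ⟨_, Ev.unit hk⟩) 0 (zero_mem _) (Or.inl (Or.inr hk))
    convert this using 1
    simp only [h1, map_zero]; ring
  · have := h.real (a0, ⟨_, Ev.unit hτ⟩) 0 (zero_mem _) (Or.inl (Or.inr hτ))
    convert this using 1
    simp only [h0, map_zero]; ring

end two
end LocalPart
namespace LocalPart
section num

/-- odd values of 2P + c y² + e z² with z odd -/
lemma f2_odd {c c' t : ℤ_[2]} (hc : IsUnit c) (hc' : IsUnit c') (ht : IsUnit t) :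
    ∃ ρ y z, Ev ρ ∧ IsUnit z ∧ 2 * ρ + c * y ^ 2 + c' * z ^ 2 = t := by
  obtain ⟨s, hs⟩ := unit_sub_unit ht hc'
  rcases even_or_unit s with ⟨s', rfl⟩ | hs1
  · rcases even_or_unit s' with ⟨s'', rfl⟩ | hs2
    · obtain ⟨z, hz, hz1⟩ := sq8 (r := t) (k := s'') hc' (by linear_combination hs)
      exact ⟨0, 0, z, Ev.zero, hz, by rw [hz1]; ring⟩
    · obtain ⟨k, hk⟩ := unit_sub_unit hs2 hc
      obtain ⟨z, hz, hz1⟩ := sq8 (r := t - 4 * c) (k := k) hc' (by linear_combination hs + 4 * hk)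
      exact ⟨0, 2, z, Ev.zero, hz, by rw [hz1]; ring⟩
  · exact ⟨s, 0, 1, Ev.unit hs1, isUnit_one, by linear_combination -hs⟩

lemma pow_cast (k : ℕ) (u : ℤ_[2]) : ((2 : ℕ) : ℤ_[2]) ^ (k+1) * u = 2 * ((2 : ℕ) ^ k * u) := by
  push_cast; ring

lemma f_univ_aux {c c' u : ℤ_[2]} (hc : IsUnit c) (hc' : IsUnit c') (hu : IsUnit u) (k : ℕ) :
    (∃ ρ y z, Ev ρ ∧ 2 * ρ + c * y ^ 2 + c' * z ^ 2 = (2 : ℕ) ^ k * u) ∧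
    (∃ ρ y z, Ev ρ ∧ ρ + 2 * (c * y ^ 2 + c' * z ^ 2) = (2 : ℕ) ^ k * u) := by
  induction k with
  | zero =>
    obtain ⟨ρ, y, z, h, -, h2⟩ := f2_odd hc hc' hu
    exact ⟨⟨ρ, y, z, h, by simpa using h2⟩, ⟨u, 0, 0, Ev.unit hu, by simp⟩⟩
  | succ k ih =>
    obtain ⟨⟨ρ, y, z, h, h2⟩, ⟨ρ', y', z', h', h2'⟩⟩ := ih
    rw [pow_cast, ← h2]
    refine ⟨⟨ρ', 2 * y', 2 * z', h', ?_⟩, ⟨4 * ρ, y, z, h.four, ?_⟩⟩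
    · rw [h2, ← h2']; ring
    · ring

lemma f2_univ {c c' : ℤ_[2]} (hc : IsUnit c) (hc' : IsUnit c') (t : ℤ_[2]) :
    ∃ ρ y z, Ev ρ ∧ 2 * ρ + c * y ^ 2 + c' * z ^ 2 = t := by
  by_cases ht : t = 0
  · exact ⟨0, 0, 0, Ev.zero, by simp [ht]⟩
  · obtain ⟨k, u, hu, rfl⟩ := val_decomp ht
    exact (f_univ_aux hc hc' hu k).1

lemma PP_univ (t : ℤ_[2]) : ∃ ρ ρ', Ev ρ ∧ Ev ρ' ∧ ρ + 2 * ρ' = t := by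
  by_cases ht : t = 0
  · exact ⟨0, 0, Ev.zero, Ev.zero, by simp [ht]⟩
  · obtain ⟨k, u, hu, rfl⟩ := val_decomp ht
    have h4 : ∀ j : ℕ, (4 : ℤ_[2]) ^ j = 2 ^ (2 * j) := fun j => by rw [pow_mul]; norm_num
    rcases Nat.even_or_odd' k with ⟨j, rfl | rfl⟩
    · exact ⟨_, 0, Or.inr ⟨j, u, hu, rfl⟩, Ev.zero, by rw [h4]; push_cast; ring⟩
    · exact ⟨0, _, Ev.zero, Or.inr ⟨j, u, hu, rfl⟩, by rw [h4]; push_cast; ring⟩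

lemma lemX {c c' : ℤ_[2]} (hc : IsUnit c) (hc' : IsUnit c') (d h : ℤ_[2]) :
    ∃ ρ y z w, Ev ρ ∧ (IsUnit z ∨ IsUnit w) ∧
      2 * ρ + c * y ^ 2 + c' * z ^ 2 + d * w ^ 2 = h := by
  rcases even_or_unit h with ⟨h, rfl⟩ | hu
  · rcases even_or_unit d with ⟨d, rfl⟩ | hd
    · rcases even_or_unit (h - d) with ⟨k, hk⟩ | hhd
      · obtain ⟨ρ, y, z, h1, h2⟩ := f2_univ hc hc' k
        rcases even_or_unit k with ⟨l, rfl⟩ | hku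
        · obtain ⟨ρ, y, z, h1, h2⟩ := f2_univ hc hc' l
          obtain ⟨ρ, y, z, h1, h2⟩ := f2_univ hc hc' (2 * l)
          exact ⟨4 * ρ, 2 * y, 2 * z, 1, h1.four, Or.inr isUnit_one, by
            linear_combination 4 * h2 - 2 * hk⟩
        · exact ⟨4 * ρ, 2 * y, 2 * z, 1, h1.four, Or.inr isUnit_one, by
            linear_combination 4 * h2 - 2 * hk⟩
      · exact ⟨h - d, 0, 0, 1, Ev.unit hhd, Or.inr isUnit_one, by ring⟩
    · obtain ⟨ρ, y, z, h1, hz, h2⟩ := f2_odd hc hc' (even_sub_unit (k := h) hd)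
      exact ⟨ρ, y, z, 1, h1, Or.inl hz, by linear_combination h2⟩
  · obtain ⟨ρ, y, z, h1, hz, h2⟩ := f2_odd hc hc' hu
    exact ⟨ρ, y, z, 0, h1, Or.inl hz, by linear_combination h2⟩

lemma lemW {c c' : ℤ_[2]} (hc : IsUnit c) (hc' : IsUnit c') (m : ℤ_[2]) :
    ∃ ρ y z, Ev ρ ∧ IsUnit z ∧ ρ + 2 * c * y ^ 2 + c' * z ^ 2 = m := by
  rcases even_or_unit m with ⟨m, rfl⟩ | hm
  · exact ⟨2 * m - c', 0, 1, Ev.unit (even_sub_unit hc'), isUnit_one, by ring⟩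
  have four : ∀ k l, m - c' - l = 4 * k → ∃ ρ z, Ev ρ ∧ IsUnit z ∧ ρ + l + c' * z ^ 2 = m := by
    intro k l h
    rcases even_or_unit k with ⟨k', rfl⟩ | hk
    · obtain ⟨z, hz, hz1⟩ := sq8 (r := m - l) (k := k') hc' (by linear_combination h)
      exact ⟨0, z, Ev.zero, hz, by rw [hz1]; ring⟩
    · exact ⟨4 * k, 1, (Ev.unit hk).four, isUnit_one, by linear_combination -h⟩
  obtain ⟨s, hs⟩ := unit_sub_unit hm hc'
  rcases even_or_unit s with ⟨s, rfl⟩ | hs1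
  · obtain ⟨ρ, z, h1, h2, h3⟩ := four s 0 (by linear_combination hs)
    exact ⟨ρ, 0, z, h1, h2, by linear_combination h3⟩
  · obtain ⟨k, hk⟩ := unit_sub_unit hs1 hc
    obtain ⟨ρ, z, h1, h2, h3⟩ := four k (2 * c) (by linear_combination hs + 2 * hk)
    exact ⟨ρ, 1, z, h1, h2, by linear_combination h3⟩

lemma E_univ_aux {u : ℤ_[2]} (hu : IsUnit u) (k : ℕ) : ∀ {a b c d : ℤ_[2]}, IsUnit a → IsUnit b →
    IsUnit c → IsUnit d →
    ∃ x y z w, a * x ^ 2 + b * y ^ 2 + 2 * (c * z ^ 2 + d * w ^ 2) = (2 : ℕ) ^ k * u := by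
  induction k with
  | zero =>
    intro a b c d ha hb hc hd
    obtain ⟨s, hs⟩ := unit_sub_unit hu ha
    obtain ⟨x, y, z, -, h⟩ := solve4 ha hb hc hs
    exact ⟨x, 2 * y, z, 0, by rw [pow_zero, one_mul, ← h]; ring⟩
  | succ k ih =>
    intro a b c d ha hb hc hd
    obtain ⟨x, y, z, w, h⟩ := ih hc hd ha hb
    exact ⟨2 * z, 2 * w, x, y, by rw [pow_cast, ← h]; ring⟩

lemma E_univ {a b c d : ℤ_[2]} (ha : IsUnit a) (hb : IsUnit b) (hc : IsUnit c) (hd : IsUnit d)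
    (t : ℤ_[2]) : ∃ x y z w, a * x ^ 2 + b * y ^ 2 + 2 * (c * z ^ 2 + d * w ^ 2) = t := by
  by_cases ht : t = 0
  · exact ⟨0, 0, 0, 0, by simp [ht]⟩
  · obtain ⟨k, u, hu, rfl⟩ := val_decomp ht
    exact E_univ_aux hu k ha hb hc hd

lemma lemY {a b c c' : ℤ_[2]} (ha : IsUnit a) (hb : IsUnit b) (hc : IsUnit c) (hc' : IsUnit c')
    (d h : ℤ_[2]) : ∃ x z y w u, (IsUnit w ∨ IsUnit u) ∧
      2 * a * x ^ 2 + 2 * b * z ^ 2 + c * y ^ 2 + c' * w ^ 2 + d * u ^ 2 = h := by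
  rcases even_or_unit h with ⟨h, rfl⟩ | hu
  · rcases even_or_unit d with ⟨d, rfl⟩ | hd
    · obtain ⟨x, z, y, w, h1⟩ := E_univ ha hb hc hc' (h - d)
      exact ⟨x, z, 2 * y, 2 * w, 1, Or.inr isUnit_one, by linear_combination 2 * h1⟩
    · obtain ⟨s, hs⟩ := unit_sub_unit (even_sub_unit (k := h) hd) hc'
      obtain ⟨x, y, z, hx, h1⟩ := solve4 hc' hc ha hs
      exact ⟨z, 0, 2 * y, x, 1, Or.inl hx, by linear_combination h1⟩
  · obtain ⟨s, hs⟩ := unit_sub_unit hu hc'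
    obtain ⟨x, y, z, hx, h1⟩ := solve4 hc' hc ha hs
    exact ⟨z, 0, 2 * y, x, 0, Or.inl hx, by linear_combination h1⟩

/-- if every t not divisible by 4 is represented, then all are. -/
lemma four_descent {X : Type} {f : X → ℤ_[2]} (h0 : ∃ x, f x = 0) (h4 : ∀ x, ∃ y, f y = 4 * f x)
    (h : ∀ u, IsUnit u → (∃ x, f x = u) ∧ ∃ x, f x = 2 * u) (t : ℤ_[2]) : ∃ x, f x = t := by
  by_cases ht : t = 0
  · rw [ht]; exact h0
  obtain ⟨k, u, hu, rfl⟩ := val_decomp ht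
  have key : ∀ (j : ℕ) (t : ℤ_[2]), (∃ x, f x = t) → ∃ x, f x = (2 : ℤ_[2]) ^ (2 * j) * t := by
    intro j t hx
    induction j with
    | zero => simpa using hx
    | succ j ih =>
      obtain ⟨x, hx⟩ := ih
      obtain ⟨y, hy⟩ := h4 x
      exact ⟨y, by rw [hy, hx]; ring⟩
  rcases Nat.even_or_odd' k with ⟨j, rfl | rfl⟩
  · simpa using key j u (h u hu).1
  · obtain ⟨y, hy⟩ := key j (2 * u) (h u hu).2
    exact ⟨y, by rw [hy]; push_cast; ring⟩

/-- sum with two coefficients summing to 0 mod 4 -/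
lemma lem3 {a b c m k e : ℤ_[2]} (ha : IsUnit a) (hc : IsUnit c) (hab : a + b + e = 4 * k) :
    ∃ x z, IsUnit x ∧ a * x ^ 2 + b + c * (2 * z) ^ 2 + e = 4 * m := by
  rcases even_or_unit (m - k) with ⟨l, hl⟩ | hl
  · obtain ⟨x, hx, h⟩ := sq8 (r := 4 * m - b - e) (k := l) ha (by linear_combination 4 * hl - hab)
    exact ⟨x, 0, hx, by rw [h]; ring⟩
  · obtain ⟨l, hl⟩ := unit_sub_unit hl hc
    obtain ⟨x, hx, h⟩ := sq8 (r := 4 * m - b - e - 4 * c) (k := l) ha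
      (by linear_combination 4 * hl - hab)
    exact ⟨x, 1, hx, by rw [h]; ring⟩


/-- reduction mod 8 -/
noncomputable def φ8 : ℤ_[2] →+* ZMod 8 := (PadicInt.toZModPow 3 : ℤ_[2] →+* ZMod (2 ^ 3))

lemma φ8_eq_zero {x : ℤ_[2]} (h : φ8 x = 0) : ∃ k, x = 8 * k := by
  have h1 : x ∈ RingHom.ker (PadicInt.toZModPow 3 : ℤ_[2] →+* ZMod (2 ^ 3)) := h
  rw [PadicInt.ker_toZModPow, Ideal.mem_span_singleton] at h1
  obtain ⟨k, hk⟩ := h1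
  exact ⟨k, by rw [hk]; push_cast; norm_num⟩

lemma φ8_surj (n : ZMod 8) : ∃ x, φ8 x = n := ZMod.ringHom_surjective φ8 n

lemma sq8' {c x r k : ℤ_[2]} (hc : IsUnit c) (hx : IsUnit x) (h : r = c * x ^ 2 + 8 * k) :
    ∃ t, IsUnit t ∧ c * t ^ 2 = r := by
  obtain ⟨t, ht, h1⟩ := sq8 (hc.mul (hx.pow 2)) h
  exact ⟨x * t, hx.mul ht, by rw [← h1]; ring⟩

lemma φ8_one_unit {x : ℤ_[2]} (h : φ8 x = 1) : IsUnit x := by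
  obtain ⟨k, hk⟩ := φ8_eq_zero (x := x - 1) (by rw [map_sub, h]; simp)
  have : x = 2 * (4 * k) + 1 := by linear_combination hk
  rw [this]; exact odd_unit _

def odds : List (ZMod 8) := [1, 3, 5, 7]

lemma φ8_unit {x : ℤ_[2]} (h : IsUnit x) : φ8 x ∈ odds := by
  obtain ⟨k, rfl⟩ := unit_odd h
  rw [map_add, map_mul, map_ofNat, map_one]
  generalize φ8 k = n
  revert n; decide

lemma decG : ∀ a ∈ odds, ∀ d ∈ odds, ∀ b ∈ [a, a+4], ∀ c ∈ [a, a+4], ∀ t ∈ ([1,3,5,7,2,6] : List (ZMod 8)),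
    ∃ x ∈ ([0,1,2] : List (ZMod 8)), ∃ y ∈ ([0,1,2] : List (ZMod 8)), ∃ z ∈ ([0,1,2] : List (ZMod 8)),
    ∃ w ∈ ([0,1,2] : List (ZMod 8)), t = a * x ^ 2 + b * y ^ 2 + c * z ^ 2 + d * w ^ 2 ∧
      (x = 1 ∨ y = 1 ∨ z = 1 ∨ w = 1) := by
  decide +kernel

lemma mem_four (a k : ZMod 8) : a + 4 * k ∈ [a, a + 4] := by revert a k; decide
lemma two_odds (a : ZMod 8) : a ∈ odds → 2 * a ∈ ([1,3,5,7,2,6] : List (ZMod 8)) := by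
  revert a; decide
lemma one_odds (a : ZMod 8) : a ∈ odds → a ∈ ([1,3,5,7,2,6] : List (ZMod 8)) := by
  revert a; decide

lemma G_univ {a b c d k l : ℤ_[2]} (ha : IsUnit a) (hd : IsUnit d)
    (hb : b = a + 4 * k) (hc : c = a + 4 * l) (t : ℤ_[2]) :
    ∃ x : ℤ_[2] × ℤ_[2] × ℤ_[2] × ℤ_[2], a * x.1 ^ 2 + b * x.2.1 ^ 2 + c * x.2.2.1 ^ 2
      + d * x.2.2.2 ^ 2 = t := by
  have hbu : IsUnit b := by
    have := unit_sub_even (k := -2 * k) ha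
    rw [hb]; convert this using 1; ring
  have hcu : IsUnit c := by
    have := unit_sub_even (k := -2 * l) ha
    rw [hc]; convert this using 1; ring
  refine four_descent (f := fun x : ℤ_[2] × ℤ_[2] × ℤ_[2] × ℤ_[2] => a * x.1 ^ 2 + b * x.2.1 ^ 2
    + c * x.2.2.1 ^ 2 + d * x.2.2.2 ^ 2) ⟨0, by simp⟩ ?_ ?_ t
  · rintro ⟨x, y, z, w⟩
    exact ⟨(2 * x, 2 * y, 2 * z, 2 * w), by dsimp only; ring⟩
  have key : ∀ t, φ8 t ∈ ([1,3,5,7,2,6] : List (ZMod 8)) →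
      ∃ x : ℤ_[2] × ℤ_[2] × ℤ_[2] × ℤ_[2], a * x.1 ^ 2 + b * x.2.1 ^ 2 + c * x.2.2.1 ^ 2
      + d * x.2.2.2 ^ 2 = t := by
    intro t ht
    obtain ⟨x, -, y, -, z, -, w, -, h, h1⟩ := decG (φ8 a) (φ8_unit ha) (φ8 d) (φ8_unit hd) (φ8 b)
      (by rw [hb, map_add, map_mul, map_ofNat]; exact mem_four _ _) (φ8 c)
      (by rw [hc, map_add, map_mul, map_ofNat]; exact mem_four _ _) (φ8 t) ht
    obtain ⟨x, rfl⟩ := φ8_surj x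
    obtain ⟨y, rfl⟩ := φ8_surj y
    obtain ⟨z, rfl⟩ := φ8_surj z
    obtain ⟨w, rfl⟩ := φ8_surj w
    obtain ⟨q, hq⟩ := φ8_eq_zero (x := t - (a * x ^ 2 + b * y ^ 2 + c * z ^ 2 + d * w ^ 2)) (by
      rw [map_sub, h]; simp)
    rcases h1 with h1 | h1 | h1 | h1
    · obtain ⟨x', -, hx'⟩ := sq8' (r := t - (b * y ^ 2 + c * z ^ 2 + d * w ^ 2)) ha
        (φ8_one_unit h1) (k := q) (by linear_combination hq)
      exact ⟨(x', y, z, w), by dsimp only; linear_combination hx'⟩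
    · obtain ⟨x', -, hx'⟩ := sq8' (r := t - (a * x ^ 2 + c * z ^ 2 + d * w ^ 2)) hbu
        (φ8_one_unit h1) (k := q) (by linear_combination hq)
      exact ⟨(x, x', z, w), by dsimp only; linear_combination hx'⟩
    · obtain ⟨x', -, hx'⟩ := sq8' (r := t - (a * x ^ 2 + b * y ^ 2 + d * w ^ 2)) hcu
        (φ8_one_unit h1) (k := q) (by linear_combination hq)
      exact ⟨(x, y, x', w), by dsimp only; linear_combination hx'⟩
    · obtain ⟨x', -, hx'⟩ := sq8' (r := t - (a * x ^ 2 + b * y ^ 2 + c * z ^ 2)) hd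
        (φ8_one_unit h1) (k := q) (by linear_combination hq)
      exact ⟨(x, y, z, x'), by dsimp only; linear_combination hx'⟩
  intro u hu
  exact ⟨key u (one_odds _ (φ8_unit hu)), key (2 * u) (by
    rw [map_mul, map_ofNat]; exact two_odds _ (φ8_unit hu))⟩

/-- ternary universal -/
lemma A3_univ {a b c : ℤ_[2]} (ha : IsUnit a) (hb : IsUnit b) (hc : IsUnit c)
    (h : ∀ t, ∃ x y z k, t = a * x ^ 2 + b * y ^ 2 + 2 * c * z ^ 2 + 16 * k) (t : ℤ_[2]) :
    ∃ x : ℤ_[2] × ℤ_[2] × ℤ_[2], a * x.1 ^ 2 + b * x.2.1 ^ 2 + 2 * c * x.2.2 ^ 2 = t := by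
  refine four_descent (f := fun x : ℤ_[2] × ℤ_[2] × ℤ_[2] => a * x.1 ^ 2 + b * x.2.1 ^ 2
    + 2 * c * x.2.2 ^ 2) ⟨0, by simp⟩ ?_ ?_ t
  · rintro ⟨x, y, z⟩
    exact ⟨(2 * x, 2 * y, 2 * z), by dsimp only; ring⟩
  have key : ∀ t, (¬ ∃ k, t = 4 * k) →
      ∃ x : ℤ_[2] × ℤ_[2] × ℤ_[2], a * x.1 ^ 2 + b * x.2.1 ^ 2 + 2 * c * x.2.2 ^ 2 = t := by
    intro t ht
    obtain ⟨x, y, z, k, hk⟩ := h t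
    rcases even_or_unit x with ⟨x, rfl⟩ | hx
    · rcases even_or_unit y with ⟨y, rfl⟩ | hy
      · rcases even_or_unit z with ⟨z, rfl⟩ | hz
        · exact absurd ⟨a * x ^ 2 + b * y ^ 2 + 2 * c * z ^ 2 + 4 * k, by rw [hk]; ring⟩ ht
        · obtain ⟨z', -, hz'⟩ := sq8' (r := c * z ^ 2 + 8 * k) hc hz rfl
          exact ⟨(2 * x, 2 * y, z'), by dsimp only; linear_combination 2 * hz' - hk⟩
      · obtain ⟨z', -, hz'⟩ := sq8' (r := b * y ^ 2 + 8 * (2 * k)) hb hy rfl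
        exact ⟨(2 * x, z', z), by dsimp only; linear_combination hz' - hk⟩
    · obtain ⟨z', -, hz'⟩ := sq8' (r := a * x ^ 2 + 8 * (2 * k)) ha hx rfl
      exact ⟨(z', y, z), by dsimp only; linear_combination hz' - hk⟩
  intro u hu
  refine ⟨key u ?_, key _ ?_⟩
  · rintro ⟨k, rfl⟩
    exact not_unit_two_mul (2 * k) (by convert hu using 1; ring)
  · rintro ⟨k, hk⟩
    have : u = 2 * k := mul_left_cancel₀ two_ne (by linear_combination hk)
    rw [this] at hu
    exact not_unit_two_mul _ hu

end num
end LocalPart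
namespace LocalPart
section contra

lemma nc_A1 {r k : ℤ_[2]} (h : Ev r) : r + 4 * k ≠ 2 := by
  intro he
  rcases h.cases with h | ⟨r', -, rfl⟩
  · have : r = 2 * (1 - 2 * k) := by linear_combination he
    rw [this] at h
    exact not_unit_two_mul _ h
  · have : (1 : ℤ_[2]) = 2 * (r' + k) := mul_left_cancel₀ two_ne (by linear_combination -he)
    exact not_unit_two_mul (r' + k) (this ▸ isUnit_one)

lemma φ8_ev {r : ℤ_[2]} (h : Ev r) : φ8 r ∈ ([1, 3, 5, 7, 0, 4] : List (ZMod 8)) := by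
  have odd : ∀ n : ZMod 8, n ∈ odds → n ∈ ([1, 3, 5, 7, 0, 4] : List (ZMod 8)) := by decide
  have four : ∀ n : ZMod 8, 4 * n ∈ ([1, 3, 5, 7, 0, 4] : List (ZMod 8)) := by decide
  rcases h.cases with h | ⟨r', -, rfl⟩
  · exact odd _ (φ8_unit h)
  · rw [map_mul, map_ofNat]; exact four _

lemma eight_zero : (8 : ZMod 8) = 0 := by decide

lemma nc_A2 {r c y k : ℤ_[2]} (h : Ev r) (hc : IsUnit c) : r + 2 * c * y ^ 2 + 16 * k ≠ 10 * c := by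
  intro he
  rcases h.cases with h | ⟨ρ, hρ, rfl⟩
  · have : r = 2 * (5 * c - c * y ^ 2 - 8 * k) := by linear_combination he
    rw [this] at h
    exact not_unit_two_mul _ h
  have h2 : 2 * ρ + c * y ^ 2 + 8 * k = 5 * c :=
    mul_left_cancel₀ two_ne (by linear_combination he)
  have := congrArg φ8 h2
  simp only [map_add, map_mul, map_pow, map_ofNat, eight_zero, zero_mul, add_zero] at this
  revert this
  have h3 := φ8_ev hρ
  have h4 := φ8_unit hc
  generalize φ8 ρ = a at *
  generalize φ8 c = b at *
  generalize φ8 y = d at *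
  revert b; revert a; revert d
  decide +kernel

lemma nc_B0 {c x k : ℤ_[2]} (hc : IsUnit c) : c * x ^ 2 + 4 * k ≠ 2 := by
  intro he
  have := congrArg φ8 he
  simp only [map_add, map_mul, map_pow, map_ofNat] at this
  revert this
  have h4 := φ8_unit hc
  generalize φ8 x = a at *
  generalize φ8 c = b at *
  generalize φ8 k = d at *
  revert b; revert a; revert d
  decide +kernel

lemma nc_B0P {c x r k : ℤ_[2]} (hc : IsUnit c) (h : Ev r) : c * x ^ 2 + 2 * r + 8 * k ≠ 5 * c := by
  intro he
  have := congrArg φ8 he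
  simp only [map_add, map_mul, map_pow, map_ofNat, eight_zero, zero_mul, add_zero] at this
  revert this
  have h4 := φ8_unit hc
  have h3 := φ8_ev h
  generalize φ8 x = a at *
  generalize φ8 c = b at *
  generalize φ8 r = d at *
  revert b; revert d; revert a
  decide +kernel

lemma decα : ∀ a ∈ odds, ∀ b ∈ odds, ∀ c ∈ odds, ∃ t : ZMod 8, ∀ x y z : ZMod 8,
    a * x ^ 2 + 2 * b * y ^ 2 + 2 * c * z ^ 2 ≠ t := by
  have sq : ∀ x : ZMod 8, x ^ 2 ∈ ([0, 1, 4] : List (ZMod 8)) := by decide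
  have : ∀ a ∈ odds, ∀ b ∈ odds, ∀ c ∈ odds, ∃ t : ZMod 8, ∀ x ∈ ([0, 1, 4] : List (ZMod 8)),
    ∀ y ∈ ([0, 1, 4] : List (ZMod 8)), ∀ z ∈ ([0, 1, 4] : List (ZMod 8)),
    a * x + 2 * b * y + 2 * c * z ≠ t := by decide +kernel
  intro a ha b hb c hc
  obtain ⟨t, ht⟩ := this a ha b hb c hc
  exact ⟨t, fun x y z => ht _ (sq x) _ (sq y) _ (sq z)⟩

lemma nc_α {a b c : ℤ_[2]} (ha : IsUnit a) (hb : IsUnit b) (hc : IsUnit c) :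
    ∃ t, ∀ x y z k, a * x ^ 2 + 2 * b * y ^ 2 + 2 * c * z ^ 2 + 8 * k ≠ t := by
  obtain ⟨t, ht⟩ := decα _ (φ8_unit ha) _ (φ8_unit hb) _ (φ8_unit hc)
  obtain ⟨t, rfl⟩ := φ8_surj t
  refine ⟨t, fun x y z k h => ht (φ8 x) (φ8 y) (φ8 z) ?_⟩
  have := congrArg φ8 h
  simpa only [map_add, map_mul, map_pow, map_ofNat, eight_zero, zero_mul, add_zero] using this

lemma nc_B1 {a b : ℤ_[2]} (ha : IsUnit a) (hb : IsUnit b) :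
    ∃ t, ∀ x y k, a * x ^ 2 + b * y ^ 2 + 4 * k ≠ t := by
  have dec : ∀ a ∈ odds, ∀ b ∈ odds, ∃ t : ZMod 8, ∀ x y k : ZMod 8,
    a * x ^ 2 + b * y ^ 2 + 4 * k ≠ t := by decide +kernel
  obtain ⟨t, ht⟩ := dec _ (φ8_unit ha) _ (φ8_unit hb)
  obtain ⟨t, rfl⟩ := φ8_surj t
  refine ⟨t, fun x y k h => ht (φ8 x) (φ8 y) (φ8 k) ?_⟩
  have := congrArg φ8 h
  simpa only [map_add, map_mul, map_pow, map_ofNat] using this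

lemma nc_B2 {a b c k l x y z q : ℤ_[2]} (ha : IsUnit a) (hb : b = a + 4 * k) (hc : c = a + 4 * l) :
    a * x ^ 2 + b * y ^ 2 + c * z ^ 2 + 8 * q ≠ a + b + c + 4 := by
  have sq : ∀ x : ZMod 8, x ^ 2 ∈ ([0, 1, 4] : List (ZMod 8)) := by decide
  have dec : ∀ a ∈ odds, ∀ b ∈ [a, a + 4], ∀ c ∈ [a, a+4], ∀ x ∈ ([0, 1, 4] : List (ZMod 8)),
    ∀ y ∈ ([0, 1, 4] : List (ZMod 8)), ∀ z ∈ ([0, 1, 4] : List (ZMod 8)),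
    a * x + b * y + c * z ≠ a + b + c + 4 := by decide +kernel
  intro h
  have := congrArg φ8 h
  simp only [map_add, map_mul, map_pow, map_ofNat, eight_zero, zero_mul, add_zero] at this
  exact dec _ (φ8_unit ha) _ (by rw [hb, map_add, map_mul, map_ofNat]; exact mem_four _ _) _
      (by rw [hc, map_add, map_mul, map_ofNat]; exact mem_four _ _) _ (sq _) _ (sq _) _ (sq _) this
end contra

section tree
variable {M : Type*} [AddCommGroup M] [Module ℤ_[2] M]
variable {Q : QuadraticMap ℤ_[2] M ℤ_[2]} {S : Submodule ℤ_[2] M}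

abbrev EvT := {r : ℤ_[2] // Ev r}

lemma Rep.of_eq {t t' : ℤ_[2]} (h : Rep Q t) (e : t' = t) : Rep Q t' := e ▸ h

lemma four_ne : (4 : ℤ_[2]) ≠ 0 := by norm_num
lemma eight_ne : (8 : ℤ_[2]) ≠ 0 := by norm_num

lemma prim_smul {x : M} {w : ℤ_[2]} (hx : Prim 2 x) (hw : IsUnit w) : Prim 2 (w • x) := by
  intro y hy
  obtain ⟨w', hw'⟩ := hw.exists_right_inv
  apply hx (w' • y)
  rw [smul_comm, ← hy, smul_smul, mul_comm, hw', one_smul]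

lemma Node.planeFin' {A : Type} {G : A × EvT → ℤ_[2]} {o' : A × EvT → Prop} {r : ℕ}
    (h : Node Q G o' S r) (π : ℤ_[2]) (a0 a1 : A) (ho : ∀ a (r : EvT), IsUnit (r : ℤ_[2]) → o' (a, r))
    (h0 : ∀ r : EvT, G (a0, r) = π * r) {u : ℤ_[2]} (hu : IsUnit u)
    (h1 : ∀ r : EvT, G (a1, r) = π * u + π * r) (τ : ℤ_[2]) : Rep Q (π * τ) := by
  rcases even_or_unit τ with ⟨k, rfl⟩ | hτ
  · have hk := even_sub_unit (k := k) hu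
    have := h.real (a1, ⟨_, Ev.unit hk⟩) 0 (zero_mem _) (Or.inl (ho _ _ hk))
    convert this using 1
    simp only [h1, map_zero]; ring
  · have := h.real (a0, ⟨_, Ev.unit hτ⟩) 0 (zero_mem _) (Or.inl (ho _ _ hτ))
    convert this using 1
    simp only [h0, map_zero]; ring

theorem caseA (N : Node Q (fun a : Unit × EvT => 0 + 1 * (a.2 : ℤ_[2]))
    (fun a => False ∨ IsUnit (a.2 : ℤ_[2])) S 3) (hS : ∀ s ∈ S, 2 ∣ Q s) (m : ℤ_[2]) :
    Rep Q (4 * m) := by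
  have z0 : Ev 0 := Ev.zero
  rcases N.step2 (π := 2) (π' := 4) (by norm_num) two_ne hS (T := 4 * m) ⟨2 * m, by ring⟩
    ((), ⟨0, z0⟩) (by simp) with h | h | ⟨c2, hc2, S2, hS2, hB, N2⟩ | ⟨S2, hS2, h4, N2⟩
  · exact h
  · exfalso
    obtain ⟨a, s, hs, h1⟩ := N.univ 2
    obtain ⟨k, hk⟩ := h s hs
    exact nc_A1 (k := k) a.2.2 (by linear_combination h1 - hk)
  · -- level one vector
    rcases N2.stepB (π := 2) (π' := 4) (by norm_num) two_ne (fun s hs => hS s (hS2 hs))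
      (fun x hx y hy => hB x (hS2 hx) y (hS2 hy)) with h | ⟨c4, hc4, S3, hS3, N3⟩
    · rcases N2.step2 (π := 4) (π' := 8) (by norm_num) four_ne h (T := 4 * m) ⟨m, by ring⟩
        (((), ⟨0, z0⟩), 0) (by simp) with h' | h' | ⟨c3, hc3, S3, hS3, -, N3⟩ | ⟨S3, hS3, h4, N3⟩
      · exact h'
      · rcases even_or_unit m with ⟨h0, rfl⟩ | hm
        · rcases N2.step2 (π := 8) (π' := 16) (by norm_num) eight_ne h' (T := 4 * (2 * h0))
            ⟨h0, by ring⟩ (((), ⟨0, z0⟩), 0) (by simp) with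
            h'' | h'' | ⟨c4, hc4, S3, hS3, -, N3⟩ | ⟨S3, hS3, h4, N3⟩
          · exact h''
          · exfalso
            obtain ⟨a, s, hs, h1⟩ := N2.univ (10 * c2)
            obtain ⟨k, hk⟩ := h'' s hs
            exact nc_A2 (k := k) a.1.2.2 hc2 (y := a.2) (by linear_combination h1 - hk)
          · obtain ⟨z, hz, hz1⟩ := N3.exists_prim
            obtain ⟨d, hd⟩ := h' z (hS3 hz)
            obtain ⟨ρ, y, w, u, h1, h2, h3⟩ := lemX hc2 hc4 d h0
            refine (N3.real ((((), ⟨_, h1.four.four⟩), 2 * y), w) (u • z) (S3.smul_mem _ hz)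
              ?_).of_eq ?_
            · exact h2.imp (fun h => Or.inr h) (fun h => prim_smul hz1 h)
            · dsimp only
              rw [QuadraticMap.map_smul, hd, smul_eq_mul]
              linear_combination -8 * h3
          · refine (N3.planeFin' 8 (((), ⟨0, z0⟩), 0) (((), ⟨0, z0⟩), 2) (fun _ _ h => Or.inr h)
              (by intro r; dsimp only; ring) hc2
              (by intro r; dsimp only; ring) h0).of_eq (by ring)
        · obtain ⟨z, hz, hz1⟩ := N2.exists_prim
          obtain ⟨d, hd⟩ := h' z hz
          refine (N2.real (((), ⟨_, (Ev.unit (unit_sub_even (k := d) hm)).four⟩), 0) z hz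
            (Or.inr hz1)).of_eq ?_
          dsimp only
          rw [hd]; ring
      · obtain ⟨ρ, y, z, h1, h2, h3⟩ := lemW hc2 hc3 m
        refine (N3.real ((((), ⟨_, h1.four⟩), 2 * y), z) 0 (zero_mem _)
          (Or.inl (Or.inr h2))).of_eq ?_
        dsimp only
        rw [QuadraticMap.map_zero]
        linear_combination -4 * h3
      · exact N3.planeFin' 4 (((), ⟨0, z0⟩), 0) (((), ⟨_, (Ev.unit isUnit_one).four⟩), 0) (fun _ _ h => Or.inr h)
              (by intro r; dsimp only; ring)
          isUnit_one (by intro r; dsimp only; ring) m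
    · obtain ⟨z, hz, hz1⟩ := N3.exists_prim
      obtain ⟨d, hd⟩ := hS z (hS2 (hS3 hz))
      obtain ⟨ρ, y, w, u, h1, h2, h3⟩ := lemX hc2 hc4 d (2 * m)
      refine (N3.real ((((), ⟨_, h1.four⟩), y), w) (u • z) (S3.smul_mem _ hz) ?_).of_eq ?_
      · exact h2.imp (fun h => Or.inr h) (fun h => prim_smul hz1 h)
      · dsimp only
        rw [QuadraticMap.map_smul, hd, smul_eq_mul]
        linear_combination -2 * h3
  · obtain ⟨z, hz, hz1⟩ := N2.exists_prim
    obtain ⟨d, hd⟩ := h4 z hz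
    obtain ⟨ρ, ρ', h1, h2, h3⟩ := PP_univ (m - d)
    refine (N2.real (((), ⟨_, h1.four⟩), ⟨_, h2.four⟩) z hz (Or.inr hz1)).of_eq ?_
    dsimp only
    rw [hd]
    linear_combination -4 * h3

theorem caseB0 {c1 : ℤ_[2]} (hc1 : IsUnit c1)
    (N : Node Q (fun a : Unit × ℤ_[2] => 0 + 1 * c1 * a.2 ^ 2)
    (fun a => False ∨ IsUnit a.2) S 4) (hS : ∀ s ∈ S, 2 ∣ Q s) (m : ℤ_[2]) :
    Rep Q (4 * m) := by
  have z0 : Ev 0 := Ev.zero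
  rcases N.step2 (π := 2) (π' := 4) (by norm_num) two_ne hS (T := 4 * m) ⟨2 * m, by ring⟩
    ((), 0) (by simp) with h | h | ⟨c2, hc2, S2, hS2, hB, N2⟩ | ⟨S2, hS2, h4, N2⟩
  · exact h
  · exfalso
    obtain ⟨a, s, hs, h1⟩ := N.univ 2
    obtain ⟨k, hk⟩ := h s hs
    exact nc_B0 hc1 (x := a.2) (k := k) (by linear_combination h1 - hk)
  · -- B0c
    rcases N2.stepB (π := 2) (π' := 4) (by norm_num) two_ne (fun s hs => hS s (hS2 hs))
      (fun x hx y hy => hB x (hS2 hx) y (hS2 hy)) with h | ⟨c3, hc3, S3, hS3, N3⟩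
    · -- β
      rcases N2.step2 (π := 4) (π' := 8) (by norm_num) four_ne h (T := 4 * m) ⟨m, by ring⟩
        (((), 0), 0) (by simp) with h' | h' | ⟨c3, hc3, S3, hS3, hB3, N3⟩ | ⟨S3, hS3, h4, N3⟩
      · exact h'
      · exfalso
        obtain ⟨t, ht⟩ := nc_α hc1 hc2 hc2
        obtain ⟨a, s, hs, h1⟩ := N2.univ t
        obtain ⟨k, hk⟩ := h' s hs
        exact ht a.1.2 a.2 0 k (by linear_combination h1 - hk)
      · rcases even_or_unit m with ⟨h0, rfl⟩ | hm
        · rcases N3.stepB (π := 4) (π' := 8) (by norm_num) four_ne (fun s hs => h s (hS3 hs))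
            (fun x hx y hy => hB3 x (hS3 hx) y (hS3 hy)) with h5 | ⟨c4, hc4, S4, hS4, N4⟩
          · rcases N3.step2 (π := 8) (π' := 16) (by norm_num) eight_ne h5 (T := 4 * (2 * h0))
              ⟨h0, by ring⟩ ((((), 0), 0), 0) (by simp) with
              h'' | h'' | ⟨c4, hc4, S4, hS4, -, N4⟩ | ⟨S4, hS4, h4, N4⟩
            · exact h''
            · exfalso
              obtain ⟨t, ht⟩ := nc_α hc2 hc1 hc3
              obtain ⟨a, s, hs, h1⟩ := N3.univ (2 * t)
              obtain ⟨k, hk⟩ := h'' s hs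
              rcases even_or_unit a.1.1.2 with ⟨x, hx⟩ | hx
              · rw [hx] at h1
                refine ht a.1.2 x a.2 k (mul_left_cancel₀ two_ne ?_)
                linear_combination h1 - hk
              · have := hc1.mul (hx.pow 2)
                refine not_unit_two_mul (t - c2 * a.1.2 ^ 2 - 2 * c3 * a.2 ^ 2 - 8 * k) ?_
                convert this using 1
                linear_combination hk - h1
            · obtain ⟨z, hz, hz1⟩ := N4.exists_prim
              obtain ⟨d, hd⟩ := h5 z (hS4 hz)
              obtain ⟨x, v, y, w, u, h2, h3⟩ := lemY hc1 hc3 hc2 hc4 d h0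
              refine (N4.real (((((), 4 * x), 2 * y), 2 * v), w) (u • z) (S4.smul_mem _ hz)
                ?_).of_eq ?_
              · exact h2.imp (fun h => Or.inr h) (fun h => prim_smul hz1 h)
              · dsimp only
                rw [QuadraticMap.map_smul, hd, smul_eq_mul]
                linear_combination -8 * h3
            · refine (N4.planeFin' 8 ((((), 0), 0), 0) ((((), 0), 2), 0) (fun _ _ h => Or.inr h)
              (by intro r; dsimp only; ring) hc2
                (by intro r; dsimp only; ring) h0).of_eq (by ring)
          · obtain ⟨s, hs⟩ := unit_sub_unit (even_sub_unit (k := h0) hc4) hc3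
            obtain ⟨x, y, z, hx, h1⟩ := solve4 hc3 hc1 hc2 hs
            refine (N4.real (((((), 4 * y), 2 * z), x), 1) 0 (zero_mem _)
              (Or.inl (Or.inr isUnit_one))).of_eq ?_
            dsimp only
            rw [QuadraticMap.map_zero]
            linear_combination -4 * h1
        · obtain ⟨s, hs⟩ := unit_sub_unit hm hc3
          obtain ⟨x, y, z, hx, h1⟩ := solve4 hc3 hc1 hc2 hs
          refine (N3.real ((((), 4 * y), 2 * z), x) 0 (zero_mem _)
            (Or.inl (Or.inr hx))).of_eq ?_
          dsimp only
          rw [QuadraticMap.map_zero]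
          linear_combination -4 * h1
      · exact N3.planeFin' 4 (((), 0), 0) (((), 2), 0) (fun _ _ h => Or.inr h)
              (by intro r; dsimp only; ring) hc1 (by intro r; dsimp only; ring) m
    · -- α
      rcases N3.stepB (π := 2) (π' := 4) (by norm_num) two_ne (fun s hs => hS s (hS2 (hS3 hs)))
        (fun x hx y hy => hB x (hS2 (hS3 hx)) y (hS2 (hS3 hy))) with h | ⟨c4, hc4, S4, hS4, N4⟩
      · rcases N3.step2 (π := 4) (π' := 8) (by norm_num) four_ne h (T := 4 * m) ⟨m, by ring⟩
          ((((), 0), 0), 0) (by simp) with h' | h' | ⟨c4, hc4, S4, hS4, -, N4⟩ | ⟨S4, hS4, h4, N4⟩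
        · exact h'
        · exfalso
          obtain ⟨t, ht⟩ := nc_α hc1 hc2 hc3
          obtain ⟨a, s, hs, h1⟩ := N3.univ t
          obtain ⟨k, hk⟩ := h' s hs
          exact ht a.1.1.2 a.1.2 a.2 k (by linear_combination h1 - hk)
        · obtain ⟨z, hz, hz1⟩ := N4.exists_prim
          obtain ⟨d, hd⟩ := h z (hS4 hz)
          obtain ⟨x, w, y, v, h3⟩ := E_univ hc1 hc4 hc2 hc3 (m - d)
          refine (N4.real (((((), 2 * x), 2 * y), 2 * v), w) z hz (Or.inr hz1)).of_eq ?_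
          dsimp only
          rw [hd]
          linear_combination -4 * h3
        · exact N4.planeFin' 4 ((((), 0), 0), 0) ((((), 2), 0), 0) (fun _ _ h => Or.inr h)
              (by intro r; dsimp only; ring) hc1 (by intro r; dsimp only; ring) m
      · obtain ⟨s, hs⟩ := unit_sub_unit (even_sub_unit (k := m) hc3) hc4
        obtain ⟨x, y, z, hx, h1⟩ := solve4 hc4 hc2 hc1 hs
        refine (N4.real (((((), 2 * z), 2 * y), 1), x) 0 (zero_mem _)
          (Or.inl (Or.inr hx))).of_eq ?_
        dsimp only
        rw [QuadraticMap.map_zero]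
        linear_combination -2 * h1
  · -- B0P
    rcases N2.step2 (π := 4) (π' := 8) (by norm_num) four_ne h4 (T := 4 * m) ⟨m, by ring⟩
        (((), 0), ⟨0, z0⟩) (by simp) with h' | h' | ⟨c3, hc3, S3, hS3, -, N3⟩ | ⟨S3, hS3, h4, N3⟩
    · exact h'
    · exfalso
      obtain ⟨a, s, hs, h1⟩ := N2.univ (5 * c1)
      obtain ⟨k, hk⟩ := h' s hs
      exact nc_B0P hc1 a.2.2 (x := a.1.2) (k := k) (by linear_combination h1 - hk)
    · obtain ⟨z, hz, hz1⟩ := N3.exists_prim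
      obtain ⟨d, hd⟩ := h4 z (hS3 hz)
      obtain ⟨ρ, y, w, u, h1, h2, h3⟩ := lemX hc1 hc3 d m
      refine (N3.real ((((), 2 * y), ⟨_, h1.four⟩), w) (u • z) (S3.smul_mem _ hz) ?_).of_eq ?_
      · exact h2.imp (fun h => Or.inr h) (fun h => prim_smul hz1 h)
      · dsimp only
        rw [QuadraticMap.map_smul, hd, smul_eq_mul]
        linear_combination -4 * h3
    · exact N3.planeFin' 4 (((), 0), ⟨0, z0⟩) (((), 2), ⟨0, z0⟩) (fun _ _ h => Or.inr h)
              (by intro r; dsimp only; ring) hc1 (by intro r; dsimp only; ring) m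
end tree
end LocalPart
namespace LocalPart
section tree
variable {M : Type*} [AddCommGroup M] [Module ℤ_[2] M]
variable {Q : QuadraticMap ℤ_[2] M ℤ_[2]} {S : Submodule ℤ_[2] M}

theorem caseB1 {c1 c2 : ℤ_[2]} (hc1 : IsUnit c1) (hc2 : IsUnit c2)
    (N : Node Q (fun a : (Unit × ℤ_[2]) × ℤ_[2] => 0 + 1 * c1 * a.1.2 ^ 2 + 1 * c2 * a.2 ^ 2)
    (fun a => (False ∨ IsUnit a.1.2) ∨ IsUnit a.2) S 3) (hS : ∀ s ∈ S, 2 ∣ Q s) (m : ℤ_[2]) :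
    Rep Q (4 * m) := by
  have z0 : Ev 0 := Ev.zero
  rcases N.step2 (π := 2) (π' := 4) (by norm_num) two_ne hS (T := 4 * m) ⟨2 * m, by ring⟩
    (((), 0), 0) (by simp) with h | h | ⟨c3, hc3, S2, hS2, hB, N2⟩ | ⟨S2, hS2, h4, N2⟩
  · exact h
  · exfalso
    obtain ⟨t, ht⟩ := nc_B1 hc1 hc2
    obtain ⟨a, s, hs, h1⟩ := N.univ t
    obtain ⟨k, hk⟩ := h s hs
    exact ht a.1.2 a.2 k (by linear_combination h1 - hk)
  · rcases N2.stepB (π := 2) (π' := 4) (by norm_num) two_ne (fun s hs => hS s (hS2 hs))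
      (fun x hx y hy => hB x (hS2 hx) y (hS2 hy)) with h | ⟨c4, hc4, S3, hS3, N3⟩
    · rcases N2.step2 (π := 4) (π' := 8) (by norm_num) four_ne h (T := 4 * m) ⟨m, by ring⟩
        ((((), 0), 0), 0) (by simp) with h' | h' | ⟨c4, hc4, S3, hS3, hB3, N3⟩ | ⟨S3, hS3, h4, N3⟩
      · exact h'
      · obtain ⟨z, hz, hz1⟩ := N2.exists_prim
        rcases even_or_unit m with ⟨h0, rfl⟩ | hm
        · rcases N2.step2 (π := 8) (π' := 16) (by norm_num) eight_ne h' (T := 4 * (2 * h0))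
              ⟨h0, by ring⟩ ((((), 0), 0), 0) (by simp) with
              h'' | h'' | ⟨c4, hc4, S4, hS4, -, N4⟩ | ⟨S4, hS4, h4, N4⟩
          · exact h''
          · obtain ⟨d, hd⟩ := h'' z hz
            obtain ⟨⟨x, y, w⟩, h1⟩ := A3_univ hc1 hc2 hc3 (fun t => by
              obtain ⟨a, s, hs, h1⟩ := N2.univ t
              obtain ⟨k, hk⟩ := h'' s hs
              exact ⟨a.1.1.2, a.1.2, a.2, k, by linear_combination hk - h1⟩) (8 * h0 - 16 * d)
            refine (N2.real ((((), x), y), w) z hz (Or.inr hz1)).of_eq ?_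
            dsimp only at h1 ⊢
            rw [hd]
            linear_combination - h1
          · obtain ⟨z, hz, hz1⟩ := N4.exists_prim
            obtain ⟨d, hd⟩ := h' z (hS4 hz)
            obtain ⟨x, v, y, w, u, h2, h3⟩ := lemY hc1 hc2 hc3 hc4 d h0
            refine (N4.real (((((), 4 * x), 4 * v), 2 * y), w) (u • z) (S4.smul_mem _ hz)
              ?_).of_eq ?_
            · exact h2.imp (fun h => Or.inr h) (fun h => prim_smul hz1 h)
            · dsimp only
              rw [QuadraticMap.map_smul, hd, smul_eq_mul]
              linear_combination -8 * h3
          · refine (N4.planeFin' 8 ((((), 0), 0), 0) ((((), 0), 0), 2) (fun _ _ h => Or.inr h)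
              (by intro r; dsimp only; ring) hc3 (by intro r; dsimp only; ring) h0).of_eq (by ring)
        · obtain ⟨d, hd⟩ := h' z hz
          obtain ⟨s, hs⟩ := unit_sub_unit (unit_sub_even (k := d) hm) hc1
          obtain ⟨x, y, w, hx, h1⟩ := solve4 hc1 hc2 hc3 hs
          refine (N2.real ((((), 2 * x), 4 * y), 2 * w) z hz (Or.inr hz1)).of_eq ?_
          dsimp only
          rw [hd]
          linear_combination -4 * h1
      · rcases even_or_unit m with ⟨h0, rfl⟩ | hm
        · obtain ⟨s, hs⟩ := unit_sub_unit (even_sub_unit (k := h0) hc2) hc4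
          obtain ⟨x, y, z, hx, h1⟩ := solve4 hc4 hc1 hc3 hs
          refine (N3.real (((((), 4 * y), 2), 2 * z), x) 0 (zero_mem _)
            (Or.inl (Or.inr hx))).of_eq ?_
          dsimp only
          rw [QuadraticMap.map_zero]
          linear_combination -4 * h1
        · obtain ⟨s, hs⟩ := unit_sub_unit hm hc4
          obtain ⟨x, y, z, hx, h1⟩ := solve4 hc4 hc1 hc3 hs
          refine (N3.real (((((), 4 * y), 0), 2 * z), x) 0 (zero_mem _)
            (Or.inl (Or.inr hx))).of_eq ?_
          dsimp only
          rw [QuadraticMap.map_zero]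
          linear_combination -4 * h1
      · exact N3.planeFin' 4 ((((), 0), 0), 0) ((((), 2), 0), 0) (fun _ _ h => Or.inr h)
              (by intro r; dsimp only; ring) hc1 (by intro r; dsimp only; ring) m
    · obtain ⟨z, hz, hz1⟩ := N3.exists_prim
      obtain ⟨d, hd⟩ := hS z (hS2 (hS3 hz))
      rcases even_or_unit d with ⟨d, rfl⟩ | hdu
      · obtain ⟨x, w, y, v, h3⟩ := E_univ hc1 hc2 hc3 hc4 (m - d)
        refine (N3.real (((((), 2 * x), 2 * w), 2 * y), 2 * v) z hz (Or.inr hz1)).of_eq ?_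
        dsimp only
        rw [hd]
        linear_combination -4 * h3
      · obtain ⟨s, hs⟩ := unit_sub_unit (even_sub_unit (k := m) hc3) hc4
        obtain ⟨x, y, w, hx, h1⟩ := solve4 hc4 hdu hc1 hs
        refine (N3.real (((((), 2 * w), 0), 1), x) ((2 * y) • z) (S3.smul_mem _ hz)
          (Or.inl (Or.inr hx))).of_eq ?_
        dsimp only
        rw [QuadraticMap.map_smul, hd, smul_eq_mul]
        linear_combination -2 * h1
  · obtain ⟨z, hz, hz1⟩ := N2.exists_prim
    obtain ⟨d, hd⟩ := h4 z hz
    obtain ⟨ρ, y, w, h1, h3⟩ := f2_univ hc1 hc2 (m - d)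
    refine (N2.real ((((), 2 * y), 2 * w), ⟨_, h1.four⟩) z hz (Or.inr hz1)).of_eq ?_
    dsimp only
    rw [hd]
    linear_combination -4 * h3

lemma mod4 {a b : ℤ_[2]} (ha : IsUnit a) (hb : IsUnit b) :
    (∃ k, a + b = 4 * k) ∨ ∃ k, b = a + 4 * k := by
  obtain ⟨k, rfl⟩ := unit_odd ha
  obtain ⟨l, rfl⟩ := unit_odd hb
  rcases even_or_unit k with ⟨k, rfl⟩ | hk <;> rcases even_or_unit l with ⟨l, rfl⟩ | hl
  · exact Or.inr ⟨l - k, by ring⟩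
  · obtain ⟨l, rfl⟩ := unit_odd hl
    exact Or.inl ⟨k + l + 1, by ring⟩
  · obtain ⟨k, rfl⟩ := unit_odd hk
    exact Or.inl ⟨k + l + 1, by ring⟩
  · obtain ⟨l, rfl⟩ := unit_odd hl
    obtain ⟨k, rfl⟩ := unit_odd hk
    exact Or.inr ⟨l - k, by ring⟩

theorem caseB2 {c1 c2 c3 : ℤ_[2]} (hc1 : IsUnit c1) (hc2 : IsUnit c2) (hc3 : IsUnit c3)
    (N : Node Q (fun a : ((Unit × ℤ_[2]) × ℤ_[2]) × ℤ_[2] =>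
      0 + 1 * c1 * a.1.1.2 ^ 2 + 1 * c2 * a.1.2 ^ 2 + 1 * c3 * a.2 ^ 2)
    (fun a => ((False ∨ IsUnit a.1.1.2) ∨ IsUnit a.1.2) ∨ IsUnit a.2) S 2)
    (hB : ∀ x ∈ S, ∀ y ∈ S, 2 ∣ QuadraticMap.polar Q x y) (m : ℤ_[2]) :
    Rep Q (4 * m) := by
  have one : IsUnit (1 : ℤ_[2]) := isUnit_one
  rcases mod4 hc1 hc2 with ⟨k, hk⟩ | ⟨k, hk⟩
  · obtain ⟨x, z, hx, h⟩ := lem3 (m := m) (e := 0) hc1 hc3 ((add_zero _).trans hk)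
    refine (N.real ((((), x), 1), 2 * z) 0 (zero_mem _) (Or.inl (by tauto))).of_eq ?_
    dsimp only
    rw [QuadraticMap.map_zero]; linear_combination -h
  rcases mod4 hc1 hc3 with ⟨l, hl⟩ | ⟨l, hl⟩
  · obtain ⟨x, z, hx, h⟩ := lem3 (m := m) (e := 0) hc1 hc2 ((add_zero _).trans hl)
    refine (N.real ((((), x), 2 * z), 1) 0 (zero_mem _) (Or.inl (by tauto))).of_eq ?_
    dsimp only
    rw [QuadraticMap.map_zero]; linear_combination -h
  obtain ⟨c1', hc1'⟩ := unit_odd hc1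
  have hodd : ∀ q, IsUnit q → ∀ s ∈ S, Q s = 2 * q → Rep Q (4 * m) := by
    intro q hq s hs hQ
    obtain ⟨q', hq'⟩ := unit_odd hq
    obtain ⟨x, z, hx, h⟩ := lem3 (m := m) (b := c2) (e := Q s) (k := c1' + q' + 1 + k) hc1 hc3 (by
      rw [hQ, hk, hq', hc1']; ring)
    refine (N.real ((((), x), 1), 2 * z) s hs (Or.inl (by tauto))).of_eq ?_
    dsimp only
    linear_combination -h
  rcases N.stepB (π := 1) (π' := 2) (by norm_num) one_ne_zero (fun s hs => one_dvd _) hB with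
    h | ⟨c4, hc4, S2, hS2, N2⟩
  · by_cases h4 : ∀ s ∈ S, 4 ∣ Q s
    · rcases N.step2 (π := 4) (π' := 8) (by norm_num) four_ne h4 (T := 4 * m) ⟨m, by ring⟩
        ((((), 0), 0), 0) (by simp) with h' | h' | ⟨c4, hc4, S3, hS3, hB3, N3⟩ | ⟨S3, hS3, h5, N3⟩
      · exact h'
      · exfalso
        obtain ⟨a, s, hs, h1⟩ := N.univ (c1 + c2 + c3 + 4)
        obtain ⟨q, hq⟩ := h' s hs
        exact nc_B2 (x := a.1.1.2) (y := a.1.2) (z := a.2) (q := q) hc1 hk hl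
          (by linear_combination h1 - hq)
      · obtain ⟨z, hz, hz1⟩ := N3.exists_prim
        obtain ⟨d, hd⟩ := h4 z (hS3 hz)
        obtain ⟨⟨x, y, w, u⟩, h1⟩ := G_univ hc1 hc4 hk hl (m - d)
        refine (N3.real (((((), 2 * x), 2 * y), 2 * w), u) z hz (Or.inr hz1)).of_eq ?_
        dsimp only at h1 ⊢
        rw [hd]
        linear_combination - 4 * h1
      · exact N3.planeFin' 4 ((((), 0), 0), 0) ((((), 2), 0), 0) (fun _ _ h => Or.inr h)
              (by intro r; dsimp only; ring) hc1 (by intro r; dsimp only; ring) m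
    · push Not at h4
      obtain ⟨s, hs, hn⟩ := h4
      obtain ⟨q, hq⟩ := h s hs
      rcases even_or_unit q with ⟨q, rfl⟩ | hqu
      · exact absurd ⟨q, by rw [hq]; ring⟩ hn
      · exact hodd q hqu s hs hq
  · rcases mod4 hc1 hc4 with ⟨j, hj⟩ | ⟨j, hj⟩
    · obtain ⟨x, z, hx, h⟩ := lem3 (m := m) (e := 0) hc1 hc2 ((add_zero _).trans hj)
      refine (N2.real (((((), x), 2 * z), 0), 1) 0 (zero_mem _) (Or.inl (by tauto))).of_eq ?_
      dsimp only
      rw [QuadraticMap.map_zero]; linear_combination -h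
    obtain ⟨z0, hz0, hz1⟩ := N2.exists_prim
    rcases even_or_unit (Q z0) with ⟨q, hq⟩ | hq
    · rcases even_or_unit q with ⟨q, rfl⟩ | hqu
      · obtain ⟨⟨x, y, w, u⟩, h1⟩ := G_univ hc1 hc4 hk hl (m - q)
        refine (N2.real (((((), 2 * x), 2 * y), 2 * w), 2 * u) z0 hz0 (Or.inr hz1)).of_eq ?_
        dsimp only at h1 ⊢
        rw [hq]
        linear_combination - 4 * h1
      · exact hodd q hqu z0 (hS2 hz0) hq
    · rcases mod4 hc1 hq with ⟨i, hi⟩ | ⟨i, hi⟩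
      · obtain ⟨x, z, hx, h⟩ := lem3 (m := m) (e := 0) hc1 hc2 ((add_zero _).trans hi)
        refine (N2.real (((((), x), 2 * z), 0), 0) z0 hz0 (Or.inl (by tauto))).of_eq ?_
        dsimp only
        linear_combination -h
      · obtain ⟨x, z, hx, h⟩ := lem3 (m := m) (b := c2) (e := c3 + c4) (k := c1 + k + l + j) hc1 hq (by
          rw [hk, hl, hj]; ring)
        refine (N2.real (((((), x), 1), 1), 1) ((2 * z) • z0) (S2.smul_mem _ hz0)
          (Or.inl (by tauto))).of_eq ?_
        dsimp only
        rw [QuadraticMap.map_smul, smul_eq_mul]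
        linear_combination -h

theorem local_two (hQ : ∀ t, ∃ x, Q x = t) (hbig : Big (p := 2) 5 (⊤ : Submodule ℤ_[2] M))
    (m : ℤ_[2]) : Rep Q (4 * m) := by
  have N0 : Node Q (fun _ : Unit => 0) (fun _ => False) ⊤ 5 := by
    refine ⟨fun t => ?_, fun a s _ h => ?_, hbig, fun _ _ => trivial⟩
    · obtain ⟨x, hx⟩ := hQ t
      exact ⟨(), x, trivial, by rw [zero_add, hx]⟩
    · exact ⟨s, h.resolve_left id, by rw [zero_add]⟩
  rcases N0.step2 (π := 1) (π' := 2) (by norm_num) one_ne_zero (fun s _ => one_dvd _) (T := 4 * m)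
    (one_dvd _) () rfl with h | h | ⟨c1, hc1, S1, hS1, hB, N1⟩ | ⟨S1, hS1, h4, N1⟩
  · exact h
  · exfalso
    obtain ⟨x, hx⟩ := hQ 1
    obtain ⟨k, hk⟩ := h x trivial
    exact not_unit_two_mul k (by rw [← hk, hx]; exact isUnit_one)
  · rcases N1.stepB (π := 1) (π' := 2) (by norm_num) one_ne_zero (fun s hs => one_dvd _)
      (fun x hx y hy => hB x (hS1 hx) y (hS1 hy)) with h | ⟨c2, hc2, S2, hS2, N2⟩
    · exact caseB0 hc1 N1 h m
    · rcases N2.stepB (π := 1) (π' := 2) (by norm_num) one_ne_zero (fun s hs => one_dvd _)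
        (fun x hx y hy => hB x trivial y trivial) with h | ⟨c3, hc3, S3, hS3, N3⟩
      · exact caseB1 hc1 hc2 N2 h m
      · exact caseB2 hc1 hc2 hc3 N3 (fun x hx y hy => hB x trivial y trivial) m
  · exact caseA N1 h4 m
end tree
end LocalPart
namespace LocalPart

lemma big_top {p : ℕ} [hp : Fact p.Prime] {n : ℕ} (hn : 5 ≤ n) :
    Big (p := p) 5 (⊤ : Submodule ℤ_[p] (Fin n → ℤ_[p])) := by
  intro l hl
  let Φ : (Fin n → ℤ_[p]) →ₗ[ℤ_[p]] (Fin l.length → ℤ_[p]) := LinearMap.pi (fun i => l.get i)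
  have hni : ¬ Function.Injective Φ := fun h => by
    have := le_of_fin_injective ℤ_[p] Φ h
    omega
  have : ∃ z, Φ z = 0 ∧ z ≠ 0 := by
    by_contra hcon
    push Not at hcon
    exact hni ((injective_iff_map_eq_zero Φ).2 hcon)
  obtain ⟨z, hz, hz0⟩ := this
  have hz' : ∀ φ ∈ l, φ z = 0 := by
    intro φ hφ
    obtain ⟨i, rfl⟩ := List.get_of_mem hφ
    exact congrFun hz i
  obtain ⟨i, hi⟩ := Function.ne_iff.1 hz0
  have hdiv : ∃ k : ℕ, ¬ (p : ℤ_[p]) ^ k ∣ z i := by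
    obtain ⟨k, u, hu, h⟩ := val_decomp (p := p) (x := z i) hi
    refine ⟨k + 1, fun hd => ?_⟩
    rw [h, pow_succ] at hd
    have := (mul_dvd_mul_iff_left (pow_ne_zero k (pne (p := p)))).1 hd
    exact PadicInt.prime_p.not_isUnit (isUnit_of_dvd_unit this hu)
  obtain ⟨k, hk⟩ := hdiv
  clear hz hz0 hi
  induction k generalizing z with
  | zero => simp at hk
  | succ k ih =>
    by_cases hP : Prim p z
    · exact ⟨z, trivial, hP, hz'⟩
    · unfold Prim at hP
      push Not at hP
      obtain ⟨y, rfl⟩ := hP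
      refine ih y (fun φ hφ => ?_) (fun hd => hk ?_)
      · have := hz' φ hφ
        rw [map_smul, smul_eq_mul] at this
        exact (mul_eq_zero.1 this).resolve_left pne
      · rw [pow_succ, mul_comm, Pi.smul_apply, smul_eq_mul]
        exact mul_dvd_mul_left _ hd

theorem local_main {p : ℕ} [hp : Fact p.Prime] {n : ℕ} (hn : 5 ≤ n)
    (Q : QuadraticMap ℤ_[p] (Fin n → ℤ_[p]) ℤ_[p]) (hQ : ∀ t, ∃ x, Q x = t) (m : ℤ_[p]) :
    Rep Q m := by
  by_cases hd : (p : ℤ_[p]) ^ 2 ∣ m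
  · obtain ⟨k, rfl⟩ := hd
    by_cases hp2 : p = 2
    · subst hp2
      have := local_two hQ (big_top hn) k
      convert this using 2
      norm_num
    · exact local_odd hp2 hQ (big_top hn) k
  · obtain ⟨x, hx⟩ := hQ m
    refine ⟨x, fun y hy => hd ⟨Q y, ?_⟩, hx⟩
    rw [← hx, hy, QuadraticMap.map_smul, smul_eq_mul]; ring
end LocalPart
namespace HM

def Iso3 (K : Type*) [Field K] (a b c : K) : Prop :=
  ∃ x y z : K, (x ≠ 0 ∨ y ≠ 0 ∨ z ≠ 0) ∧ a * x ^ 2 + b * y ^ 2 + c * z ^ 2 = 0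

section basic
variable {K : Type*} [Field K] {a b c : K}

lemma Iso3.swap12 (h : Iso3 K a b c) : Iso3 K b a c := by
  obtain ⟨x, y, z, h0, h1⟩ := h
  exact ⟨y, x, z, by tauto, by linear_combination h1⟩

lemma Iso3.swap23 (h : Iso3 K a b c) : Iso3 K a c b := by
  obtain ⟨x, y, z, h0, h1⟩ := h
  exact ⟨x, z, y, by tauto, by linear_combination h1⟩

lemma Iso3.scale (h : Iso3 K a b c) (k : K) : Iso3 K (k * a) (k * b) (k * c) := by
  obtain ⟨x, y, z, h0, h1⟩ := h
  exact ⟨x, y, z, h0, by linear_combination k * h1⟩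

lemma Iso3.unscale {k : K} (hk : k ≠ 0) (h : Iso3 K (k * a) (k * b) (k * c)) : Iso3 K a b c := by
  have := h.scale k⁻¹
  simpa [inv_mul_cancel_left₀ hk] using this

lemma Iso3.sq1 {s : K} (hs : s ≠ 0) : Iso3 K (a * s ^ 2) b c ↔ Iso3 K a b c := by
  constructor
  · rintro ⟨x, y, z, h0, h1⟩
    exact ⟨s * x, y, z, by simpa [hs] using h0, by linear_combination h1⟩
  · rintro ⟨x, y, z, h0, h1⟩
    refine ⟨s⁻¹ * x, y, z, by simpa [hs] using h0, ?_⟩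
    rw [← h1]
    field_simp

lemma Iso3.sq2 {s : K} (hs : s ≠ 0) : Iso3 K a (b * s ^ 2) c ↔ Iso3 K a b c :=
  ⟨fun h => ((Iso3.sq1 hs).1 h.swap12).swap12, fun h => ((Iso3.sq1 hs).2 h.swap12).swap12⟩

lemma Iso3.sq3 {s : K} (hs : s ≠ 0) : Iso3 K a b (c * s ^ 2) ↔ Iso3 K a b c :=
  ⟨fun h => ((Iso3.sq2 hs).1 h.swap23).swap23, fun h => ((Iso3.sq2 hs).2 h.swap23).swap23⟩

lemma Iso3.norm (hc : c ≠ 0) : Iso3 K a b c ↔ Iso3 K (-(a * c)) (-(b * c)) (-1) := by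
  rw [← Iso3.sq3 (c := -1) hc]
  constructor
  · intro h
    have := h.scale (-c)
    convert this using 1 <;> ring
  · intro h
    apply Iso3.unscale (k := -c) (neg_ne_zero.2 hc)
    convert h using 1 <;> ring

lemma Iso3.transfer {b' t : K} (hb : b ≠ 0) (ht : t ^ 2 = a + b * b') (h : Iso3 K a b (-1)) :
    Iso3 K a b' (-1) := by
  obtain ⟨x, y, z, h0, h1⟩ := h
  by_cases hy : y = 0
  · exact ⟨x, 0, z, by simpa [hy] using h0, by rw [hy] at h1; linear_combination h1⟩
  · refine ⟨z + t * x, b * y, z * t + a * x, Or.inr (Or.inl (mul_ne_zero hb hy)), ?_⟩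
    linear_combination (b' * b) * h1 + (a * x ^ 2 - z ^ 2) * ht

lemma Iso3.map {L : Type*} [Field L] (f : K →+* L) (h : Iso3 K a b c) :
    Iso3 L (f a) (f b) (f c) := by
  obtain ⟨x, y, z, h0, h1⟩ := h
  refine ⟨f x, f y, f z, by simpa using h0, ?_⟩
  have := congrArg f h1
  simpa using this
end basic

section padic
variable {p : ℕ} [hp : Fact p.Prime]

lemma Iso3.primitive {a b c : ℤ_[p]} (h : Iso3 ℚ_[p] a b c) : ∃ x y z : ℤ_[p],
    (IsUnit x ∨ IsUnit y ∨ IsUnit z) ∧ a * x ^ 2 + b * y ^ 2 + c * z ^ 2 = 0 := by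
  obtain ⟨x, y, z, h0, h1⟩ := h
  have key : ∀ w : ℚ_[p], w ≠ 0 → ‖x‖ ≤ ‖w‖ → ‖y‖ ≤ ‖w‖ → ‖z‖ ≤ ‖w‖ → (w = x ∨ w = y ∨ w = z) →
      ∃ x y z : ℤ_[p], (IsUnit x ∨ IsUnit y ∨ IsUnit z) ∧ a * x ^ 2 + b * y ^ 2 + c * z ^ 2 = 0 := by
    intro w hw hx hy hz hor
    have hw' : 0 < ‖w‖ := norm_pos_iff.2 hw
    have hd : ∀ v : ℚ_[p], ‖v‖ ≤ ‖w‖ → ‖v / w‖ ≤ 1 := fun v hv => by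
      rw [norm_div]; exact (div_le_one hw').2 hv
    have hX : ∀ v : ℚ_[p], ‖v‖ ≤ ‖w‖ → ∃ V : ℤ_[p], (V : ℚ_[p]) = v / w := fun v hv => ⟨⟨v / w, hd v hv⟩, rfl⟩
    obtain ⟨X, hX1⟩ := hX x hx
    obtain ⟨Y, hY1⟩ := hX y hy
    obtain ⟨Z, hZ1⟩ := hX z hz
    refine ⟨X, Y, Z, ?_, ?_⟩
    · rw [PadicInt.isUnit_iff, PadicInt.isUnit_iff, PadicInt.isUnit_iff, PadicInt.norm_def,
        PadicInt.norm_def, PadicInt.norm_def, hX1, hY1, hZ1]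
      rcases hor with rfl | rfl | rfl
      · left; rw [div_self hw, norm_one]
      · right; left; rw [div_self hw, norm_one]
      · right; right; rw [div_self hw, norm_one]
    · apply Subtype.coe_injective
      push_cast
      rw [hX1, hY1, hZ1]
      field_simp
      simpa using h1
  have hpos : 0 < ‖x‖ ∨ 0 < ‖y‖ ∨ 0 < ‖z‖ := by simpa only [norm_pos_iff] using h0
  have hnx := norm_nonneg x
  have hny := norm_nonneg y
  have hnz := norm_nonneg z
  rcases le_total ‖x‖ ‖y‖ with h2 | h2 <;> rcases le_total ‖y‖ ‖z‖ with h3 | h3 <;>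
    rcases le_total ‖x‖ ‖z‖ with h4 | h4
  all_goals first
    | exact key x (norm_pos_iff.1 (by rcases hpos with h | h | h <;> linarith)) (by linarith) (by linarith) (by linarith) (by tauto)
    | exact key y (norm_pos_iff.1 (by rcases hpos with h | h | h <;> linarith)) (by linarith) (by linarith) (by linarith) (by tauto)
    | exact key z (norm_pos_iff.1 (by rcases hpos with h | h | h <;> linarith)) (by linarith) (by linarith) (by linarith) (by tauto)

lemma not_unit_dvd {x : ℤ_[p]} (h : ¬ IsUnit x) : (p : ℤ_[p]) ∣ x := by
  rw [PadicInt.isUnit_iff] at h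
  exact (PadicInt.norm_lt_one_iff_dvd x).1 (lt_of_le_of_ne x.norm_le_one h)

lemma intCast_dvd {k : ℤ} : (p : ℤ_[p]) ∣ (k : ℤ_[p]) ↔ (p : ℤ) ∣ k := by
  rw [← PadicInt.norm_lt_one_iff_dvd, PadicInt.norm_int_lt_one_iff_dvd]

lemma toZMod_zero_of_dvd {x : ℤ_[p]} (h : (p : ℤ_[p]) ∣ x) : PadicInt.toZMod x = 0 := by
  obtain ⟨k, rfl⟩ := h
  simp

lemma pprime : Prime (p : ℤ_[p]) := PadicInt.prime_p

lemma sq_mod {a b : ℤ} (hb : Squarefree b) (hpb : (p : ℤ) ∣ b)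
    (h : Iso3 ℚ_[p] a b (-1)) : IsSquare ((a : ℤ) : ZMod p) := by
  have h' : Iso3 ℚ_[p] ((a : ℤ_[p]) : ℚ_[p]) ((b : ℤ_[p]) : ℚ_[p]) ((-1 : ℤ_[p]) : ℚ_[p]) := by
    push_cast; exact h
  obtain ⟨x, y, z, h0, h1⟩ := h'.primitive
  obtain ⟨b', hb'⟩ := hpb
  have hnb : ¬ (p : ℤ) ∣ b' := by
    rintro ⟨k, rfl⟩
    have := hb p ⟨k, by rw [hb']; ring⟩
    have h2 := Int.isUnit_iff_natAbs_eq.1 this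
    exact hp.out.one_lt.ne' (by simpa using h2)
  have hbc : (b : ℤ_[p]) = p * b' := by rw [hb']; push_cast; ring
  by_cases hx : IsUnit x
  · obtain ⟨w, hw⟩ := hx.exists_right_inv
    have := congrArg PadicInt.toZMod (show (a : ℤ_[p]) = (z * w) ^ 2 - p * (b' * y ^ 2 * w ^ 2) by
      rw [hbc] at h1
      linear_combination w ^ 2 * h1 - a * (x * w + 1) * hw)
    rw [map_sub, map_mul, map_natCast, map_pow, map_intCast] at this
    simp only [CharP.cast_eq_zero, zero_mul, sub_zero] at this
    exact ⟨_, this.trans (sq _)⟩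
  · exfalso
    obtain ⟨x', rfl⟩ := not_unit_dvd hx
    have hz : (p : ℤ_[p]) ∣ z := by
      apply pprime.dvd_of_dvd_pow (n := 2)
      exact ⟨a * p * x' ^ 2 + b' * y ^ 2, by rw [hbc] at h1; linear_combination -h1⟩
    obtain ⟨z', rfl⟩ := hz
    have hy : (p : ℤ_[p]) ∣ y := by
      have h2 : (p : ℤ_[p]) ∣ b' * y ^ 2 := by
        refine ⟨z' ^ 2 - a * x' ^ 2, mul_left_cancel₀ pprime.ne_zero ?_⟩
        rw [hbc] at h1
        linear_combination h1
      rcases pprime.dvd_or_dvd h2 with h3 | h3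
      · exact absurd (intCast_dvd.1 h3) hnb
      · exact pprime.dvd_of_dvd_pow h3
    obtain ⟨y', rfl⟩ := hy
    rcases h0 with h0 | h0 | h0 <;> exact pprime.not_isUnit (isUnit_of_mul_isUnit_left h0)
end padic

lemma crt {m n : ℤ} (h : IsCoprime m n) (x y : ℤ) : ∃ z, m ∣ z - x ∧ n ∣ z - y := by
  obtain ⟨u, v, huv⟩ := h
  exact ⟨x * (v * n) + y * (u * m), ⟨u * (y - x), by linear_combination x * huv⟩,
    ⟨v * (x - y), by linear_combination y * huv⟩⟩

lemma sq_crt (a : ℤ) (s : Finset ℕ) (hs : ∀ p ∈ s, p.Prime) (h : ∀ p ∈ s, ∃ t : ℤ, (p : ℤ) ∣ t ^ 2 - a) :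
    ∃ t : ℤ, (∏ p ∈ s, (p : ℤ)) ∣ t ^ 2 - a := by
  classical
  induction s using Finset.induction_on with
  | empty => exact ⟨0, by simp⟩
  | insert q s hq ih =>
    obtain ⟨t1, h1⟩ := ih (fun p hp => hs p (by simp [hp])) (fun p hp => h p (by simp [hp]))
    obtain ⟨t2, h2⟩ := h q (by simp)
    have hco : IsCoprime (q : ℤ) (∏ p ∈ s, (p : ℤ)) := by
      refine IsCoprime.prod_right fun p hp => ?_
      rw [Nat.isCoprime_iff_coprime]
      refine (Nat.coprime_primes (hs q (by simp)) (hs p (by simp [hp]))).2 ?_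
      rintro rfl; exact hq hp
    obtain ⟨z, hz1, hz2⟩ := crt hco t2 t1
    refine ⟨z, ?_⟩
    rw [Finset.prod_insert hq]
    refine hco.mul_dvd ?_ ?_
    · have : z ^ 2 - a = (z - t2) * (z + t2) + (t2 ^ 2 - a) := by ring
      rw [this]; exact dvd_add (hz1.mul_right _) h2
    · have : z ^ 2 - a = (z - t1) * (z + t1) + (t1 ^ 2 - a) := by ring
      rw [this]; exact dvd_add (hz2.mul_right _) h1

lemma sqfree_part (b : ℤ) (hb : b ≠ 0) : ∃ b1 s : ℤ, Squarefree b1 ∧ s ≠ 0 ∧ b = b1 * s ^ 2 := by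
  obtain ⟨u, v, h1, h2⟩ := Nat.sq_mul_squarefree b.natAbs
  have hv : v ≠ 0 := by
    rintro rfl
    simp only [ne_eq, OfNat.ofNat_ne_zero, not_false_eq_true, zero_pow, zero_mul] at h1
    exact hb (Int.natAbs_eq_zero.1 h1.symm)
  have hu : Squarefree (u : ℤ) := Int.squarefree_natCast.2 h2
  rcases Int.natAbs_eq b with h | h
  · refine ⟨u, v, hu, by exact_mod_cast hv, ?_⟩
    rw [h, ← h1]; push_cast; ring
  · refine ⟨-u, v, ?_, by exact_mod_cast hv, ?_⟩
    · exact Int.squarefree_natAbs.1 (by simpa using h2)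
    · rw [h, ← h1]; push_cast; ring

lemma sq_zmod2 : ∀ w : ZMod 2, IsSquare w := by decide

theorem hm3_aux (N : ℕ) : ∀ a b : ℤ, a.natAbs + b.natAbs ≤ N → Squarefree a → Squarefree b →
    (∀ (p : ℕ) [Fact p.Prime], p ≠ 2 → Iso3 ℚ_[p] a b (-1)) → Iso3 ℝ a b (-1) → Iso3 ℚ a b (-1) := by
  induction N with
  | zero =>
    intro a b h ha
    have : a = 0 := by omega
    subst this
    exact absurd ha not_squarefree_zero
  | succ N ih =>
    have main : ∀ a b : ℤ, a.natAbs + b.natAbs ≤ N + 1 → a.natAbs ≤ b.natAbs → Squarefree a → Squarefree b →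
      (∀ (p : ℕ) [Fact p.Prime], p ≠ 2 → Iso3 ℚ_[p] a b (-1)) → Iso3 ℝ a b (-1) → Iso3 ℚ a b (-1) := by
      intro a b hN hab ha hb hloc hR
      have ha0 : a ≠ 0 := ha.ne_zero
      have hb0 : b ≠ 0 := hb.ne_zero
      by_cases hb1 : b.natAbs = 1
      · have h1 : a = 1 ∨ a = -1 := by omega
        have h2 : b = 1 ∨ b = -1 := by omega
        rcases h1 with rfl | rfl
        · exact ⟨1, 0, 1, by simp, by simp⟩
        rcases h2 with rfl | rfl
        · exact ⟨0, 1, 1, by simp, by simp⟩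
        exfalso
        obtain ⟨x, y, z, h0, h1⟩ := hR
        push_cast at h1
        have hx : x = 0 := by nlinarith [sq_nonneg x, sq_nonneg y, sq_nonneg z]
        have hy : y = 0 := by nlinarith [sq_nonneg x, sq_nonneg y, sq_nonneg z]
        have hz : z = 0 := by nlinarith [sq_nonneg x, sq_nonneg y, sq_nonneg z]
        simp_all
      have hb2 : 2 ≤ b.natAbs := by omega
      obtain ⟨t0, ht0⟩ := sq_crt a b.natAbs.primeFactors (fun p hp => Nat.prime_of_mem_primeFactors hp)
        (by
          intro p hp
          have hpp := Nat.prime_of_mem_primeFactors hp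
          have : Fact p.Prime := ⟨hpp⟩
          have hpb : (p : ℤ) ∣ b := Int.natCast_dvd.2 (Nat.dvd_of_mem_primeFactors hp)
          have hsq : IsSquare ((a : ℤ) : ZMod p) := by
            by_cases hp2 : p = 2
            · subst hp2
              exact sq_zmod2 _
            · exact sq_mod hb hpb (hloc p hp2)
          obtain ⟨w, hw⟩ := hsq
          obtain ⟨t, rfl⟩ := ZMod.intCast_surjective w
          refine ⟨t, (ZMod.intCast_zmod_eq_zero_iff_dvd _ p).1 ?_⟩
          push_cast
          rw [hw]; ring)
      have hprod : (∏ p ∈ b.natAbs.primeFactors, (p : ℤ)) = b.natAbs := by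
        rw [← Nat.cast_prod, Nat.prod_primeFactors_of_squarefree (Int.squarefree_natAbs.2 hb)]
      rw [hprod, Int.natAbs_dvd] at ht0
      obtain ⟨t, b', ht, htb⟩ : ∃ t b' : ℤ, t ^ 2 - a = b * b' ∧ 2 * |t| ≤ |b| := by
        obtain ⟨r, hr1, hr2⟩ : ∃ r : ℤ, b ∣ r - t0 ∧ 2 * |r| ≤ |b| := by
          refine ⟨Int.bmod t0 b.natAbs, ?_, ?_⟩
          · have h3 : ((b.natAbs : ℕ) : ℤ) ∣ Int.bmod t0 b.natAbs - t0 := by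
              exact Int.dvd_bmod_sub_self
            rwa [Int.natAbs_dvd] at h3
          · have h4 := Int.bmod_lt (x := t0) (m := b.natAbs) (by omega)
            have h5 := Int.le_bmod (x := t0) (m := b.natAbs) (by omega)
            rw [Int.abs_eq_natAbs, Int.abs_eq_natAbs]
            omega
        obtain ⟨k, hk⟩ := ht0
        obtain ⟨l, hl⟩ := hr1
        exact ⟨r, l * (r + t0) + k, by linear_combination hk + (r + t0) * hl, hr2⟩
      by_cases hb'0 : b' = 0
      · refine ⟨1, 0, t, by simp, ?_⟩
        have : (t : ℚ) ^ 2 = a := by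
          have : t ^ 2 = a := by rw [hb'0] at ht; linarith
          exact_mod_cast this
        rw [this]; ring
      have hlt : b'.natAbs < b.natAbs := by
        have hab' : |a| ≤ |b| := by rw [Int.abs_eq_natAbs, Int.abs_eq_natAbs]; exact_mod_cast hab
        have hb2' : 2 ≤ |b| := by rw [Int.abs_eq_natAbs]; exact_mod_cast hb2
        have h3 : |b| * |b'| ≤ |t| ^ 2 + |a| := by
          rw [← abs_mul, ← ht, ← abs_pow]; exact abs_sub _ _
        have : |b'| < |b| := by
          by_contra hcon
          push Not at hcon
          nlinarith [abs_nonneg t, abs_nonneg a]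
        rw [Int.abs_eq_natAbs, Int.abs_eq_natAbs] at this
        exact_mod_cast this
      obtain ⟨b1, s, hb1s, hs, hbs⟩ := sqfree_part b' hb'0
      have hle : b1.natAbs ≤ b'.natAbs := by
        rw [hbs, Int.natAbs_mul]
        exact Nat.le_mul_of_pos_right _ (Int.natAbs_pos.2 (pow_ne_zero _ hs))
      have tr : ∀ (K : Type) [Field K] [CharZero K], Iso3 K a b (-1) → Iso3 K a b1 (-1) := by
        intro K _ _ h
        have h6 : Iso3 K a b' (-1) := by
          refine h.transfer (t := t) (by exact_mod_cast hb0) ?_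
          have : t ^ 2 = a + b * b' := by linarith
          exact_mod_cast this
        rw [hbs] at h6
        push_cast at h6
        exact (Iso3.sq2 (by exact_mod_cast hs)).1 h6
      have hQ := ih a b1 (by omega) ha hb1s (fun p _ hp2 => tr _ (hloc p hp2)) (tr _ hR)
      have hQ' : Iso3 ℚ a b' (-1) := by
        rw [hbs]; push_cast
        exact (Iso3.sq2 (by exact_mod_cast hs)).2 hQ
      refine hQ'.transfer (t := t) (by exact_mod_cast hb'0) ?_
      have : t ^ 2 = a + b' * b := by linarith
      exact_mod_cast this
    intro a b hN ha hb hloc hR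
    rcases le_total a.natAbs b.natAbs with h | h
    · exact main a b hN h ha hb hloc hR
    · exact (main b a (by omega) h hb ha (fun p _ hp => (hloc p hp).swap12) hR.swap12).swap12

/-- Ternary Hasse principle (omitting the prime two). -/
theorem hm3 (a b c : ℤ) (ha : a ≠ 0) (hb : b ≠ 0) (hc : c ≠ 0)
    (hloc : ∀ (p : ℕ) [Fact p.Prime], p ≠ 2 → Iso3 ℚ_[p] a b c) (hR : Iso3 ℝ a b c) :
    Iso3 ℚ a b c := by
  obtain ⟨a1, s, ha1, hs, has⟩ := sqfree_part (-(a * c)) (neg_ne_zero.2 (mul_ne_zero ha hc))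
  obtain ⟨b1, t, hb1, ht, hbt⟩ := sqfree_part (-(b * c)) (neg_ne_zero.2 (mul_ne_zero hb hc))
  have tr : ∀ (K : Type) [Field K] [CharZero K], Iso3 K a b c ↔ Iso3 K a1 b1 (-1) := by
    intro K _ _
    rw [Iso3.norm (by exact_mod_cast hc)]
    have e1 : -((a : K) * c) = a1 * s ^ 2 := by exact_mod_cast has
    have e2 : -((b : K) * c) = b1 * t ^ 2 := by exact_mod_cast hbt
    rw [e1, e2, Iso3.sq1 (by exact_mod_cast hs), Iso3.sq2 (by exact_mod_cast ht)]
  rw [tr]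
  exact hm3_aux _ a1 b1 le_rfl ha1 hb1 (fun p _ hp => (tr _).1 (hloc p hp)) ((tr _).1 hR)
end HM
namespace HM
open NumberTheorySymbols

lemma rec_signed (D : ℤ) (hD : D % 2 = 1) (q : ℕ) (hq : q % 2 = 1) :
    J(D | q) = J(q | D.natAbs) * (if q % 4 = 3 ∧ D % 4 = 3 then -1 else 1) := by
  have hn2 : D.natAbs % 2 = 1 := by omega
  have hrec := jacobiSym.quadratic_reciprocity_if hn2 hq
  rcases Int.natAbs_eq D with h | h
  · rw [h] at hD ⊢
    rw [← hrec, ← h]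
    have : (D.natAbs % 4 = 3 ∧ q % 4 = 3) ↔ (q % 4 = 3 ∧ D % 4 = 3) := by omega
    simp only [this]
    split_ifs <;> ring
  · have e : J(D | q) = J(-1 | q) * J((D.natAbs : ℤ) | q) := by
      rw [← jacobiSym.mul_left, neg_one_mul, ← h]
    rw [e, ← hrec, jacobiSym.at_neg_one (Nat.odd_iff.2 hq), ZMod.χ₄_nat_eq_if_mod_four]
    have h1 : D.natAbs % 4 = 1 ∨ D.natAbs % 4 = 3 := by omega
    have h2 : q % 4 = 1 ∨ q % 4 = 3 := by omega
    rcases h1 with h1 | h1 <;> rcases h2 with h2 | h2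
    · have h3 : D % 4 = 3 := by omega
      simp [h1, h2, h3, hq]
    · have h3 : D % 4 = 3 := by omega
      simp [h1, h2, h3, hq]
    · have h3 : D % 4 = 1 := by omega
      simp [h1, h2, h3, hq]
    · have h3 : D % 4 = 1 := by omega
      simp [h1, h2, h3, hq]

lemma jconst {D r0 : ℤ} {N r : ℕ} (hD : D ∣ N) (hr : (N : ℤ) ∣ r - r0) :
    J(r | D.natAbs) = J(r0 | D.natAbs) := by
  apply jacobiSym.mod_left'
  have : ((D.natAbs : ℕ) : ℤ) ∣ r - r0 := (Int.natAbs_dvd.2 hD).trans hr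
  exact Int.ModEq.symm ((Int.modEq_iff_dvd).2 this)

lemma jpm {D r0 : ℤ} {N : ℕ} (hD : D ∣ N) (h0 : IsCoprime r0 (N : ℤ)) :
    J(r0 | D.natAbs) = 1 ∨ J(r0 | D.natAbs) = -1 := by
  apply jacobiSym.eq_one_or_neg_one
  rw [← Int.isCoprime_iff_gcd_eq_one]
  exact h0.of_isCoprime_of_dvd_right (Int.natAbs_dvd.2 hD)

/-- choice of the residue modulo four -/
lemma choose_mod4 {D r0 : ℤ} {N : ℕ} (hD : D ∣ N) (h0 : IsCoprime r0 (N : ℤ)) (hD4 : D % 4 = 3) :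
    ∃ κ : ℕ, (κ = 1 ∨ κ = 3) ∧ ∀ r : ℕ, (N : ℤ) ∣ r - r0 → r % 4 = κ → J(D | r) = 1 := by
  rcases jpm hD h0 with h | h
  · refine ⟨1, Or.inl rfl, fun r hr hr4 => ?_⟩
    rw [rec_signed D (by omega) r (by omega), jconst hD hr, h]
    simp [hr4]
  · refine ⟨3, Or.inr rfl, fun r hr hr4 => ?_⟩
    rw [rec_signed D (by omega) r (by omega), jconst hD hr, h]
    simp [hr4, hD4]

/-- Dirichlet choice -/
lemma choose_prime {D r0 : ℤ} {N : ℕ} (hN : N % 2 = 1) (hD : D ∣ N) (h0 : IsCoprime r0 (N : ℤ))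
    (hD2 : D % 2 = 1) {κ : ℕ} (hκ : κ = 1 ∨ κ = 3) (B : ℕ) :
    ∃ q : ℕ, B < q ∧ q.Prime ∧ (N : ℤ) ∣ q - r0 ∧ q % 4 = κ ∧ J(2 * D | q) = 1 := by
  have key : ∀ ρ : ℕ, ρ % 2 = 1 → ∃ q : ℕ, B < q ∧ q.Prime ∧ (N : ℤ) ∣ q - r0 ∧ (8 : ℤ) ∣ q - ρ := by
    intro ρ hρ
    have hco : IsCoprime (N : ℤ) 8 := by
      have : Nat.Coprime N (2 ^ 3) := Nat.Coprime.pow_right 3 (Nat.coprime_two_right.2 (Nat.odd_iff.2 hN))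
      exact_mod_cast Nat.isCoprime_iff_coprime.2 this
    obtain ⟨c, hc1, hc2⟩ := crt hco r0 ρ
    have hρ8 : IsCoprime (ρ : ℤ) 8 := by
      have : Nat.Coprime ρ (2 ^ 3) := Nat.Coprime.pow_right 3 (Nat.coprime_two_right.2 (Nat.odd_iff.2 hρ))
      exact_mod_cast Nat.isCoprime_iff_coprime.2 this
    have hcN : IsCoprime c (N : ℤ) := by
      obtain ⟨k, hk⟩ := hc1
      have : c = r0 + N * k := by linarith
      rw [this]
      exact IsCoprime.add_mul_left_left h0 k
    have hc8 : IsCoprime c 8 := by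
      obtain ⟨k, hk⟩ := hc2
      have : c = ρ + 8 * k := by linarith
      rw [this]
      exact IsCoprime.add_mul_left_left hρ8 k
    obtain ⟨q, hq1, hq2, hq3⟩ := Nat.forall_exists_prime_gt_and_zmodEq B (q := N * 8) (a := c)
      (by omega) (by push_cast; exact hcN.mul_right hc8)
    have hq4 : ((N * 8 : ℕ) : ℤ) ∣ q - c := (Int.modEq_iff_dvd.1 hq3.symm)
    push_cast at hq4
    refine ⟨q, hq1, hq2, ?_, ?_⟩
    · have := dvd_add ((Dvd.intro _ rfl : (N : ℤ) ∣ N * 8).trans hq4) hc1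
      simpa using this
    · have := dvd_add ((Dvd.intro_left _ rfl : (8 : ℤ) ∣ N * 8).trans hq4) hc2
      simpa using this
  have hκ2 : κ % 2 = 1 := by omega
  obtain ⟨q1, hB1, hp1, hN1, h81⟩ := key κ hκ2
  obtain ⟨q2, hB2, hp2, hN2, h82⟩ := key (κ + 4) (by omega)
  push_cast at h82
  have h2 : ∀ q : ℕ, q % 2 = 1 → J(2 * D | q) = (if q % 8 = 1 ∨ q % 8 = 7 then 1 else -1) * J(D | q) := by
    intro q hq
    rw [jacobiSym.mul_left, jacobiSym.at_two (Nat.odd_iff.2 hq), ZMod.χ₈_nat_eq_if_mod_eight]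
    simp [hq]
  have e1 := h2 q1 (by omega)
  have e2 := h2 q2 (by omega)
  have f1 := rec_signed D hD2 q1 (by omega)
  have f2 := rec_signed D hD2 q2 (by omega)
  rw [jconst hD hN1] at f1
  rw [jconst hD hN2] at f2
  have heq : J(D | q1) = J(D | q2) := by
    rw [f1, f2]
    have : q1 % 4 = q2 % 4 := by omega
    rw [this]
  have hpm : J(D | q1) = 1 ∨ J(D | q1) = -1 := by
    rw [f1]
    rcases jpm hD h0 with h | h <;> rw [h] <;> split_ifs <;> simp
  rcases hpm with h | h
  · by_cases h8 : q1 % 8 = 1 ∨ q1 % 8 = 7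
    · exact ⟨q1, hB1, hp1, hN1, by omega, by rw [e1, if_pos h8, h]; rfl⟩
    · exact ⟨q2, hB2, hp2, hN2, by omega, by rw [e2, if_pos (by omega), ← heq, h]; rfl⟩
  · by_cases h8 : q1 % 8 = 1 ∨ q1 % 8 = 7
    · exact ⟨q2, hB2, hp2, hN2, by omega, by rw [e2, if_neg (by omega), ← heq, h]; rfl⟩
    · exact ⟨q1, hB1, hp1, hN1, by omega, by rw [e1, if_neg h8, h]; rfl⟩
end HM
namespace HM
open LocalPart

/-- isotropy of a diagonal form -/
def IsoF {ι : Type*} [Fintype ι] (K : Type*) [Field K] (a : ι → K) : Prop :=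
  ∃ x : ι → K, x ≠ 0 ∧ ∑ i, a i * x i ^ 2 = 0

lemma IsoF.lift {ι κ : Type*} [Fintype ι] [Fintype κ] {K : Type*} [Field K] {a : ι → K}
    (e : κ → ι) (he : Function.Injective e) (h : IsoF K (fun k => a (e k))) : IsoF K a := by
  obtain ⟨x, hx, hs⟩ := h
  refine ⟨Function.extend e x 0, ?_, ?_⟩
  · intro h0
    apply hx
    funext k
    have := congrFun h0 (e k)
    rwa [he.extend_apply] at this
  · rw [← hs]
    symm
    apply Finset.sum_of_injOn e he.injOn (by simp)
    · intro i _ hi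
      have : ¬ ∃ k, e k = i := by simpa using hi
      rw [Function.extend_apply' _ _ _ this]
      simp
    · intro k _
      rw [he.extend_apply]

lemma IsoF.of_sq {ι : Type*} [Fintype ι] {K : Type*} [Field K] {a b s : ι → K}
    (hs : ∀ i, s i ≠ 0) (hb : ∀ i, b i = a i * s i ^ 2) (h : IsoF K b) : IsoF K a := by
  obtain ⟨x, hx, hs0⟩ := h
  refine ⟨fun i => s i * x i, ?_, ?_⟩
  · intro h0
    apply hx
    funext i
    have := congrFun h0 i
    simpa [hs i] using this
  · rw [← hs0]
    refine Finset.sum_congr rfl fun i _ => ?_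
    rw [hb]; ring

lemma IsoF.scale {ι : Type*} [Fintype ι] {K : Type*} [Field K] {a : ι → K} {k : K} (hk : k ≠ 0)
    (h : IsoF K (fun i => k * a i)) : IsoF K a := by
  obtain ⟨x, hx, hs0⟩ := h
  refine ⟨x, hx, ?_⟩
  have : k * ∑ i, a i * x i ^ 2 = 0 := by
    rw [← hs0, Finset.mul_sum]
    exact Finset.sum_congr rfl fun i _ => by ring
  exact (mul_eq_zero.1 this).resolve_left hk

def Iso5 (K : Type*) [Field K] (a b c d e : K) : Prop :=
  ∃ x y z u v : K, (x ≠ 0 ∨ y ≠ 0 ∨ z ≠ 0 ∨ u ≠ 0 ∨ v ≠ 0) ∧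
    a * x ^ 2 + b * y ^ 2 + c * z ^ 2 + d * u ^ 2 + e * v ^ 2 = 0

lemma isoF_iff5 {K : Type*} [Field K] (a : Fin 5 → K) :
    IsoF K a ↔ Iso5 K (a 0) (a 1) (a 2) (a 3) (a 4) := by
  constructor
  · rintro ⟨x, hx, h⟩
    refine ⟨x 0, x 1, x 2, x 3, x 4, ?_, ?_⟩
    · by_contra! h0
      apply hx
      funext i
      fin_cases i <;> simp [h0]
    · rw [← h]; simp [Fin.sum_univ_five]
  · rintro ⟨x, y, z, u, v, hx, h⟩
    refine ⟨![x, y, z, u, v], ?_, ?_⟩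
    · intro h0
      have h1 := congrFun h0 0
      have h2 := congrFun h0 1
      have h3 := congrFun h0 2
      have h4 := congrFun h0 3
      have h5 := congrFun h0 4
      simp at h1 h2 h3 h4 h5
      simp_all
    · rw [← h]; simp [Fin.sum_univ_five]

variable {K : Type*} [Field K]

lemma iso3_of {a b c : K} (x y z : K) (h0 : x ≠ 0 ∨ y ≠ 0 ∨ z ≠ 0)
    (h : a * x ^ 2 + b * y ^ 2 + c * z ^ 2 = 0) : Iso3 K a b c := ⟨x, y, z, h0, h⟩

lemma lemmaK {a1 a2 a3 a4 a5 : K} (h1 : a1 ≠ 0) (h3 : a3 ≠ 0)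
    (h5 : a5 ≠ 0) (h : Iso5 K a1 a2 a3 a4 a5) :
    ∃ t s : K, t ≠ 0 ∧ s ≠ 0 ∧ Iso3 K a1 a2 (-t) ∧ Iso3 K a3 a4 (-s) ∧ Iso3 K t s a5 := by
  obtain ⟨x1, x2, x3, x4, x5, hx, h⟩ := h
  have one : (1 : K) ≠ 0 := one_ne_zero
  by_cases ht : a1 * x1 ^ 2 + a2 * x2 ^ 2 = 0
  · by_cases h12 : x1 ≠ 0 ∨ x2 ≠ 0
    · refine ⟨-a3, a3, neg_ne_zero.2 h3, h3, iso3_of x1 x2 0 (by tauto) (by linear_combination ht),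
        iso3_of 1 0 1 (by tauto) (by ring), iso3_of 1 1 0 (by tauto) (by ring)⟩
    push Not at h12
    obtain ⟨rfl, rfl⟩ := h12
    by_cases hs : a3 * x3 ^ 2 + a4 * x4 ^ 2 = 0
    · have h50 : x5 = 0 := by
        have : a5 * x5 ^ 2 = 0 := by linear_combination h - hs
        simpa [h5] using this
      subst h50
      refine ⟨a1, -a1, h1, neg_ne_zero.2 h1, iso3_of 1 0 1 (by tauto) (by ring),
        iso3_of x3 x4 0 (by tauto) (by linear_combination hs), iso3_of 1 1 0 (by tauto) (by ring)⟩
    · refine ⟨a1, _, h1, hs, iso3_of 1 0 1 (by tauto) (by ring),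
        iso3_of x3 x4 1 (by tauto) (by ring), iso3_of 0 1 x5 (by tauto) (by linear_combination h)⟩
  · by_cases hs : a3 * x3 ^ 2 + a4 * x4 ^ 2 = 0
    · by_cases h34 : x3 ≠ 0 ∨ x4 ≠ 0
      · refine ⟨a1, -a1, h1, neg_ne_zero.2 h1, iso3_of 1 0 1 (by tauto) (by ring),
          iso3_of x3 x4 0 (by tauto) (by linear_combination hs), iso3_of 1 1 0 (by tauto) (by ring)⟩
      · refine ⟨_, a3, ht, h3, iso3_of x1 x2 1 (by tauto) (by ring),
          iso3_of 1 0 1 (by tauto) (by ring), iso3_of 1 0 x5 (by tauto) (by linear_combination h - hs)⟩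
    · exact ⟨_, _, ht, hs, iso3_of x1 x2 1 (by tauto) (by ring), iso3_of x3 x4 1 (by tauto) (by ring),
        iso3_of 1 1 x5 (by tauto) (by linear_combination h)⟩

lemma lemmaK_conv {a1 a2 a3 a4 a5 t s : K} (ht : t ≠ 0) (hs : s ≠ 0)
    (h12 : Iso3 K a1 a2 (-t)) (h34 : Iso3 K a3 a4 (-s)) (h5 : Iso3 K t s a5) :
    Iso5 K a1 a2 a3 a4 a5 := by
  obtain ⟨x, y, z, hxyz, h⟩ := h12
  obtain ⟨x', y', z', hxyz', h'⟩ := h34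
  obtain ⟨X, Y, Z, hXYZ, H⟩ := h5
  by_cases hz : z = 0
  · subst hz
    exact ⟨x, y, 0, 0, 0, by tauto, by linear_combination h⟩
  by_cases hz' : z' = 0
  · subst hz'
    exact ⟨0, 0, x', y', 0, by tauto, by linear_combination h'⟩
  have e1 : t * z ^ 2 = a1 * x ^ 2 + a2 * y ^ 2 := by linear_combination -h
  have e2 : s * z' ^ 2 = a3 * x' ^ 2 + a4 * y' ^ 2 := by linear_combination -h'
  have n1 : x ≠ 0 ∨ y ≠ 0 := by
    by_contra! hh
    rw [hh.1, hh.2] at e1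
    simp [ht, hz] at e1
  have n2 : x' ≠ 0 ∨ y' ≠ 0 := by
    by_contra! hh
    rw [hh.1, hh.2] at e2
    simp [hs, hz'] at e2
  refine ⟨x * X * z', y * X * z', x' * Y * z, y' * Y * z, Z * z * z', ?_, ?_⟩
  · rcases hXYZ with hX | hY | hZ
    · rcases n1 with n | n
      · left; exact mul_ne_zero (mul_ne_zero n hX) hz'
      · right; left; exact mul_ne_zero (mul_ne_zero n hX) hz'
    · rcases n2 with n | n
      · right; right; left; exact mul_ne_zero (mul_ne_zero n hY) hz
      · right; right; right; left; exact mul_ne_zero (mul_ne_zero n hY) hz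
    · right; right; right; right; exact mul_ne_zero (mul_ne_zero hZ hz) hz'
  · linear_combination z ^ 2 * z' ^ 2 * H - (X * z') ^ 2 * e1 - (Y * z) ^ 2 * e2

variable {p : ℕ} [hp : Fact p.Prime]

lemma intCast_unit {u : ℤ} (hu : ¬ (p : ℤ) ∣ u) : IsUnit (u : ℤ_[p]) := by
  by_contra h
  exact hu (intCast_dvd.1 (not_unit_dvd h))

lemma coe_ne {x : ℤ_[p]} (hx : x ≠ 0) : (x : ℚ_[p]) ≠ 0 := fun h => hx (Subtype.ext h)

lemma padic_class (hp2 : p ≠ 2) {x : ℚ_[p]} (hx : x ≠ 0) : ∃ (e : Fin 2) (u : ℤ) (s : ℚ_[p]),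
    ¬ (p : ℤ) ∣ u ∧ s ≠ 0 ∧ x = p ^ (e : ℕ) * u * s ^ 2 := by
  obtain ⟨A, B, hB, hAB⟩ := IsFractionRing.div_surjective (A := ℤ_[p]) x
  have hB0 : (B : ℚ_[p]) ≠ 0 := by
    exact coe_ne (nonZeroDivisors.ne_zero hB)
  have hA0 : A ≠ 0 := by
    rintro rfl
    apply hx; rw [← hAB]; simp
  have hAB0 : A * B ≠ 0 := mul_ne_zero hA0 (nonZeroDivisors.ne_zero hB)
  obtain ⟨k, v, hv, hk⟩ := val_decomp hAB0
  obtain ⟨w, hw⟩ := ZMod.intCast_surjective (PadicInt.toZMod v)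
  have hdvd : (p : ℤ_[p]) ∣ w * 1 ^ 2 - v := by
    have : PadicInt.toZMod ((w : ℤ_[p]) * 1 ^ 2 - v) = 0 := by simp [hw]
    exact toZMod_eq_zero.1 this
  have hwu : IsUnit (w : ℤ_[p]) := by
    refine unit_of_dvd_sub (y := v) ?_ hv
    simpa using hdvd
  obtain ⟨y, hy, hy1⟩ := sq_hensel hp2 hwu isUnit_one hdvd
  have hw2 : ¬ (p : ℤ) ∣ w := by
    intro h
    have := intCast_dvd.2 h
    exact PadicInt.prime_p.not_isUnit (isUnit_of_dvd_unit this hwu)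
  have hp0 : (p : ℚ_[p]) ≠ 0 := by exact_mod_cast hp.out.ne_zero
  have hy0 : (y : ℚ_[p]) ≠ 0 := coe_ne hy.ne_zero
  refine ⟨⟨k % 2, Nat.mod_lt _ (by norm_num)⟩, w, p ^ (k / 2) * y / B, hw2, by positivity, ?_⟩
  have hk' : (A : ℚ_[p]) * B = p ^ k * v := by
    have := congrArg (fun z : ℤ_[p] => (z : ℚ_[p])) hk
    push_cast at this
    exact this
  have hy' : (w : ℚ_[p]) * y ^ 2 = v := by
    have := congrArg (fun z : ℤ_[p] => (z : ℚ_[p])) hy1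
    push_cast at this
    exact this
  have hkk : (p : ℚ_[p]) ^ k = p ^ (k % 2) * (p ^ (k / 2)) ^ 2 := by
    rw [← pow_mul, ← pow_add]; congr 1; omega
  rw [← hAB]
  change (A : ℚ_[p]) / B = _
  field_simp
  rw [hk', hkk, ← hy']
  ring

lemma iso3_units (hp2 : p ≠ 2) {a b c : ℤ_[p]} (ha : IsUnit a) (hb : IsUnit b) (hc : IsUnit c) :
    Iso3 ℚ_[p] a b c := by
  obtain ⟨x, y, z, h, hz⟩ := ternary_odd hp2 ha hb hc 0
  refine iso3_of (x : ℚ_[p]) y z ?_ ?_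
  · right; right; exact coe_ne hz.ne_zero
  · have := congrArg (fun z : ℤ_[p] => (z : ℚ_[p])) h
    push_cast at this
    exact this

lemma iso5_padic (hp2 : p ≠ 2) {a : Fin 5 → ℚ_[p]} (ha : ∀ i, a i ≠ 0) : IsoF ℚ_[p] a := by
  choose e u s hu hs hE using fun i => padic_class hp2 (ha i)
  obtain ⟨ε, -, hε⟩ := Finset.exists_lt_card_fiber_of_mul_lt_card_of_maps_to
    (s := (Finset.univ : Finset (Fin 5))) (t := (Finset.univ : Finset (Fin 2))) (f := e) (n := 2)
    (by simp) (by simp)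
  obtain ⟨i, hi, j, hj, k, hk, hij, hik, hjk⟩ := Finset.two_lt_card.1 hε
  simp only [Finset.mem_filter, Finset.mem_univ, true_and] at hi hj hk
  apply IsoF.lift ![i, j, k]
  · intro x y hxy
    fin_cases x <;> fin_cases y <;> simp_all
  apply IsoF.of_sq (b := fun l => (p : ℚ_[p]) ^ (ε : ℕ) * (u (![i, j, k] l) : ℚ_[p])) (s := fun l => (s (![i, j, k] l))⁻¹)
  · intro l; exact inv_ne_zero (hs _)
  · intro l
    have he : e (![i, j, k] l) = ε := by fin_cases l <;> simp [hi, hj, hk]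
    rw [hE, he]
    have := hs (![i, j, k] l)
    field_simp
  apply IsoF.scale (k := ((p : ℚ_[p]) ^ (ε : ℕ))⁻¹)
    (inv_ne_zero (pow_ne_zero _ (by exact_mod_cast hp.out.ne_zero)))
  obtain ⟨x, y, z, h0, h⟩ := iso3_units hp2 (intCast_unit (hu i)) (intCast_unit (hu j)) (intCast_unit (hu k))
  have hp0 : (p : ℚ_[p]) ≠ 0 := by exact_mod_cast hp.out.ne_zero
  refine ⟨![x, y, z], ?_, ?_⟩
  · intro h1
    have e1 := congrFun h1 0
    have e2 := congrFun h1 1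
    have e3 := congrFun h1 2
    simp at e1 e2 e3
    simp_all
  · rw [← h]
    simp [Fin.sum_univ_three, hp0]

lemma iso_real {ι : Type*} [Fintype ι] {a : ι → ℝ} {i j : ι} (hi : 0 < a i) (hj : a j < 0) : IsoF ℝ a := by
  have hij : i ≠ j := by rintro rfl; linarith
  apply IsoF.lift ![i, j]
  · intro x y hxy
    fin_cases x <;> fin_cases y <;> simp_all
  refine ⟨![√(-a j), √(a i)], ?_, ?_⟩
  · intro h
    have := congrFun h 1
    simp at this
    linarith [Real.sqrt_pos.2 hi]
  · simp [Fin.sum_univ_two]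
    rw [Real.sq_sqrt (by linarith), Real.sq_sqrt hi.le]
    ring
end HM
namespace HM
open LocalPart NumberTheorySymbols

lemma crt_fin (s : Finset ℕ) (hs : ∀ p ∈ s, p.Prime) (k : ℕ → ℕ) (r : ℕ → ℤ) :
    ∃ z : ℤ, ∀ p ∈ s, (p : ℤ) ^ k p ∣ z - r p := by
  induction s using Finset.induction_on with
  | empty => exact ⟨0, by simp⟩
  | insert q s hq ih =>
    obtain ⟨z, hz⟩ := ih (fun p hp => hs p (Finset.mem_insert_of_mem hp))
    have hco : IsCoprime ((q : ℤ) ^ k q) (∏ p ∈ s, (p : ℤ) ^ k p) := by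
      apply IsCoprime.prod_right
      intro p hp
      apply IsCoprime.pow
      rw [Nat.isCoprime_iff_coprime]
      exact (Nat.coprime_primes (hs q (Finset.mem_insert_self _ _))
        (hs p (Finset.mem_insert_of_mem hp))).2 (by rintro rfl; exact hq hp)
    obtain ⟨w, hw1, hw2⟩ := crt hco (r q) z
    refine ⟨w, fun p hp => ?_⟩
    rcases Finset.mem_insert.1 hp with rfl | hp
    · exact hw1
    · have := dvd_add ((Finset.dvd_prod_of_mem (fun p : ℕ => (p : ℤ) ^ k p) hp).trans hw2) (hz p hp)
      simpa using this

lemma crt_fin1 (s : Finset ℕ) (hs : ∀ p ∈ s, p.Prime) (r : ℕ → ℤ) :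
    ∃ z : ℤ, ∀ p ∈ s, (p : ℤ) ∣ z - r p := by
  obtain ⟨z, hz⟩ := crt_fin s hs (fun _ => 1) r
  exact ⟨z, fun p hp => by simpa using hz p hp⟩

/-- the three conditions -/
def Loc (K : Type*) [Field K] (a1 a2 a3 a4 a5 t s : K) : Prop :=
  Iso3 K a1 a2 (-t) ∧ Iso3 K a3 a4 (-s) ∧ Iso3 K t s a5

lemma Loc.sq {K : Type*} [Field K] {a1 a2 a3 a4 a5 t s α β : K} (hα : α ≠ 0) (hβ : β ≠ 0) :
    Loc K a1 a2 a3 a4 a5 (t * α ^ 2) (s * β ^ 2) ↔ Loc K a1 a2 a3 a4 a5 t s := by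
  unfold Loc
  rw [← neg_mul, ← neg_mul, Iso3.sq3 hα, Iso3.sq3 hβ, Iso3.sq1 hα, Iso3.sq2 hβ]

section
variable {p : ℕ} [hp : Fact p.Prime]

lemma unit_sq (hp2 : p ≠ 2) {u v : ℤ} (hu : ¬ (p : ℤ) ∣ u) (h : (p : ℤ) ∣ u - v) :
    ∃ y : ℚ_[p], y ≠ 0 ∧ (v : ℚ_[p]) = u * y ^ 2 := by
  obtain ⟨y, hy, h1⟩ := sq_hensel hp2 (intCast_unit hu) isUnit_one (r := (v : ℤ_[p])) (by
    have := intCast_dvd (p := p).2 h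
    push_cast at this
    simpa using this)
  refine ⟨y, coe_ne hy.ne_zero, ?_⟩
  have := congrArg (fun z : ℤ_[p] => (z : ℚ_[p])) h1
  push_cast at this
  exact this.symm

lemma Loc.congr (hp2 : p ≠ 2) {a1 a2 a3 a4 a5 : ℚ_[p]} {u v u' v' : ℤ} {e e' : ℕ} (hu : ¬ (p : ℤ) ∣ u)
    (hu' : ¬ (p : ℤ) ∣ u') (h : (p : ℤ) ∣ u - v) (h' : (p : ℤ) ∣ u' - v')
    (hL : Loc ℚ_[p] a1 a2 a3 a4 a5 (p ^ e * u) (p ^ e' * u')) :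
    Loc ℚ_[p] a1 a2 a3 a4 a5 (p ^ e * v) (p ^ e' * v') := by
  obtain ⟨y, hy, h1⟩ := unit_sq hp2 hu h
  obtain ⟨y', hy', h1'⟩ := unit_sq hp2 hu' h'
  rw [h1, h1', ← mul_assoc, ← mul_assoc, Loc.sq hy hy']
  exact hL

lemma loc_exists (hp2 : p ≠ 2) {a1 a2 a3 a4 a5 : ℚ_[p]} (h1 : a1 ≠ 0) (h2 : a2 ≠ 0) (h3 : a3 ≠ 0)
    (h4 : a4 ≠ 0) (h5 : a5 ≠ 0) : ∃ (e e' : ℕ) (u u' : ℤ), e ≤ 1 ∧ e' ≤ 1 ∧ ¬ (p : ℤ) ∣ u ∧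
      ¬ (p : ℤ) ∣ u' ∧ Loc ℚ_[p] a1 a2 a3 a4 a5 (p ^ e * u) (p ^ e' * u') := by
  have h := iso5_padic hp2 (a := ![a1, a2, a3, a4, a5]) (by
    intro i; fin_cases i <;> simpa)
  rw [isoF_iff5] at h
  obtain ⟨t, s, ht, hs, hL⟩ := lemmaK h1 h3 h5 h
  obtain ⟨e, u, α, hu, hα, rfl⟩ := padic_class hp2 ht
  obtain ⟨e', u', β, hu', hβ, rfl⟩ := padic_class hp2 hs
  refine ⟨e, e', u, u', by omega, by omega, hu, hu', ?_⟩
  rw [← Loc.sq hα hβ]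
  exact hL

lemma bin_iso (hp2 : p ≠ 2) {a b w : ℤ} (ha : ¬ (p : ℤ) ∣ a) (hb : ¬ (p : ℤ) ∣ b)
    (h : (p : ℤ) ∣ w ^ 2 + a * b) : ∃ x y : ℚ_[p], x ≠ 0 ∧ a * x ^ 2 + b * y ^ 2 = 0 := by
  have hpp : Prime (p : ℤ) := Nat.prime_iff_prime_int.1 hp.out
  have hw : ¬ (p : ℤ) ∣ w := by
    intro hw
    have : (p : ℤ) ∣ a * b := (Int.dvd_add_right (dvd_pow hw two_ne_zero)).1 h
    rcases hpp.dvd_or_dvd this with h | h <;> contradiction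
  obtain ⟨y, hy, h1⟩ := sq_hensel hp2 isUnit_one (intCast_unit hw) (r := ((-(a * b) : ℤ) : ℤ_[p])) (by
    have := intCast_dvd (p := p).2 h
    push_cast at this ⊢
    simpa using this)
  refine ⟨y, a, coe_ne hy.ne_zero, ?_⟩
  have := congrArg (fun z : ℤ_[p] => (z : ℚ_[p])) h1
  push_cast at this
  linear_combination (a : ℚ_[p]) * this

lemma jac_sq {a : ℤ} (h : J(a | p) = 1) : ∃ w : ℤ, (p : ℤ) ∣ w ^ 2 - a := by
  obtain ⟨w, hw⟩ := ZMod.isSquare_of_jacobiSym_eq_one h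
  obtain ⟨w, rfl⟩ := ZMod.intCast_surjective w
  refine ⟨w, ?_⟩
  rw [← ZMod.intCast_zmod_eq_zero_iff_dvd]
  push_cast
  rw [hw]; ring

lemma iso3_of_jac12 (hp2 : p ≠ 2) {a b : ℤ} (c : ℚ_[p]) (ha : ¬ (p : ℤ) ∣ a) (hb : ¬ (p : ℤ) ∣ b)
    (h : ∃ w : ℤ, (p : ℤ) ∣ w ^ 2 + a * b) : Iso3 ℚ_[p] a b c := by
  obtain ⟨w, hw⟩ := h
  obtain ⟨x, y, hx, h⟩ := bin_iso hp2 ha hb hw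
  exact iso3_of x y 0 (Or.inl hx) (by linear_combination h)

lemma iso3_int_units (hp2 : p ≠ 2) {a b c : ℤ} (ha : ¬ (p : ℤ) ∣ a) (hb : ¬ (p : ℤ) ∣ b)
    (hc : ¬ (p : ℤ) ∣ c) : Iso3 ℚ_[p] a b c := by
  have := iso3_units hp2 (intCast_unit ha) (intCast_unit hb) (intCast_unit hc)
  simpa using this
end

lemma real_sign {t : ℝ} (ht : t ≠ 0) : ∃ (ε : ℤ) (α : ℝ), (ε = 1 ∨ ε = -1) ∧ α ≠ 0 ∧ t = ε * α ^ 2 := by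
  rcases lt_or_gt_of_ne ht with h | h
  · refine ⟨-1, √(-t), Or.inr rfl, (Real.sqrt_pos.2 (by linarith)).ne', ?_⟩
    rw [Real.sq_sqrt (by linarith)]; push_cast; ring
  · refine ⟨1, √t, Or.inl rfl, (Real.sqrt_pos.2 (by linarith)).ne', ?_⟩
    rw [Real.sq_sqrt (by linarith)]; push_cast; ring

lemma inv_mod {p : ℕ} (hp : p.Prime) {c : ℤ} (hc : ¬ (p : ℤ) ∣ c) (u : ℤ) :
    ∃ z : ℤ, (p : ℤ) ∣ u - c * z := by
  have : IsCoprime (p : ℤ) c := (Nat.prime_iff_prime_int.1 hp).coprime_iff_not_dvd.2 hc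
  obtain ⟨x, y, h⟩ := this
  exact ⟨y * u, x * u, by linear_combination (-u) * h⟩

end HM
namespace HM
open LocalPart NumberTheorySymbols

lemma prod_split (S : Finset ℕ) (hS : ∀ p ∈ S, p.Prime) (e : ℕ → ℕ) {p : ℕ} (hp : p ∈ S) :
    ∃ c : ℤ, ∏ q ∈ S, (q : ℤ) ^ e q = p ^ e p * c ∧ ¬ (p : ℤ) ∣ c := by
  refine ⟨∏ q ∈ S.erase p, (q : ℤ) ^ e q, (Finset.mul_prod_erase _ _ hp).symm, ?_⟩
  have hpp : Prime (p : ℤ) := Nat.prime_iff_prime_int.1 (hS p hp)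
  rw [hpp.dvd_finsetProd_iff]
  rintro ⟨q, hq, h⟩
  have h1 := hpp.dvd_of_dvd_pow h
  have h2 : p ∣ q := by exact_mod_cast h1
  have := (Nat.prime_dvd_prime_iff_eq (hS p hp) (hS q (Finset.mem_of_mem_erase hq))).1 h2
  exact (Finset.ne_of_mem_erase hq) this.symm

lemma prod_dvd (P : ℤ) (hP : P ≠ 0) (e : ℕ → ℕ) (he : ∀ p ∈ P.natAbs.primeFactors, e p ≤ 1) :
    ∏ q ∈ P.natAbs.primeFactors, (q : ℤ) ^ e q ∣ P := by
  have h1 : ∏ q ∈ P.natAbs.primeFactors, (q : ℤ) ^ e q ∣ ∏ q ∈ P.natAbs.primeFactors, (q : ℤ) :=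
    Finset.prod_dvd_prod_of_dvd _ _ (fun q hq => by
      simpa using pow_dvd_pow (q : ℤ) (he q hq))
  refine h1.trans ?_
  have := Nat.prod_primeFactors_dvd P.natAbs
  have h2 : ((∏ p ∈ P.natAbs.primeFactors, p : ℕ) : ℤ) ∣ P := Int.natCast_dvd.2 this
  push_cast at h2
  exact h2

lemma isCoprime_of_primes {x P : ℤ} (hP : P ≠ 0) (h : ∀ p ∈ P.natAbs.primeFactors, ¬ (p : ℤ) ∣ x) :
    IsCoprime x P := by
  rw [Int.isCoprime_iff_gcd_eq_one]
  by_contra hg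
  obtain ⟨p, hp, hd⟩ := Nat.exists_prime_and_dvd hg
  refine h p ?_ ?_
  · simp only [Nat.mem_primeFactors]
    exact ⟨hp, hd.trans (Nat.gcd_dvd_right _ _), by simpa using hP⟩
  · exact Int.natCast_dvd.2 (hd.trans (Nat.gcd_dvd_left _ _))

lemma residue_choice (P g : ℤ) (hP : P ≠ 0) (e : ℕ → ℕ) (u : ℕ → ℤ)
    (hu : ∀ p ∈ P.natAbs.primeFactors, ¬ (p : ℤ) ∣ u p)
    (hg : ∀ p ∈ P.natAbs.primeFactors, ¬ (p : ℤ) ∣ g) :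
    ∃ z : ℤ, IsCoprime z P ∧ ∀ x : ℤ, P ∣ x - z → ∀ p ∈ P.natAbs.primeFactors,
      ∃ c : ℤ, g * (∏ q ∈ P.natAbs.primeFactors, (q : ℤ) ^ e q) * x = p ^ e p * c ∧ (p : ℤ) ∣ u p - c := by
  set S := P.natAbs.primeFactors with hS
  have hSp : ∀ p ∈ S, p.Prime := fun p hp => Nat.prime_of_mem_primeFactors hp
  have key : ∀ p : ℕ, ∃ (c z : ℤ), p ∈ S → (∏ q ∈ S, (q : ℤ) ^ e q = p ^ e p * c ∧ ¬ (p : ℤ) ∣ c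
      ∧ (p : ℤ) ∣ u p - g * c * z) := by
    intro p
    by_cases hp : p ∈ S
    · obtain ⟨c, h1, h2⟩ := prod_split S hSp e hp
      have hpp : Prime (p : ℤ) := Nat.prime_iff_prime_int.1 (hSp p hp)
      obtain ⟨z, hz⟩ := inv_mod (hSp p hp) (c := g * c)
        (fun h => (hpp.dvd_or_dvd h).elim (hg p hp) h2) (u p)
      exact ⟨c, z, fun _ => ⟨h1, h2, hz⟩⟩
    · exact ⟨0, 0, fun h => absurd h hp⟩
  choose c z hcz using key
  obtain ⟨w, hw⟩ := crt_fin1 S hSp z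
  have hdP : ∀ p ∈ S, (p : ℤ) ∣ P := fun p hp => Int.natCast_dvd.2 (Nat.dvd_of_mem_primeFactors hp)
  refine ⟨w, isCoprime_of_primes hP fun p hp hpw => ?_, fun x hx p hp => ?_⟩
  · obtain ⟨h1, h2, h3⟩ := hcz p hp
    apply hu p hp
    have h4 : (p : ℤ) ∣ z p := by
      have := dvd_sub hpw (hw p hp)
      simpa using this
    have := dvd_add h3 (h4.mul_left (g * c p))
    simpa using this
  · obtain ⟨h1, h2, h3⟩ := hcz p hp
    refine ⟨g * c p * x, by rw [h1]; ring, ?_⟩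
    have h4 : (p : ℤ) ∣ x - z p := by
      have := dvd_add ((hdP p hp).trans hx) (hw p hp)
      simpa using this
    have := dvd_sub h3 (h4.mul_left (g * c p))
    have e : u p - g * c p * z p - g * c p * (x - z p) = u p - g * c p * x := by ring
    rwa [e] at this

lemma meyerA {a1 b2 a3 b4 b5 : ℤ} {f : ℕ} (h1 : a1 % 2 = 1) (h2 : b2 % 2 = 1)
    (h3 : a3 % 2 = 1) (h4 : b4 % 2 = 1) (h5 : b5 % 2 = 1)
    (hR : Iso5 ℝ a1 (2 * b2 : ℤ) a3 (2 * b4 : ℤ) (2 ^ f * b5 : ℤ)) :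
    Iso5 ℚ a1 (2 * b2 : ℤ) a3 (2 * b4 : ℤ) (2 ^ f * b5 : ℤ) := by
  have n1 : a1 ≠ 0 := by rintro rfl; omega
  have n2 : b2 ≠ 0 := by rintro rfl; omega
  have n3 : a3 ≠ 0 := by rintro rfl; omega
  have n4 : b4 ≠ 0 := by rintro rfl; omega
  have n5 : b5 ≠ 0 := by rintro rfl; omega
  have n2' : 2 * b2 ≠ 0 := by omega
  have n4' : 2 * b4 ≠ 0 := by omega
  have n5' : 2 ^ f * b5 ≠ 0 := mul_ne_zero (by positivity) n5
  obtain ⟨tR, sR, htR, hsR, hLR⟩ := lemmaK (by exact_mod_cast n1) (by exact_mod_cast n3)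
    (by exact_mod_cast n5') hR
  obtain ⟨εt, αt, hεt, hαt, rfl⟩ := real_sign htR
  obtain ⟨εs, αs, hεs, hαs, rfl⟩ := real_sign hsR
  rw [show Iso3 ℝ _ _ _ ∧ Iso3 ℝ _ _ _ ∧ Iso3 ℝ _ _ _ ↔ Loc ℝ _ _ _ _ _ _ _ from Iff.rfl,
    Loc.sq hαt hαs] at hLR
  clear hαt hαs htR hsR αt αs
  -- the odd part
  obtain ⟨P, hPdef⟩ : ∃ P, P = a1 * b2 * a3 * b4 * b5 := ⟨_, rfl⟩
  have hP0 : P ≠ 0 := by rw [hPdef]; simp [n1, n2, n3, n4, n5]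
  have hPodd : P % 2 = 1 := by
    rw [hPdef, ← Int.odd_iff]
    rw [← Int.odd_iff] at h1 h2 h3 h4 h5
    exact (((h1.mul h2).mul h3).mul h4).mul h5
  have hd1 : a1 ∣ P := ⟨b2 * a3 * b4 * b5, by rw [hPdef]; ring⟩
  have hd2 : b2 ∣ P := ⟨a1 * a3 * b4 * b5, by rw [hPdef]; ring⟩
  have hd3 : a3 ∣ P := ⟨a1 * b2 * b4 * b5, by rw [hPdef]; ring⟩
  have hd4 : b4 ∣ P := ⟨a1 * b2 * a3 * b5, by rw [hPdef]; ring⟩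
  have hd5 : b5 ∣ P := ⟨a1 * b2 * a3 * b4, by rw [hPdef]; ring⟩
  have hd12 : a1 * b2 ∣ P := ⟨a3 * b4 * b5, by rw [hPdef]; ring⟩
  have hd34 : a3 * b4 ∣ P := ⟨a1 * b2 * b5, by rw [hPdef]; ring⟩
  have hSp : ∀ p ∈ P.natAbs.primeFactors, p.Prime := fun p hp => Nat.prime_of_mem_primeFactors hp
  have hSmem : ∀ p : ℕ, p.Prime → (p : ℤ) ∣ P → p ∈ P.natAbs.primeFactors := fun p hp h =>
    Nat.mem_primeFactors.2 ⟨hp, Int.natCast_dvd.1 h, by simpa using hP0⟩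
  have hSd : ∀ p ∈ P.natAbs.primeFactors, (p : ℤ) ∣ P := fun p hp =>
    Int.natCast_dvd.2 (Nat.dvd_of_mem_primeFactors hp)
  have hS2 : ∀ p ∈ P.natAbs.primeFactors, p ≠ 2 := by
    rintro p hp rfl
    have := hSd 2 hp
    omega
  have key : ∀ p : ℕ, ∃ (e e' : ℕ) (u u' : ℤ), p ∈ P.natAbs.primeFactors → (e ≤ 1 ∧ e' ≤ 1 ∧ ¬ (p : ℤ) ∣ u ∧
      ¬ (p : ℤ) ∣ u' ∧ ∀ [Fact p.Prime], Loc ℚ_[p] a1 (2 * b2 : ℤ) a3 (2 * b4 : ℤ) (2 ^ f * b5 : ℤ)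
        (p ^ e * u) (p ^ e' * u')) := by
    intro p
    by_cases hp : p ∈ P.natAbs.primeFactors
    · have : Fact p.Prime := ⟨hSp p hp⟩
      obtain ⟨e, e', u, u', k1, k2, k3, k4, k5⟩ := loc_exists (p := p) (hS2 p hp) (a1 := (a1 : ℤ))
        (a2 := (2 * b2 : ℤ)) (a3 := a3) (a4 := (2 * b4 : ℤ)) (a5 := (2 ^ f * b5 : ℤ))
        (by exact_mod_cast n1) (by exact_mod_cast n2') (by exact_mod_cast n3) (by exact_mod_cast n4')
        (by exact_mod_cast n5')
      exact ⟨e, e', u, u', fun _ => ⟨k1, k2, k3, k4, k5⟩⟩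
    · exact ⟨0, 0, 0, 0, fun h => absurd h hp⟩
  choose e e' u u' hloc using key
  have hS2' : ∀ p ∈ P.natAbs.primeFactors, ¬ (p : ℤ) ∣ 2 := by
    intro p hp h
    have : p ∣ 2 := by exact_mod_cast h
    exact hS2 p hp ((Nat.prime_dvd_prime_iff_eq (hSp p hp) Nat.prime_two).1 this)
  have hεtd : ∀ p : ℕ, p.Prime → ¬ (p : ℤ) ∣ εt := by
    intro p hp h
    have : IsUnit εt := by rcases hεt with rfl | rfl <;> simp
    exact (Nat.prime_iff_prime_int.1 hp).not_isUnit (isUnit_of_dvd_unit h this)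
  have hεsd : ∀ p : ℕ, p.Prime → ¬ (p : ℤ) ∣ εs := by
    intro p hp h
    have : IsUnit εs := by rcases hεs with rfl | rfl <;> simp
    exact (Nat.prime_iff_prime_int.1 hp).not_isUnit (isUnit_of_dvd_unit h this)
  obtain ⟨q0, hq0, hq0x⟩ := residue_choice P (εt * 2 ^ f) hP0 e u (fun p hp => (hloc p hp).2.2.1) (by
    intro p hp h
    have hpp : Prime (p : ℤ) := Nat.prime_iff_prime_int.1 (hSp p hp)
    rcases hpp.dvd_or_dvd h with h | h
    · exact hεtd p (hSp p hp) h
    · exact hS2' p hp (hpp.dvd_of_dvd_pow h))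
  obtain ⟨r0', hr0', hr0x⟩ := residue_choice P εs hP0 e' u' (fun p hp => (hloc p hp).2.2.2.1)
    (fun p hp => hεsd p (hSp p hp))
  have hAP := prod_dvd P hP0 e (fun p hp => (hloc p hp).1)
  have hAP' := prod_dvd P hP0 e' (fun p hp => (hloc p hp).2.1)
  obtain ⟨A, hA⟩ : ∃ A, A = ∏ q ∈ P.natAbs.primeFactors, (q : ℤ) ^ e q := ⟨_, rfl⟩
  obtain ⟨A', hA'⟩ : ∃ A, A = ∏ q ∈ P.natAbs.primeFactors, (q : ℤ) ^ e' q := ⟨_, rfl⟩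
  rw [← hA] at hAP hq0x
  rw [← hA'] at hAP' hr0x
  have hA0 : 0 < A := by
    rw [hA]; exact Finset.prod_pos fun q hq => pow_pos (by exact_mod_cast (hSp q hq).pos) _
  have hA0' : 0 < A' := by
    rw [hA']; exact Finset.prod_pos fun q hq => pow_pos (by exact_mod_cast (hSp q hq).pos) _
  have hAodd : A % 2 = 1 := by
    obtain ⟨k, hk⟩ := hAP
    rcases Int.emod_two_eq_zero_or_one A with h | h
    · have : P % 2 = 0 := by rw [hk, Int.mul_emod, h]; simp
      omega
    · exact h
  have hNodd : P.natAbs % 2 = 1 := by omega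
  have hPN : (P.natAbs : ℤ) ∣ P := Int.natAbs_dvd.2 dvd_rfl
  have hPN' : P ∣ (P.natAbs : ℤ) := Int.dvd_natAbs.2 dvd_rfl
  -- choice of q
  have hEodd : (-εt * A * b5) % 2 = 1 := by
    have : Odd (-εt * A * b5) := by
      refine Odd.mul (Odd.mul ?_ (Int.odd_iff.2 hAodd)) (Int.odd_iff.2 h5)
      rcases hεt with rfl | rfl <;> decide
    exact Int.odd_iff.1 this
  have hbb2 : (-(a1 * b2)) % 2 = 1 := by
    rw [← Int.odd_iff] at h1 h2 ⊢
    exact (h1.mul h2).neg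
  have hbb4 : (-(a3 * b4)) % 2 = 1 := by
    rw [← Int.odd_iff] at h3 h4 ⊢
    exact (h3.mul h4).neg
  obtain ⟨κ, hκ, hκE⟩ : ∃ κ : ℕ, (κ = 1 ∨ κ = 3) ∧ ∀ q : ℕ, q % 4 = κ → (-εt * A * b5 * q) % 4 = 3 := by
    have : (-εt * A * b5) % 4 = 1 ∨ (-εt * A * b5) % 4 = 3 := by omega
    rcases this with h | h
    · refine ⟨3, Or.inr rfl, fun q hq => ?_⟩
      rw [Int.mul_emod, h]; omega
    · refine ⟨1, Or.inl rfl, fun q hq => ?_⟩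
      rw [Int.mul_emod, h]; omega
  obtain ⟨q, hqB, hqp, hqN, hq4, hqJ⟩ := choose_prime (D := -(a1 * b2)) (r0 := q0) hNodd
    ((neg_dvd.2 hd12).trans hPN') (hq0.of_isCoprime_of_dvd_right hPN) hbb2 hκ P.natAbs
  have hqD := hκE q hq4
  have hq2 : q ≠ 2 := by rintro rfl; omega
  have hqP : ¬ (q : ℤ) ∣ P := by
    intro h
    have := Nat.le_of_dvd (by omega) (Int.natCast_dvd.1 h)
    omega
  have hqq : Prime (q : ℤ) := Nat.prime_iff_prime_int.1 hqp
  have not2 : ∀ p : ℕ, p.Prime → p ≠ 2 → ¬ (p : ℤ) ∣ 2 := by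
    intro p hp hp2 h
    have : p ∣ 2 := by exact_mod_cast h
    exact hp2 ((Nat.prime_dvd_prime_iff_eq hp Nat.prime_two).1 this)
  have nmul : ∀ p : ℕ, p.Prime → ∀ x y : ℤ, ¬ (p : ℤ) ∣ x → ¬ (p : ℤ) ∣ y → ¬ (p : ℤ) ∣ x * y :=
    fun p hp x y hx hy h => ((Nat.prime_iff_prime_int.1 hp).dvd_or_dvd h).elim hx hy
  have npow : ∀ p : ℕ, p.Prime → p ≠ 2 → ¬ (p : ℤ) ∣ 2 ^ f :=
    fun p hp hp2 h => not2 p hp hp2 ((Nat.prime_iff_prime_int.1 hp).dvd_of_dvd_pow h)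
  have ndv : ∀ {p : ℕ} {x : ℤ}, ¬ (p : ℤ) ∣ P → x ∣ P → ¬ (p : ℤ) ∣ x := fun h hx hp => h (hp.trans hx)
  have npr : ∀ p r : ℕ, p.Prime → r.Prime → p ≠ r → ¬ (p : ℤ) ∣ r := by
    intro p r hp hr hne h
    exact hne ((Nat.prime_dvd_prime_iff_eq hp hr).1 (by exact_mod_cast h))
  have hqa5 : ¬ (q : ℤ) ∣ 2 ^ f * b5 := nmul q hqp _ _ (npow q hqp hq2) (ndv hqP hd5)
  have hqη : ¬ (q : ℤ) ∣ -(εs * A' * (2 ^ f * b5)) := by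
    rw [dvd_neg]
    exact nmul q hqp _ _ (nmul q hqp _ _ (hεsd q hqp) (ndv hqP hAP')) hqa5
  have hcoPq : IsCoprime P (q : ℤ) := (hqq.coprime_iff_not_dvd.2 hqP).symm
  obtain ⟨r0, hr01, hr02⟩ := crt hcoPq r0' (-(εs * A' * (2 ^ f * b5)))
  have hr0P : IsCoprime r0 P := by
    obtain ⟨k, hk⟩ := hr01
    have : r0 = r0' + P * k := by linarith
    rw [this]
    exact IsCoprime.add_mul_left_left hr0' k
  have hr0q : IsCoprime r0 (q : ℤ) := by
    refine (hqq.coprime_iff_not_dvd.2 fun h => hqη ?_).symm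
    have := dvd_sub h hr02
    simpa using this
  obtain ⟨N, hN⟩ : ∃ N, N = P.natAbs * P.natAbs * q := ⟨_, rfl⟩
  have hNZ : (N : ℤ) ∣ P * P * q := by
    rw [hN]; push_cast
    rw [← Int.natCast_natAbs, ]
    exact mul_dvd_mul (mul_dvd_mul hPN hPN) dvd_rfl
  have hNZ' : P * P * q ∣ (N : ℤ) := by
    rw [hN]; push_cast
    rw [← Int.natCast_natAbs]
    exact mul_dvd_mul (mul_dvd_mul hPN' hPN') dvd_rfl
  have hr0N : IsCoprime r0 (N : ℤ) :=
    ((hr0P.mul_right hr0P).mul_right hr0q).of_isCoprime_of_dvd_right hNZ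
  have hNo : N % 2 = 1 := by
    rw [hN]
    have hqo : Odd q := Nat.odd_iff.2 (by omega)
    exact Nat.odd_iff.1 (((Nat.odd_iff.2 hNodd).mul (Nat.odd_iff.2 hNodd)).mul hqo)
  have hDN : -εt * A * b5 * q ∣ (N : ℤ) := by
    refine Dvd.dvd.trans ?_ hNZ'
    refine mul_dvd_mul (mul_dvd_mul ?_ hd5) dvd_rfl
    rcases hεt with rfl | rfl <;> simpa using hAP
  obtain ⟨κ', hκ', hκr⟩ := choose_mod4 hDN hr0N hqD
  obtain ⟨r, hrB, hrp, hrN, hr4, hrJ⟩ := choose_prime (D := -(a3 * b4)) (r0 := r0) hNo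
    ((neg_dvd.2 hd34).trans ((Dvd.intro (P * q) (by ring) : P ∣ P * P * q).trans hNZ')) hr0N hbb4 hκ' N
  have hrD := hκr r hrN hr4
  have hr2 : r ≠ 2 := by rintro rfl; omega
  have hPqN : P.natAbs ≤ N ∧ q ≤ N := by
    rw [hN]
    have := hqp.pos
    have : 0 < P.natAbs := by omega
    constructor
    · nlinarith [Nat.mul_pos (Nat.mul_pos this this) hqp.pos, Nat.le_mul_of_pos_right P.natAbs (Nat.mul_pos this hqp.pos), mul_assoc P.natAbs P.natAbs q]
    · exact Nat.le_mul_of_pos_left _ (Nat.mul_pos this this)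
  have hrP : ¬ (r : ℤ) ∣ P := by
    intro h
    have := Nat.le_of_dvd (by omega) (Int.natCast_dvd.1 h)
    omega
  have hrq : r ≠ q := by omega
  have hrP0 : P ∣ r - r0' := by
    have := dvd_add (((Dvd.intro (P * q) (by ring) : P ∣ P * P * q).trans hNZ').trans hrN) hr01
    simpa using this
  have hrq0 : (q : ℤ) ∣ r - (-(εs * A' * (2 ^ f * b5))) := by
    have := dvd_add (((Dvd.intro_left (P * P) rfl : (q : ℤ) ∣ P * P * q).trans hNZ').trans hrN) hr02
    rwa [sub_add_sub_cancel] at this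
  -- the numbers t and s
  obtain ⟨t, ht⟩ : ∃ t, t = εt * 2 ^ f * A * q := ⟨_, rfl⟩
  obtain ⟨s, hs⟩ : ∃ s, s = εs * A' * r := ⟨_, rfl⟩
  have hεt0 : εt ≠ 0 := by rcases hεt with rfl | rfl <;> simp
  have hεs0 : εs ≠ 0 := by rcases hεs with rfl | rfl <;> simp
  have ht0 : t ≠ 0 := by
    rw [ht]; exact mul_ne_zero (mul_ne_zero (mul_ne_zero hεt0 (by positivity)) hA0.ne') (by exact_mod_cast hqp.ne_zero)
  have hs0 : s ≠ 0 := by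
    rw [hs]; exact mul_ne_zero (mul_ne_zero hεs0 hA0'.ne') (by exact_mod_cast hrp.ne_zero)
  have hLocS : ∀ p ∈ P.natAbs.primeFactors, ∀ [Fact p.Prime],
      Loc ℚ_[p] a1 (2 * b2 : ℤ) a3 (2 * b4 : ℤ) (2 ^ f * b5 : ℤ) (t : ℤ) (s : ℤ) := by
    intro p hp _
    obtain ⟨k1, k2, k3, k4, k5⟩ := hloc p hp
    obtain ⟨c, hc1, hc2⟩ := hq0x q (hPN'.trans hqN) p hp
    obtain ⟨c', hc1', hc2'⟩ := hr0x r hrP0 p hp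
    have := Loc.congr (hS2 p hp) k3 k4 hc2 hc2' k5
    rw [ht, hs, hc1, hc1']
    push_cast at this ⊢
    exact this
  have hLocR : Loc ℝ a1 (2 * b2 : ℤ) a3 (2 * b4 : ℤ) (2 ^ f * b5 : ℤ) (t : ℤ) (s : ℤ) := by
    have p1 : (0 : ℝ) < 2 ^ f * A * q := by
      have : (0 : ℝ) < A := by exact_mod_cast hA0
      have : (0 : ℝ) < q := by exact_mod_cast hqp.pos
      positivity
    have p2 : (0 : ℝ) < A' * r := by
      have : (0 : ℝ) < A' := by exact_mod_cast hA0'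
      have : (0 : ℝ) < r := by exact_mod_cast hrp.pos
      positivity
    rw [← Loc.sq (Real.sqrt_pos.2 p1).ne' (Real.sqrt_pos.2 p2).ne', Real.sq_sqrt p1.le,
      Real.sq_sqrt p2.le] at hLR
    rw [ht, hs]
    push_cast at hLR ⊢
    convert hLR using 1 <;> ring
  -- three applications of hm3
  have I1 : Iso3 ℚ (a1 : ℤ) (2 * b2 : ℤ) (-t : ℤ) := by
    refine hm3 _ _ _ n1 n2' (neg_ne_zero.2 ht0) ?_ (by simpa using hLocR.1)
    intro p hp hp2
    by_cases hpS : p ∈ P.natAbs.primeFactors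
    · have := (hLocS p hpS).1
      simpa using this
    have hpP : ¬ (p : ℤ) ∣ P := fun h => hpS (hSmem p hp.out h)
    have u1 := ndv hpP hd1
    have u2 := nmul p hp.out _ _ (not2 p hp.out hp2) (ndv hpP hd2)
    by_cases hpq : p = q
    · subst hpq
      refine iso3_of_jac12 hp2 _ u1 u2 ?_
      obtain ⟨w, hw⟩ := jac_sq hqJ
      exact ⟨w, by convert hw using 1; ring⟩
    · refine iso3_int_units hp2 u1 u2 ?_
      rw [dvd_neg, ht]
      exact nmul p hp.out _ _ (nmul p hp.out _ _ (nmul p hp.out _ _ (hεtd p hp.out) (npow p hp.out hp2))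
        (ndv hpP hAP)) (npr p q hp.out hqp hpq)
  have I2 : Iso3 ℚ (a3 : ℤ) (2 * b4 : ℤ) (-s : ℤ) := by
    refine hm3 _ _ _ n3 n4' (neg_ne_zero.2 hs0) ?_ (by simpa using hLocR.2.1)
    intro p hp hp2
    by_cases hpS : p ∈ P.natAbs.primeFactors
    · have := (hLocS p hpS).2.1
      simpa using this
    have hpP : ¬ (p : ℤ) ∣ P := fun h => hpS (hSmem p hp.out h)
    have u1 := ndv hpP hd3
    have u2 := nmul p hp.out _ _ (not2 p hp.out hp2) (ndv hpP hd4)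
    by_cases hpq : p = r
    · subst hpq
      refine iso3_of_jac12 hp2 _ u1 u2 ?_
      obtain ⟨w, hw⟩ := jac_sq hrJ
      exact ⟨w, by convert hw using 1; ring⟩
    · refine iso3_int_units hp2 u1 u2 ?_
      rw [dvd_neg, hs]
      exact nmul p hp.out _ _ (nmul p hp.out _ _ (hεsd p hp.out)
        (ndv hpP hAP')) (npr p r hp.out hrp hpq)
  have I3 : Iso3 ℚ (t : ℤ) (s : ℤ) (2 ^ f * b5 : ℤ) := by
    refine hm3 _ _ _ ht0 hs0 n5' ?_ hLocR.2.2
    intro p hp hp2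
    by_cases hpS : p ∈ P.natAbs.primeFactors
    · exact (hLocS p hpS).2.2
    have hpP : ¬ (p : ℤ) ∣ P := fun h => hpS (hSmem p hp.out h)
    have u5 := nmul p hp.out _ _ (npow p hp.out hp2) (ndv hpP hd5)
    have ut : p ≠ q → ¬ (p : ℤ) ∣ t := by
      intro hpq
      rw [ht]
      exact nmul p hp.out _ _ (nmul p hp.out _ _ (nmul p hp.out _ _ (hεtd p hp.out) (npow p hp.out hp2))
        (ndv hpP hAP)) (npr p q hp.out hqp hpq)
    have us : p ≠ r → ¬ (p : ℤ) ∣ s := by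
      intro hpq
      rw [hs]
      exact nmul p hp.out _ _ (nmul p hp.out _ _ (hεsd p hp.out)
        (ndv hpP hAP')) (npr p r hp.out hrp hpq)
    by_cases hpq : p = q
    · subst hpq
      refine Iso3.swap12 (Iso3.swap23 (iso3_of_jac12 hp2 _ (us (Ne.symm hrq)) u5 ?_))
      refine ⟨εs * A' * (2 ^ f * b5), ?_⟩
      have h6 : (εs * A' * (2 ^ f * b5)) ^ 2 + s * (2 ^ f * b5) =
          εs * A' * (2 ^ f * b5) * (r - (-(εs * A' * (2 ^ f * b5)))) := by
        rw [hs]; ring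
      rw [h6]
      exact hrq0.mul_left _
    by_cases hpr : p = r
    · subst hpr
      refine Iso3.swap23 (iso3_of_jac12 hp2 _ (ut hpq) u5 ?_)
      obtain ⟨w, hw⟩ := jac_sq hrD
      refine ⟨2 ^ f * w, ?_⟩
      have h6 : (2 ^ f * w) ^ 2 + t * (2 ^ f * b5) = (2 ^ f) ^ 2 * (w ^ 2 - -εt * A * b5 * q) := by
        rw [ht]; ring
      rw [h6]
      exact hw.mul_left _
    · exact iso3_int_units hp2 (ut hpq) (us hpr) u5
  refine lemmaK_conv (t := (t : ℤ)) (s := (s : ℤ)) (by exact_mod_cast ht0) (by exact_mod_cast hs0) ?_ ?_ I3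
  · simpa using I1
  · simpa using I2
end HM
namespace HM
open LocalPart

lemma two_class {x : ℤ} (hx : x ≠ 0) : ∃ (f : ℕ) (b s : ℤ), f ≤ 1 ∧ b % 2 = 1 ∧ s ≠ 0 ∧ x = 2 ^ f * b * s ^ 2 := by
  have hfin : FiniteMultiplicity (2 : ℤ) x := Int.finiteMultiplicity_iff.2 ⟨by norm_num, hx⟩
  obtain ⟨y, h1, h2⟩ := hfin.exists_eq_pow_mul_and_not_dvd
  refine ⟨multiplicity 2 x % 2, y, 2 ^ (multiplicity 2 x / 2), by omega, by omega, by positivity, ?_⟩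
  have : (2 : ℤ) ^ multiplicity 2 x = 2 ^ (multiplicity 2 x % 2) * (2 ^ (multiplicity 2 x / 2)) ^ 2 := by
    rw [← pow_mul, ← pow_add]; congr 1; omega
  conv_lhs => rw [h1, this]
  ring

lemma isoF_perm {K : Type*} [Field K] {ι : Type*} [Fintype ι] (σ : ι → ι) (hσ : Function.Injective σ) (c : ι → K) :
    IsoF K (fun i => c (σ i)) ↔ IsoF K c := by
  constructor
  · exact IsoF.lift σ hσ
  · intro h
    let e := Equiv.ofBijective σ (Finite.injective_iff_bijective.1 hσ)
    refine IsoF.lift e.symm e.symm.injective ?_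
    have : (fun k => c (σ (e.symm k))) = c := by
      funext k
      congr 1
      exact e.apply_symm_apply k
    rw [this]; exact h

lemma isoF_sq {K : Type*} [Field K] {ι : Type*} [Fintype ι] {a b s : ι → K}
    (hs : ∀ i, s i ≠ 0) (hb : ∀ i, b i = a i * s i ^ 2) : IsoF K b ↔ IsoF K a := by
  refine ⟨IsoF.of_sq hs hb, IsoF.of_sq (s := fun i => (s i)⁻¹) (fun i => inv_ne_zero (hs i)) fun i => ?_⟩
  rw [hb]
  have := hs i
  field_simp

lemma isoF_scale {ι : Type*} [Fintype ι] {K : Type*} [Field K] {a : ι → K} {k : K} (hk : k ≠ 0) :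
    IsoF K (fun i => k * a i) ↔ IsoF K a := by
  refine ⟨IsoF.scale hk, fun h => IsoF.scale (inv_ne_zero hk) ?_⟩
  have : (fun i => k⁻¹ * (k * a i)) = a := by funext i; field_simp
  rw [this]; exact h

lemma iso5_replace {K : Type*} [Field K] {a b c d e : K} (hab : a + b ≠ 0) :
    Iso5 K (a + b) (a * b * (a + b)) c d e ↔ Iso5 K a b c d e := by
  constructor
  · rintro ⟨x, y, z, u, v, h0, h⟩
    refine ⟨x - b * y, x + a * y, z, u, v, ?_, by linear_combination h⟩
    by_contra! hh
    obtain ⟨h1, h2, h3, h4, h5⟩ := hh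
    have hy : (a + b) * y = 0 := by linear_combination h2 - h1
    have hy : y = 0 := (mul_eq_zero.1 hy).resolve_left hab
    subst hy
    simp at h1
    simp_all
  · rintro ⟨x, y, z, u, v, h0, h⟩
    refine ⟨(a * x + b * y) / (a + b), (y - x) / (a + b), z, u, v, ?_, ?_⟩
    · by_contra! hh
      obtain ⟨h1, h2, h3, h4, h5⟩ := hh
      have h1 : a * x + b * y = 0 := by simpa [hab] using h1
      have h2 : y - x = 0 := by simpa [hab] using h2
      have : (a + b) * x = 0 := by linear_combination h1 - b * h2
      have hx : x = 0 := (mul_eq_zero.1 this).resolve_left hab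
      subst hx
      simp at h2
      simp_all
    · field_simp
      linear_combination (a + b) * h

/-- the case of two even and two odd -/
lemma meyer_case1 {f : Fin 5 → ℕ} {b : Fin 5 → ℤ} (hb : ∀ i, b i % 2 = 1)
    (σ : Fin 5 → Fin 5) (hσ : Function.Injective σ) (h0 : f (σ 0) = 0) (h1 : f (σ 1) = 1)
    (h2 : f (σ 2) = 0) (h3 : f (σ 3) = 1)
    (hR : IsoF ℝ (fun i => ((2 ^ f i * b i : ℤ) : ℝ))) : IsoF ℚ (fun i => ((2 ^ f i * b i : ℤ) : ℚ)) := by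
  rw [← isoF_perm σ hσ, isoF_iff5] at hR ⊢
  simp only [h0, h1, h2, h3, pow_zero, pow_one, one_mul] at hR ⊢
  exact meyerA (hb _) (hb _) (hb _) (hb _) (hb _) hR

lemma Iso5.rot {K : Type*} [Field K] {a b c d e : K} (h : Iso5 K a b c d e) : Iso5 K c a d b e := by
  obtain ⟨x, y, z, u, v, h0, h⟩ := h
  exact ⟨z, x, u, y, v, by tauto, by linear_combination h⟩

lemma Iso5.rot2 {K : Type*} [Field K] {a b c d e : K} (h : Iso5 K c a d b e) : Iso5 K a b c d e := by
  obtain ⟨x, y, z, u, v, h0, h⟩ := h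
  exact ⟨y, u, x, z, v, by tauto, by linear_combination h⟩

lemma meyer_odd4 {a b c d e : ℤ} {f : ℕ} (ha : a % 2 = 1) (hb : b % 2 = 1) (hc : c % 2 = 1) (hd : d % 2 = 1)
    (he : e % 2 = 1) (hab : a % 4 = b % 4) (hR : Iso5 ℝ a b c d (2 ^ f * e : ℤ)) :
    Iso5 ℚ a b c d (2 ^ f * e : ℤ) := by
  have hn : a + b ≠ 0 := by omega
  obtain ⟨k, hk⟩ : ∃ k, a + b = 2 * k := ⟨(a + b) / 2, by omega⟩
  have hk1 : k % 2 = 1 := by omega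
  have hk2 : (a * b * k) % 2 = 1 := by
    rw [← Int.odd_iff] at ha hb hk1 ⊢
    exact (ha.mul hb).mul hk1
  have e1 : ∀ K : Type, ∀ [Field K], ((a : K) + b) = (2 * k : ℤ) := by
    intro K _
    rw [← hk]; push_cast; ring
  have e2 : ∀ K : Type, ∀ [Field K], (a : K) * b * (a + b) = (2 * (a * b * k) : ℤ) := by
    intro K _
    rw [e1]; push_cast; ring
  rw [← iso5_replace (by exact_mod_cast hn), e2, e1] at hR
  rw [← iso5_replace (by exact_mod_cast hn), e2, e1]
  exact Iso5.rot2 (meyerA hc hk1 hd hk2 he (Iso5.rot hR))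

lemma meyer_case2 {f : Fin 5 → ℕ} {b : Fin 5 → ℤ} (hb : ∀ i, b i % 2 = 1) {m : Fin 5}
    (hm : ∀ i, i ≠ m → f i = 0)
    (hR : IsoF ℝ (fun i => ((2 ^ f i * b i : ℤ) : ℝ))) : IsoF ℚ (fun i => ((2 ^ f i * b i : ℤ) : ℚ)) := by
  have hm' : ∀ i, i ≠ 4 → f (Equiv.swap m 4 i) = 0 := by
    intro i hi
    apply hm
    intro h
    apply hi
    have := congrArg (Equiv.swap m 4) h
    simpa using this
  have key : ∀ σ : Fin 5 → Fin 5, Function.Injective σ → σ 4 = 4 →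
      b (Equiv.swap m 4 (σ 0)) % 4 = b (Equiv.swap m 4 (σ 1)) % 4 →
      IsoF ℚ (fun i => ((2 ^ f i * b i : ℤ) : ℚ)) := by
    intro σ hσ h4 h01
    have hi : Function.Injective fun i => Equiv.swap m 4 (σ i) := (Equiv.injective _).comp hσ
    rw [← isoF_perm _ hi, isoF_iff5] at hR ⊢
    have h : ∀ i, i ≠ 4 → f (Equiv.swap m 4 (σ i)) = 0 := fun i hi' => hm' _ (fun h => hi' (hσ (h.trans h4.symm)))
    simp only [h 0 (by decide), h 1 (by decide), h 2 (by decide), h 3 (by decide), pow_zero, one_mul] at hR ⊢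
    exact meyer_odd4 (hb _) (hb _) (hb _) (hb _) (hb _) h01 hR
  have d0 := hb (Equiv.swap m 4 0)
  have d1 := hb (Equiv.swap m 4 1)
  have d2 := hb (Equiv.swap m 4 2)
  have : b (Equiv.swap m 4 0) % 4 = b (Equiv.swap m 4 1) % 4 ∨ b (Equiv.swap m 4 0) % 4 = b (Equiv.swap m 4 2) % 4
    ∨ b (Equiv.swap m 4 1) % 4 = b (Equiv.swap m 4 2) % 4 := by omega
  rcases this with h | h | h
  · exact key ![0, 1, 2, 3, 4] (by decide) rfl h
  · exact key ![0, 2, 1, 3, 4] (by decide) rfl h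
  · exact key ![1, 2, 0, 3, 4] (by decide) rfl h

lemma comb5 (g : Fin 5 → Bool) : (∃ m, ∀ i, i ≠ m → g i = false) ∨ (∃ m, ∀ i, i ≠ m → g i = true) ∨
    ∃ i j k l : Fin 5, i ≠ j ∧ k ≠ l ∧ g i = true ∧ g j = true ∧ g k = false ∧ g l = false := by
  have h1 : (Finset.univ.filter fun i => g i = true).card + (Finset.univ.filter fun i => g i = false).card = 5 := by
    have := Finset.card_filter_add_card_filter_not (s := (Finset.univ : Finset (Fin 5))) (fun i => g i = true)
    simpa using this
  by_cases h2 : 1 < (Finset.univ.filter fun i => g i = true).card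
  · by_cases h3 : 1 < (Finset.univ.filter fun i => g i = false).card
    · obtain ⟨i, hi, j, hj, hij⟩ := Finset.one_lt_card.1 h2
      obtain ⟨k, hk, l, hl, hkl⟩ := Finset.one_lt_card.1 h3
      right; right
      exact ⟨i, j, k, l, hij, hkl, by simpa using hi, by simpa using hj, by simpa using hk, by simpa using hl⟩
    · right; left
      obtain ⟨m, hm⟩ := Finset.card_le_one_iff_subset_singleton.1 (not_lt.1 h3)
      refine ⟨m, fun i hi => ?_⟩
      by_contra h
      have := hm (show i ∈ _ by simpa using h)
      exact hi (by simpa using this)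
  · left
    obtain ⟨m, hm⟩ := Finset.card_le_one_iff_subset_singleton.1 (not_lt.1 h2)
    refine ⟨m, fun i hi => ?_⟩
    by_contra h
    have := hm (show i ∈ _ by simpa using h)
    exact hi (by simpa using this)

lemma meyer5' {f : Fin 5 → ℕ} {b : Fin 5 → ℤ} (hf : ∀ i, f i ≤ 1) (hb : ∀ i, b i % 2 = 1)
    (hR : IsoF ℝ (fun i => ((2 ^ f i * b i : ℤ) : ℝ))) : IsoF ℚ (fun i => ((2 ^ f i * b i : ℤ) : ℚ)) := by
  rcases comb5 (fun i => decide (f i = 1)) with ⟨m, hm⟩ | ⟨m, hm⟩ | ⟨i, j, k, l, hij, hkl, hi, hj, hk, hl⟩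
  · refine meyer_case2 hb (m := m) (fun i hi => ?_) hR
    have := hm i hi
    have := hf i
    simp at *
    omega
  · have e : ∀ K : Type, ∀ [Field K], ∀ [CharZero K], (IsoF K (fun i => ((2 ^ f i * b i : ℤ) : K)) ↔
        IsoF K (fun i => ((2 ^ (1 - f i) * b i : ℤ) : K))) := by
      intro K _ _
      rw [← isoF_scale (k := (2 : K)) two_ne_zero]
      refine isoF_sq (s := fun i => 2 ^ f i) (fun i => pow_ne_zero _ two_ne_zero) fun i => ?_
      have := hf i
      interval_cases f i <;> push_cast <;> ring
    rw [e] at hR ⊢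
    refine meyer_case2 hb (m := m) (fun i hi => ?_) hR
    have := hm i hi
    simp at this
    omega
  · simp at hi hj hk hl
    obtain ⟨m, hm⟩ : ∃ m, m ∉ ({i, j, k, l} : Finset (Fin 5)) := by
      by_contra! h
      have h1 := Finset.card_le_card (fun x _ => h x : (Finset.univ : Finset (Fin 5)) ⊆ _)
      have h2 := Finset.card_le_four (a := i) (b := j) (c := k) (d := l)
      simp at h1
      omega
    have hki : k ≠ i := by rintro rfl; exact hk hi
    have hkj : k ≠ j := by rintro rfl; exact hk hj
    have hli : l ≠ i := by rintro rfl; exact hl hi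
    have hlj : l ≠ j := by rintro rfl; exact hl hj
    simp only [Finset.mem_insert, Finset.mem_singleton, not_or] at hm
    obtain ⟨m1, m2, m3, m4⟩ := hm
    refine meyer_case1 hb ![k, i, l, j, m] ?_ ?_ hi ?_ hj hR
    · intro x y hxy
      fin_cases x <;> fin_cases y <;> simp_all
    · have := hf k
      simp; omega
    · have := hf l
      simp; omega

theorem meyer5 {c : Fin 5 → ℤ} (hc : ∀ i, c i ≠ 0) (hR : IsoF ℝ (fun i => (c i : ℝ))) :
    IsoF ℚ (fun i => (c i : ℚ)) := by
  choose f b s hf hb hs hE using fun i => two_class (hc i)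
  have e : ∀ K : Type, ∀ [Field K], ∀ [CharZero K], (IsoF K (fun i => (c i : K)) ↔
        IsoF K (fun i => ((2 ^ f i * b i : ℤ) : K))) := by
    intro K _ _
    refine isoF_sq (s := fun i => (s i : K)) (fun i => by exact_mod_cast hs i) fun i => ?_
    rw [hE i]; push_cast; ring
  rw [e] at hR ⊢
  exact meyer5' hf hb hR

theorem meyer {n : ℕ} (hn : 5 ≤ n) {w : Fin n → ℚ} (hw : ∀ i, w i ≠ 0) {i j : Fin n}
    (hi : 0 < w i) (hj : w j < 0) : IsoF ℚ w := by
  obtain ⟨T, hT, hT5⟩ := Finset.exists_superset_card_eq (s := {i, j}) (n := 5)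
    (Finset.card_le_two.trans (by norm_num)) (by simpa using hn)
  let e := T.equivFinOfCardEq hT5
  have hiT : i ∈ T := hT (by simp)
  have hjT : j ∈ T := hT (by simp)
  refine IsoF.lift (fun k : Fin 5 => ((e.symm k : T) : Fin n)) (fun x y h => e.symm.injective (Subtype.ext h)) ?_
  let v : Fin 5 → ℚ := fun k => w (e.symm k : T)
  have hv : ∀ k, v k ≠ 0 := fun k => hw _
  change IsoF ℚ v
  have hcv : ∀ k, (((v k).num * (v k).den : ℤ) : ℚ) = v k * ((v k).den : ℚ) ^ 2 := by
    intro k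
    have h1 := Rat.mul_den_eq_num (v k)
    push_cast
    rw [← h1]; ring
  have hd : ∀ k, (0 : ℚ) < (v k).den := fun k => by exact_mod_cast (v k).den_pos
  rw [← isoF_sq (b := fun k => (((v k).num * (v k).den : ℤ) : ℚ)) (s := fun k => ((v k).den : ℚ))
    (fun k => (hd k).ne') hcv]
  refine meyer5 (fun k => ?_) ?_
  · exact mul_ne_zero (Rat.num_ne_zero.2 (hv k)) (by exact_mod_cast (v k).den_nz)
  · refine iso_real (i := e ⟨i, hiT⟩) (j := e ⟨j, hjT⟩) ?_ ?_
    · have : (0 : ℚ) < (((v (e ⟨i, hiT⟩)).num * (v (e ⟨i, hiT⟩)).den : ℤ) : ℚ) := by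
        rw [hcv]
        refine mul_pos ?_ (pow_pos (hd _) _)
        simpa [v] using hi
      exact_mod_cast this
    · have : (((v (e ⟨j, hjT⟩)).num * (v (e ⟨j, hjT⟩)).den : ℤ) : ℚ) < 0 := by
        rw [hcv]
        refine mul_neg_of_neg_of_pos ?_ (pow_pos (hd _) _)
        simpa [v] using hj
      exact_mod_cast this
end HM
namespace GlobalPart
open QuadraticMap

def U {n : ℕ} (R : Type*) [CommRing R] (a : Fin n → Fin n → ℤ) : Matrix (Fin n) (Fin n) R :=
  Matrix.of fun i j => if i ≤ j then (a i j : R) else 0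

def qf {n : ℕ} (R : Type*) [CommRing R] (a : Fin n → Fin n → ℤ) : QuadraticMap R (Fin n → R) R :=
  (Matrix.toBilin' (U R a)).toQuadraticMap

lemma qf_apply {n : ℕ} {R : Type*} [CommRing R] (a : Fin n → Fin n → ℤ) (x : Fin n → R) :
    qf R a x = ∑ i, ∑ j ∈ Finset.Ici i, (a i j : R) * x i * x j := by
  rw [qf, LinearMap.BilinMap.toQuadraticMap_apply, Matrix.toBilin'_apply]
  refine Finset.sum_congr rfl fun i _ => ?_
  rw [← Finset.sum_subset (Finset.subset_univ (Finset.Ici i))]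
  · refine Finset.sum_congr rfl fun j hj => ?_
    rw [Finset.mem_Ici] at hj
    simp [U, hj]; ring
  · intro j _ hj
    rw [Finset.mem_Ici] at hj
    simp [U, hj]

lemma qf_cast {n : ℕ} {R : Type*} [CommRing R] (a : Fin n → Fin n → ℤ) (x : Fin n → ℤ) :
    qf R a (fun i => (x i : R)) = ((qf ℤ a x : ℤ) : R) := by
  rw [qf_apply, qf_apply]; push_cast; rfl

lemma polar_cast {n : ℕ} {R : Type*} [CommRing R] (a : Fin n → Fin n → ℤ) (x y : Fin n → ℤ) :
    polar (qf R a) (fun i => (x i : R)) (fun i => (y i : R)) = ((polar (qf ℤ a) x y : ℤ) : R) := by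
  unfold polar
  have : (fun i => (x i : R)) + (fun i => (y i : R)) = fun i => (((x + y) i : ℤ) : R) := by
    funext i; simp
  rw [this, qf_cast, qf_cast, qf_cast]; push_cast; rfl

variable {n : ℕ} {a : Fin n → Fin n → ℤ}

def Ms (a : Fin n → Fin n → ℤ) : Matrix (Fin n) (Fin n) ℚ := Matrix.of fun i j : Fin n =>
        if i = j then (a i i : ℚ)
        else if i < j then (a i j : ℚ) / 2 else (a j i : ℚ) / 2

lemma polar_eq (x y : Fin n → ℚ) : polar (qf ℚ a) x y = 2 * Matrix.toBilin' (Ms a) x y := by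
  rw [qf, LinearMap.BilinMap.polar_toQuadraticMap]
  simp only [Matrix.toBilin'_apply]
  rw [Finset.sum_comm (f := fun i j => y i * U ℚ a i j * x j), ← Finset.sum_add_distrib, Finset.mul_sum]
  refine Finset.sum_congr rfl fun i _ => ?_
  rw [← Finset.sum_add_distrib, Finset.mul_sum]
  refine Finset.sum_congr rfl fun j _ => ?_
  rcases lt_trichotomy i j with h | h | h
  · simp [U, Ms, h, h.le, h.ne, not_le.2 h]; ring
  · subst h; simp [U, Ms]; ring
  · simp [U, Ms, h, h.le, h.ne', not_le.2 h, not_lt.2 h.le]; ring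

lemma assoc_eq : associated (R := ℚ) (qf ℚ a) = Matrix.toBilin' (Ms a) := by
  refine LinearMap.ext fun x => LinearMap.ext fun y => ?_
  have h := congrArg (fun B => B x y) (two_nsmul_associated ℚ (qf ℚ a))
  have h2 := polar_eq (a := a) x y
  simp only [LinearMap.smul_apply, polarBilin_apply_apply, nsmul_eq_mul] at h
  rw [h2] at h
  push_cast at h
  linarith

lemma int_mult (x : Fin n → ℚ) : ∃ (N : ℤ) (y : Fin n → ℤ), N ≠ 0 ∧ (fun i => (y i : ℚ)) = (N : ℚ) • x := by
  obtain ⟨b, hb⟩ := IsLocalization.exist_integer_multiples_of_finite (nonZeroDivisors ℤ) x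
  choose y hy using hb
  refine ⟨b, y, nonZeroDivisors.ne_zero b.2, ?_⟩
  funext i
  have := hy i
  simpa using this

lemma exists_iso (hn : 5 ≤ n) (hnd : (Ms a).det ≠ 0) (hpos : ∃ x : Fin n → ℤ, 0 < qf ℤ a x)
    (hneg : ∃ x : Fin n → ℤ, qf ℤ a x < 0) : ∃ v : Fin n → ℤ, v ≠ 0 ∧ qf ℤ a v = 0 := by
  have hB := LinearMap.BilinForm.nondegenerate_toBilin'_of_det_ne_zero' _ hnd
  obtain ⟨w, ⟨E⟩⟩ := QuadraticForm.equivalent_weightedSumSquares_units_of_nondegenerate' (qf ℚ a)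
    (by rw [assoc_eq]; exact hB.1)
  have hdim : Module.finrank ℚ (Fin n → ℚ) = n := by simp
  have hi : ∃ i, (0 : ℚ) < w i := by
    obtain ⟨x, hx⟩ := hpos
    by_contra! h
    have h1 : (0 : ℚ) < qf ℚ a (fun i => (x i : ℚ)) := by rw [qf_cast]; exact_mod_cast hx
    rw [← E.map_app, weightedSumSquares_apply] at h1
    apply absurd h1 (not_lt.2 _)
    refine Finset.sum_nonpos fun i _ => ?_
    have := mul_nonpos_of_nonpos_of_nonneg (h i) (mul_self_nonneg (E (fun i => (x i : ℚ)) i))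
    rw [Units.smul_def, smul_eq_mul]; exact this
  have hj : ∃ i, (w i : ℚ) < 0 := by
    obtain ⟨x, hx⟩ := hneg
    by_contra! h
    have h1 : qf ℚ a (fun i => (x i : ℚ)) < 0 := by rw [qf_cast]; exact_mod_cast hx
    rw [← E.map_app, weightedSumSquares_apply] at h1
    apply absurd h1 (not_lt.2 _)
    refine Finset.sum_nonneg fun i _ => ?_
    have := mul_nonneg (h i) (mul_self_nonneg (E (fun i => (x i : ℚ)) i))
    rw [Units.smul_def, smul_eq_mul]; exact this
  obtain ⟨i, hi⟩ := hi
  obtain ⟨j, hj⟩ := hj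
  obtain ⟨z, hz, hs⟩ := HM.meyer (hdim.symm ▸ hn) (w := fun i => (w i : ℚ)) (fun i => (w i).ne_zero) hi hj
  have h0 : qf ℚ a (E.symm z) = 0 := by
    rw [E.symm.map_app, weightedSumSquares_apply, ← hs]
    refine Finset.sum_congr rfl fun i _ => ?_
    rw [Units.smul_def, smul_eq_mul]; ring
  obtain ⟨N, y, hN, hy⟩ := int_mult (E.symm z)
  refine ⟨y, ?_, ?_⟩
  · rintro rfl
    have h1 : (N : ℚ) • E.symm z = 0 := by rw [← hy]; funext i; simp
    rcases smul_eq_zero.1 h1 with h | h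
    · exact hN (by exact_mod_cast h)
    · apply hz
      have := congrArg E h
      simpa using this
  · have h1 : qf ℚ a (fun i => (y i : ℚ)) = 0 := by rw [hy, QuadraticMap.map_smul, h0, smul_zero]
    rw [qf_cast] at h1
    exact_mod_cast h1

lemma exists_d (hnd : (Ms a).det ≠ 0) {v : Fin n → ℤ} (hv : v ≠ 0) :
    ∃ (d : ℤ) (w : Fin n → ℤ), d ≠ 0 ∧ polar (qf ℤ a) v w = d ∧ ∀ x, d ∣ polar (qf ℤ a) v x := by
  have hB := LinearMap.BilinForm.nondegenerate_toBilin'_of_det_ne_zero' _ hnd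
  obtain ⟨y, hy⟩ : ∃ y : Fin n → ℤ, polar (qf ℤ a) v y ≠ 0 := by
    by_contra! h
    have h1 : (fun i => (v i : ℚ)) = 0 := by
      apply hB.1
      intro y
      obtain ⟨N, z, hN, hz⟩ := int_mult y
      have h2 : polar (qf ℚ a) (fun i => (v i : ℚ)) (fun i => (z i : ℚ)) = 0 := by
        rw [polar_cast, h]; simp
      rw [hz, polar_eq, map_smul] at h2
      simpa [hN] using h2
    apply hv
    funext i
    have := congrFun h1 i
    simpa using this
  let I : Submodule ℤ ℤ := LinearMap.range ((polarBilin (qf ℤ a)) v)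
  have hI : I.IsPrincipal := inferInstance
  obtain ⟨d, hd⟩ := hI
  have hmem : ∀ x, polar (qf ℤ a) v x ∈ I := fun x => ⟨x, rfl⟩
  have hdI : d ∈ I := by rw [hd]; exact Submodule.mem_span_singleton_self d
  obtain ⟨w, hw⟩ := hdI
  have hdv : ∀ x, d ∣ polar (qf ℤ a) v x := by
    intro x
    have := hmem x
    rw [hd, Submodule.mem_span_singleton] at this
    obtain ⟨c, hc⟩ := this
    exact ⟨c, by rw [← hc]; simp [mul_comm]⟩
  refine ⟨d, w, ?_, hw, hdv⟩
  rintro rfl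
  exact hy (zero_dvd_iff.1 (hdv y))

lemma ortho_exists (hn : 5 ≤ n) (hnd : (Ms a).det ≠ 0) (v v' : Fin n → ℤ) :
    ∃ e : Fin n → ℤ, polar (qf ℤ a) v e = 0 ∧ polar (qf ℤ a) v' e = 0 ∧ qf ℤ a e ≠ 0 := by
  have hB := LinearMap.BilinForm.nondegenerate_toBilin'_of_det_ne_zero' _ hnd
  set B := Matrix.toBilin' (Ms a) with hBdef
  let c : (Fin n → ℤ) → (Fin n → ℚ) := fun x i => (x i : ℚ)
  let W : Submodule ℚ (Fin n → ℚ) := Submodule.span ℚ {c v, c v'}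
  have hW : Module.finrank ℚ W ≤ 2 := by
    have := finrank_span_le_card (R := ℚ) (({c v, c v'} : Finset (Fin n → ℚ)) : Set (Fin n → ℚ))
    have h2 := Finset.card_le_two (a := c v) (b := c v')
    simp only [Finset.toFinset_coe] at this
    rw [Finset.coe_insert, Finset.coe_singleton] at this
    exact this.trans h2
  have h1 := LinearMap.BilinForm.finrank_orthogonal hB W
  have h2 := LinearMap.BilinForm.finrank_orthogonal hB (B.orthogonal W)
  have hdim : Module.finrank ℚ (Fin n → ℚ) = n := by simp
  rw [hdim] at h1 h2
  obtain ⟨e, he, hQe⟩ : ∃ e ∈ B.orthogonal W, qf ℚ a e ≠ 0 := by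
    by_contra! h
    have hle : B.orthogonal W ≤ B.orthogonal (B.orthogonal W) := by
      intro x hx y hy
      have h3 : polar (qf ℚ a) y x = 0 := by
        unfold polar
        rw [h _ (add_mem hy hx), h _ hy, h _ hx]; simp
      rw [polar_eq] at h3
      have : B y x = 0 := by simpa using h3
      exact this
    have := Submodule.finrank_mono hle
    omega
  obtain ⟨N, y, hN, hy⟩ := int_mult e
  have hN' : (N : ℚ) ≠ 0 := by exact_mod_cast hN
  have hpol : ∀ z : Fin n → ℤ, c z ∈ W → polar (qf ℤ a) z y = 0 := by
    intro z hz
    have h3 : B (c z) e = 0 := he _ hz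
    have h4 : polar (qf ℚ a) (c z) (fun i => (y i : ℚ)) = 0 := by
      rw [hy, polar_eq, map_smul, ← hBdef, h3]; simp
    rw [polar_cast] at h4
    exact_mod_cast h4
  refine ⟨y, hpol v (Submodule.subset_span (by simp)), hpol v' (Submodule.subset_span (by simp)), ?_⟩
  intro h
  have h5 : qf ℚ a (fun i => (y i : ℚ)) = 0 := by rw [qf_cast, h]; simp
  rw [hy, QuadraticMap.map_smul] at h5
  simp [hN', hQe] at h5
end GlobalPart
namespace GlobalPart
open QuadraticMap

lemma q_expand {R M : Type*} [CommRing R] [AddCommGroup M] [Module R M] (Q : QuadraticMap R M R)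
    (x z : M) (k : R) : Q (x + k • z) = Q x + k * (polar Q x z + k * Q z) := by
  rw [QuadraticMap.map_add Q, QuadraticMap.map_smul, polar_smul_right]
  simp only [smul_eq_mul]; ring

variable {p : ℕ} [hp : Fact p.Prime] {n : ℕ} {a : Fin n → Fin n → ℤ}

lemma perturb (Q : QuadraticMap ℤ_[p] (Fin n → ℤ_[p]) ℤ_[p]) {x v w : Fin n → ℤ_[p]}
    (hx : LocalPart.Prim p x) {m : ℤ_[p]} (hm : m ≠ 0) (hQ : Q x = m) (hvw : polar Q v w ≠ 0) :
    ∃ x', LocalPart.Prim p x' ∧ Q x' = m ∧ polar Q v x' ≠ 0 := by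
  by_cases h : polar Q v x ≠ 0
  · exact ⟨x, hx, hQ, h⟩
  push Not at h
  set s := polar Q x w + 4 * p * m * Q w with hs
  obtain ⟨r, hr, hr0⟩ := LocalPart.quad_root (p := p) (A := 1) (b := 1) (C := -(p * s)) (t0 := 0)
    (by simp) (by simp)
  have hpr : (p : ℤ_[p]) ∣ r := by simpa using hr0
  have hu : IsUnit (1 + 2 * r) := LocalPart.unit_of_dvd_sub (y := 1)
    (by rw [add_sub_cancel_left]; exact Dvd.dvd.mul_left hpr 2) isUnit_one
  obtain ⟨β, hβ⟩ := hu.exists_left_inv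
  have hpne : (p : ℤ_[p]) ≠ 0 := by exact_mod_cast hp.out.ne_zero
  refine ⟨β • (x + (4 * p * m) • w), ?_, ?_, ?_⟩
  · intro y hy
    refine hx ((1 + 2 * r) • y - (4 * m) • w) ?_
    have h1 : x + (4 * p * m) • w = (1 + 2 * r) • ((p : ℤ_[p]) • y) := by
      rw [← hy, smul_smul, mul_comm (1 + 2 * r) β, hβ, one_smul]
    have h2 : x = (1 + 2 * r) • ((p : ℤ_[p]) • y) - (4 * p * m) • w := by rw [← h1]; simp
    rw [h2, smul_sub, smul_smul, smul_smul, smul_smul]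
    congr 2 <;> ring
  · rw [QuadraticMap.map_smul, q_expand, hQ]
    have h3 : m + 4 * p * m * (polar Q x w + 4 * p * m * Q w) = m * (1 + 2 * r) ^ 2 := by
      rw [← hs]; linear_combination (-4 * m) * hr
    rw [h3, smul_eq_mul]
    linear_combination m * (β * (1 + 2 * r) + 1) * hβ
  · rw [polar_smul_right, polar_add_right, h, polar_smul_right]
    have hβ0 : β ≠ 0 := by rintro rfl; simp at hβ
    have h4 : (4 : ℤ_[p]) ≠ 0 := by norm_num
    simp [hβ0, hpne, hm, hvw]

lemma local_int (hn : 5 ≤ n) (huniv : ∀ α : ℤ_[p], ∃ z, qf ℤ_[p] a z = α)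
    {v w : Fin n → ℤ} (hd : polar (qf ℤ a) v w ≠ 0) {m : ℤ} (hm : m ≠ 0) :
    ∃ (x : Fin n → ℤ) (K : ℕ), 1 ≤ K ∧ (∃ i, ¬ (p : ℤ) ∣ x i) ∧ (p : ℤ) ^ K ∣ qf ℤ a x - m ∧
      ¬ (p : ℤ) ^ K ∣ polar (qf ℤ a) v x := by
  obtain ⟨x0, hx0, hQ0⟩ := LocalPart.local_main hn (qf ℤ_[p] a) huniv (m : ℤ_[p])
  obtain ⟨x, hx, hQ, hB⟩ := perturb (qf ℤ_[p] a) (v := fun i => (v i : ℤ_[p])) (w := fun i => (w i : ℤ_[p]))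
    hx0 (by exact_mod_cast hm) hQ0 (by rw [polar_cast]; exact_mod_cast hd)
  obtain ⟨K, hK⟩ : ∃ K : ℕ, ¬ (p : ℤ_[p]) ^ K ∣ polar (qf ℤ_[p] a) (fun i => (v i : ℤ_[p])) x := by
    have hf := FiniteMultiplicity.of_not_isUnit (a := (p : ℤ_[p])) (PadicInt.prime_p.not_isUnit) hB
    obtain ⟨K, hK⟩ := hf
    exact ⟨K + 1, hK⟩
  have hK1 : 1 ≤ K := by
    rcases Nat.eq_zero_or_pos K with rfl | h
    · simp at hK
    · exact h
  let y : Fin n → ℤ := fun i => ((x i).appr K : ℤ)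
  have hy : ∀ i, (p : ℤ_[p]) ^ K ∣ x i - (y i : ℤ_[p]) := by
    intro i
    have := PadicInt.appr_spec K (x i)
    rw [Ideal.mem_span_singleton] at this
    simpa [y] using this
  choose z hz using hy
  have hxy : x = (fun i => (y i : ℤ_[p])) + ((p : ℤ_[p]) ^ K) • z := by
    funext i
    have := hz i
    simp only [Pi.add_apply, Pi.smul_apply, smul_eq_mul, ← this]; ring
  refine ⟨y, K, hK1, ?_, ?_, ?_⟩
  · by_contra! h
    have h2 : ∀ i, (p : ℤ_[p]) ∣ x i := by
      intro i
      have h3 : (p : ℤ_[p]) ∣ (y i : ℤ_[p]) := HM.intCast_dvd.2 (h i)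
      have h4 : (p : ℤ_[p]) ∣ x i - y i := by
        rw [hz i]; exact Dvd.dvd.mul_right (dvd_pow_self _ (by omega)) _
      have := dvd_add h4 h3
      simpa using this
    choose t ht using h2
    exact hx t (funext ht)
  · have h1 : (p : ℤ_[p]) ^ K ∣ ((qf ℤ a y - m : ℤ) : ℤ_[p]) := by
      rw [hxy, q_expand, qf_cast] at hQ
      push_cast
      rw [← hQ]
      refine ⟨-(polar (qf ℤ_[p] a) (fun i => (y i : ℤ_[p])) z + (p : ℤ_[p]) ^ K * qf ℤ_[p] a z), by ring⟩
    exact (PadicInt.pow_p_dvd_int_iff K _).1 h1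
  · intro h
    apply hK
    have h1 := (PadicInt.pow_p_dvd_int_iff (p := p) K _).2 h
    rw [← polar_cast] at h1
    rw [hxy, polar_add_right, polar_smul_right]
    exact dvd_add h1 (Dvd.intro _ rfl)

end GlobalPart
namespace GlobalPart
open QuadraticMap

variable {n : ℕ}

lemma vec_of_dvd {x y : Fin n → ℤ} {k : ℤ} (h : ∀ i, k ∣ x i - y i) : ∃ u : Fin n → ℤ, x = y + k • u := by
  choose u hu using h
  refine ⟨u, funext fun i => ?_⟩
  have := hu i
  simp only [Pi.add_apply, Pi.smul_apply, smul_eq_mul]; linarith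

lemma q_congr (Q : QuadraticMap ℤ (Fin n → ℤ) ℤ) {x y : Fin n → ℤ} {k : ℤ} (h : ∀ i, k ∣ x i - y i) :
    k ∣ Q x - Q y := by
  obtain ⟨u, rfl⟩ := vec_of_dvd h
  rw [q_expand, add_sub_cancel_left]
  exact Dvd.intro _ rfl

lemma b_congr (Q : QuadraticMap ℤ (Fin n → ℤ) ℤ) (v : Fin n → ℤ) {x y : Fin n → ℤ} {k : ℤ} (h : ∀ i, k ∣ x i - y i) :
    k ∣ polar Q v x - polar Q v y := by
  obtain ⟨u, rfl⟩ := vec_of_dvd h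
  rw [polar_add_right, polar_smul_right, add_sub_cancel_left]
  exact Dvd.intro _ rfl

lemma two_sq {q : ℕ} (hq : q.Prime) (hq2 : q ≠ 2) {A B : ℤ} (hA : ¬ (q : ℤ) ∣ A) (hB : ¬ (q : ℤ) ∣ B) (m : ℤ) :
    ∃ α β : ℤ, (q : ℤ) ∣ α ^ 2 * A + β ^ 2 * B - m := by
  haveI : Fact q.Prime := ⟨hq⟩
  have hA' : (A : ZMod q) ≠ 0 := by rwa [Ne, ZMod.intCast_zmod_eq_zero_iff_dvd] 
  have hB' : (B : ZMod q) ≠ 0 := by rwa [Ne, ZMod.intCast_zmod_eq_zero_iff_dvd]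
  have h1 : (Polynomial.C (A : ZMod q) * Polynomial.X ^ 2 + Polynomial.C 0 * Polynomial.X + Polynomial.C 0).degree = 2 :=
    Polynomial.degree_quadratic hA'
  have h2 : (Polynomial.C (B : ZMod q) * Polynomial.X ^ 2 + Polynomial.C 0 * Polynomial.X + Polynomial.C (-m : ZMod q)).degree = 2 :=
    Polynomial.degree_quadratic hB'
  obtain ⟨α, β, h⟩ := FiniteField.exists_root_sum_quadratic h1 h2
    (by rw [ZMod.card]; exact Nat.odd_iff.1 (hq.odd_of_ne_two hq2))
  obtain ⟨α, rfl⟩ := ZMod.intCast_surjective α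
  obtain ⟨β, rfl⟩ := ZMod.intCast_surjective β
  refine ⟨α, β, ?_⟩
  rw [← ZMod.intCast_zmod_eq_zero_iff_dvd]
  simp at h
  push_cast
  rw [← h]; ring

lemma global_core (Q : QuadraticMap ℤ (Fin n → ℤ) ℤ) {v w e e2 : Fin n → ℤ} {d m : ℤ}
    (hv : Q v = 0) (hd : d ≠ 0) (hvw : polar Q v w = d) (hdv : ∀ x, d ∣ polar Q v x)
    (hve : polar Q v e = 0) (hve2 : polar Q v e2 = 0) (hee2 : polar Q e e2 = 0)
    (hQe : Q e ≠ 0) (hQe2 : Q e2 ≠ 0) (hm : m ≠ 0)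
    (hloc : ∀ p : ℕ, p.Prime → ∃ (x : Fin n → ℤ) (K : ℕ), 1 ≤ K ∧ (∃ i, ¬ (p : ℤ) ∣ x i) ∧
      (p : ℤ) ^ K ∣ Q x - m ∧ ¬ (p : ℤ) ^ K ∣ polar Q v x) :
    ∃ x, Q x = m ∧ ∀ p : ℕ, p.Prime → ∃ i, ¬ (p : ℤ) ∣ x i := by
  set D : ℤ := 2 * m * d * Q e * Q e2 with hD
  have hD0 : D ≠ 0 := by simp [hD, hm, hd, hQe, hQe2]
  set S := D.natAbs.primeFactors with hS
  have hSp : ∀ p ∈ S, p.Prime := fun p hp => Nat.prime_of_mem_primeFactors hp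
  have hmemS : ∀ p : ℕ, p.Prime → (p : ℤ) ∣ D → p ∈ S := fun p hp h =>
    Nat.mem_primeFactors.2 ⟨hp, Int.natCast_dvd.1 h, by simpa using hD0⟩
  have hloc' : ∀ p : ℕ, ∃ (x : Fin n → ℤ) (K : ℕ), p.Prime → (1 ≤ K ∧ (∃ i, ¬ (p : ℤ) ∣ x i) ∧
      (p : ℤ) ^ K ∣ Q x - m ∧ ¬ (p : ℤ) ^ K ∣ polar Q v x) := by
    intro p
    by_cases hp : p.Prime
    · obtain ⟨x, K, h⟩ := hloc p hp
      exact ⟨x, K, fun _ => h⟩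
    · exact ⟨0, 0, fun h => absurd h hp⟩
  choose X K hXK using hloc'
  choose x0 hx0 using fun i => HM.crt_fin S hSp K (fun p => X p i)
  have hx0' : ∀ p ∈ S, ∀ i, (p : ℤ) ^ K p ∣ x0 i - X p i := fun p hp i => hx0 i p hp
  set M : ℤ := ∏ p ∈ S, (p : ℤ) ^ K p with hM
  have hpM : ∀ p ∈ S, (p : ℤ) ^ K p ∣ M := fun p hp => Finset.dvd_prod_of_mem _ hp
  have hM0 : M ≠ 0 := Finset.prod_ne_zero_iff.2 fun p hp => pow_ne_zero _ (by exact_mod_cast (hSp p hp).ne_zero)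
  have hMS : ∀ p : ℕ, p.Prime → (p : ℤ) ∣ M → p ∈ S := by
    intro p hp h
    have hp' : Prime (p : ℤ) := Nat.prime_iff_prime_int.1 hp
    obtain ⟨q, hq, hpq⟩ := (hp'.dvd_finset_prod_iff _).1 h
    have h1 := hp'.dvd_of_dvd_pow hpq
    have h2 : p = q := (Nat.prime_dvd_prime_iff_eq hp (hSp q hq)).1 (by exact_mod_cast h1)
    exact h2 ▸ hq
  have hMQ : M ∣ Q x0 - m := by
    refine Finset.prod_dvd_of_coprime ?_ ?_
    · intro p hp q hq hpq
      refine IsCoprime.pow ?_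
      exact Nat.isCoprime_iff_coprime.2 ((Nat.coprime_primes (hSp p hp) (hSp q hq)).2 hpq)
    · intro p hp
      have h1 := q_congr Q (hx0' p hp)
      have h2 := (hXK p (hSp p hp)).2.2.1
      have := dvd_add h1 h2
      simpa using this
  set c0 := polar Q v x0 with hc0
  have hc0p : ∀ p ∈ S, ¬ (p : ℤ) ^ K p ∣ c0 := by
    intro p hp h
    have h1 := b_congr Q v (hx0' p hp)
    exact (hXK p (hSp p hp)).2.2.2 ((dvd_sub_right h).1 h1)
  obtain ⟨C, e0, M1, hC1, hC2, hcop⟩ : ∃ C e0 M1 : ℤ, c0 = C * e0 ∧ M = C * M1 ∧ IsCoprime e0 M1 := by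
    have hg : (Int.gcd c0 M : ℤ) ≠ 0 := by
      simp [Int.gcd_eq_zero_iff, hM0]
    obtain ⟨g, c', M', hg1, h1, h2, h3⟩ := Int.exists_gcd_one' (m := c0) (n := M) (Nat.pos_of_ne_zero (by exact_mod_cast hg))
    exact ⟨g, c', M', by rw [h2]; ring, by rw [h3]; ring, Int.isCoprime_iff_gcd_eq_one.2 h1⟩
  have hM10 : M1 ≠ 0 := by rintro rfl; simp at hC2; exact hM0 hC2
  have hpM1 : ∀ p ∈ S, (p : ℤ) ∣ M1 := by
    intro p hp
    by_contra h
    have hp' : Prime (p : ℤ) := Nat.prime_iff_prime_int.1 (hSp p hp)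
    have h1 := hpM p hp
    rw [hC2] at h1
    have h2 := hp'.pow_dvd_of_dvd_mul_right _ h h1
    exact hc0p p hp (hC1 ▸ Dvd.dvd.mul_right h2 _)
  have hcop2 : IsCoprime e0 (M1 * d) := by
    refine HM.isCoprime_of_primes (mul_ne_zero hM10 hd) ?_
    intro p hp hpe
    have hpp := Nat.prime_of_mem_primeFactors hp
    have hp' : Prime (p : ℤ) := Nat.prime_iff_prime_int.1 hpp
    have h1 : (p : ℤ) ∣ M1 * d := Int.natCast_dvd.2 (Nat.dvd_of_mem_primeFactors hp)
    have hpS : p ∈ S := by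
      rcases hp'.dvd_or_dvd h1 with h | h
      · exact hMS p hpp (hC2 ▸ Dvd.dvd.mul_left h _)
      · exact hmemS p hpp (h.trans ⟨2 * m * Q e * Q e2, by rw [hD]; ring⟩)
    exact hp'.not_isUnit (hcop.isUnit_of_dvd' hpe (hpM1 p hpS))
  obtain ⟨q, hqgt, hq, hqmod⟩ := Nat.forall_exists_prime_gt_and_zmodEq D.natAbs (q := (M1 * d).natAbs) (a := e0)
    (by simpa using ⟨hM10, hd⟩) (by
      rcases Int.natAbs_eq (M1 * d) with h | h
      · rw [← h]; exact hcop2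
      · rw [h] at hcop2
        exact (IsCoprime.neg_right_iff _ _).1 hcop2)
  have hq' : Prime (q : ℤ) := Nat.prime_iff_prime_int.1 hq
  have hqD : ¬ (q : ℤ) ∣ D := fun h => by
    have := Nat.le_of_dvd (by simpa [Nat.pos_iff_ne_zero] using hD0) (Int.natCast_dvd.1 h)
    omega
  have hqS : q ∉ S := fun h => hqD (Int.natCast_dvd.2 (Nat.dvd_of_mem_primeFactors h))
  have hqM : ¬ (q : ℤ) ∣ M := fun h => hqS (hMS q hq h)
  obtain ⟨j, hj⟩ : ∃ j, (q : ℤ) = e0 + M1 * d * j := by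
    have h1 : (M1 * d) ∣ q - e0 := by
      have := hqmod.symm.dvd
      exact Int.natAbs_dvd.1 this
    obtain ⟨j, hj⟩ := h1
    exact ⟨j, by linarith⟩
  have hqm : ¬ (q : ℤ) ∣ m := fun h => hqD (h.trans ⟨2 * d * Q e * Q e2, by rw [hD]; ring⟩)
  have hqd : ¬ (q : ℤ) ∣ d := fun h => hqD (h.trans ⟨2 * m * Q e * Q e2, by rw [hD]; ring⟩)
  obtain ⟨α, β, hαβ⟩ := two_sq hq
    (by rintro rfl; exact hqD ⟨m * d * Q e * Q e2, by rw [hD]; push_cast; ring⟩)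
    (A := Q e) (B := Q e2)
    (fun h => hqD (h.trans ⟨2 * m * d * Q e2, by rw [hD]; ring⟩))
    (fun h => hqD (h.trans ⟨2 * m * d * Q e, by rw [hD]; ring⟩)) m
  set y := α • e + β • e2 with hy
  have hQy : Q y = α ^ 2 * Q e + β ^ 2 * Q e2 := by
    rw [hy, q_expand, QuadraticMap.map_smul, polar_smul_left, hee2]
    simp only [smul_eq_mul]; ring
  have hvy : polar Q v y = 0 := by
    rw [hy, polar_add_right, polar_smul_right, polar_smul_right, hve, hve2]; simp
  have hMq : IsCoprime M (q : ℤ) := ((hq'.coprime_iff_not_dvd).2 hqM).symm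
  choose x1 hx1M hx1q using fun i => HM.crt hMq (x0 i) (y i)
  obtain ⟨u, hu⟩ := vec_of_dvd hx1M
  obtain ⟨j', hj'⟩ := hdv u
  have hB1 : polar Q v x1 = c0 + M * d * j' := by
    rw [hu, polar_add_right, polar_smul_right, hj', smul_eq_mul]; ring
  have hCq : C * q = c0 + M * d * j := by rw [hC1, hC2, hj]; ring
  have hqj : (q : ℤ) ∣ j' - j := by
    have h1 := b_congr Q v hx1q
    rw [hvy, sub_zero, hB1] at h1
    have h2 : (q : ℤ) ∣ M * d * (j' - j) := by
      have := dvd_sub h1 (Dvd.intro_left C hCq)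
      have h3 : c0 + M * d * j' - (c0 + M * d * j) = M * d * (j' - j) := by ring
      rwa [h3] at this
    rcases hq'.dvd_or_dvd h2 with h | h
    · rcases hq'.dvd_or_dvd h with h | h
      · exact absurd h hqM
      · exact absurd h hqd
    · exact h
  set x2 := x1 - (M * (j' - j)) • w with hx2
  have hx2M : ∀ i, M ∣ x2 i - x0 i := by
    intro i
    have h1 : x2 i - x0 i = (x1 i - x0 i) - M * ((j' - j) * w i) := by
      simp [hx2]; ring
    rw [h1]; exact dvd_sub (hx1M i) (Dvd.intro _ rfl)
  have hx2q : ∀ i, (q : ℤ) ∣ x2 i - y i := by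
    intro i
    have h1 : x2 i - y i = (x1 i - y i) - (j' - j) * (M * w i) := by
      simp [hx2]; ring
    rw [h1]; exact dvd_sub (hx1q i) (Dvd.dvd.mul_right hqj _)
  have hB2 : polar Q v x2 = C * q := by
    rw [hx2, polar_sub_right, polar_smul_right, hB1, hvw, hCq, smul_eq_mul]; ring
  have hdiv : M * q ∣ Q x2 - m := by
    refine hMq.mul_dvd ?_ ?_
    · have := dvd_add (q_congr Q hx2M) hMQ
      simpa using this
    · have := dvd_add (q_congr Q hx2q) (hQy ▸ hαβ)
      simpa using this
  obtain ⟨s, hs⟩ := hdiv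
  set t := -(M1 * s) with ht
  have hQx : Q (x2 + t • v) = m := by
    rw [q_expand, hv, polar_comm, hB2, ht]
    rw [hC2] at hs
    linear_combination hs
  have hBx : polar Q v (x2 + t • v) = C * q := by
    rw [polar_add_right, polar_smul_right, hB2, polar_self, hv]; simp
  refine ⟨x2 + t • v, hQx, ?_⟩
  intro r hr
  have hr' : Prime (r : ℤ) := Nat.prime_iff_prime_int.1 hr
  by_contra! hall
  by_cases hrS : r ∈ S
  · obtain ⟨hK, ⟨i, hi⟩, -⟩ := hXK r hr
    apply hi
    have h1 : (r : ℤ) ∣ (r : ℤ) ^ K r := dvd_pow_self _ (by omega)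
    have h2 := h1.trans (hx0' r hrS i)
    have h3 := (h1.trans (hpM r hrS)).trans (hx2M i)
    have h4 : (r : ℤ) ∣ t * v i := Dvd.dvd.mul_right (by rw [ht]; exact (Dvd.dvd.mul_right (hpM1 r hrS) s).neg_right) _
    have h5 := hall i
    simp only [Pi.add_apply, Pi.smul_apply, smul_eq_mul] at h5
    have h6 : X r i = (x2 i + t * v i) - t * v i - (x2 i - x0 i) - (x0 i - X r i) := by ring
    rw [h6]
    exact dvd_sub (dvd_sub (dvd_sub h5 h4) h3) h2
  · have h0 : ∀ i, (r : ℤ) ∣ (x2 + t • v) i - (0 : Fin n → ℤ) i := fun i => by simpa using hall i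
    have h1 := b_congr Q v h0
    rw [hBx, polar_zero_right, sub_zero] at h1
    rcases hr'.dvd_or_dvd h1 with h | h
    · exact hrS (hMS r hr (hC2 ▸ Dvd.dvd.mul_right h _))
    · have hrq : r = q := (Nat.prime_dvd_prime_iff_eq hr hq).1 (by exact_mod_cast h)
      subst hrq
      have h2 := q_congr Q h0
      rw [hQx, QuadraticMap.map_zero, sub_zero] at h2
      exact hqm h2

end GlobalPart

theorem stmt_3 {n : ℕ} (hn : 5 ≤ n) (a : Fin n → Fin n → ℤ)
    (hnd : (Matrix.of fun i j : Fin n =>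
        if i = j then (a i i : ℚ)
        else if i < j then (a i j : ℚ) / 2 else (a j i : ℚ) / 2).det ≠ 0)
    (hindef : (∃ x : Fin n → ℤ,
        0 < ∑ i : Fin n, ∑ j ∈ Finset.Ici i, a i j * x i * x j) ∧
      (∃ y : Fin n → ℤ,
        ∑ i : Fin n, ∑ j ∈ Finset.Ici i, a i j * y i * y j < 0))
    (huniv : ∀ (p : ℕ) [Fact p.Prime], ∀ α : ℤ_[p], ∃ z : Fin n → ℤ_[p],
      ∑ i : Fin n, ∑ j ∈ Finset.Ici i, (a i j : ℤ_[p]) * z i * z j = α) :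
    ∀ m : ℤ, m ≠ 0 → ∃ x : Fin n → ℤ,
      Finset.univ.gcd x = 1 ∧
      ∑ i : Fin n, ∑ j ∈ Finset.Ici i, a i j * x i * x j = m := by
  intro m hm
  have hpos : ∃ x : Fin n → ℤ, 0 < GlobalPart.qf ℤ a x := by
    obtain ⟨x, hx⟩ := hindef.1
    exact ⟨x, by rw [GlobalPart.qf_apply]; simpa using hx⟩
  have hneg : ∃ x : Fin n → ℤ, GlobalPart.qf ℤ a x < 0 := by
    obtain ⟨x, hx⟩ := hindef.2
    exact ⟨x, by rw [GlobalPart.qf_apply]; simpa using hx⟩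
  have hnd' : (GlobalPart.Ms a).det ≠ 0 := hnd
  obtain ⟨v, hv0, hv⟩ := GlobalPart.exists_iso hn hnd' hpos hneg
  obtain ⟨d, w, hd, hvw, hdv⟩ := GlobalPart.exists_d hnd' hv0
  obtain ⟨e, hve, -, hQe⟩ := GlobalPart.ortho_exists hn hnd' v v
  obtain ⟨e2, hve2, hee2, hQe2⟩ := GlobalPart.ortho_exists hn hnd' v e
  obtain ⟨x, hx, hprim⟩ := GlobalPart.global_core (GlobalPart.qf ℤ a) hv hd hvw hdv hve hve2 hee2 hQe hQe2 hm
    (by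
      intro p hp
      haveI : Fact p.Prime := ⟨hp⟩
      refine GlobalPart.local_int hn ?_ (w := w) (by rw [hvw]; exact hd) hm
      intro α
      obtain ⟨z, hz⟩ := huniv p α
      exact ⟨z, by rw [GlobalPart.qf_apply]; exact hz⟩)
  refine ⟨x, ?_, ?_⟩
  · by_contra hg
    have hna : (Finset.univ.gcd x).natAbs ≠ 1 := by
      intro h
      apply hg
      have h1 := Finset.normalize_gcd (s := Finset.univ) (f := x)
      rw [← Int.abs_eq_normalize, Int.abs_eq_natAbs, h] at h1
      simpa using h1.symm
    obtain ⟨p, hp, hpd⟩ := Nat.exists_prime_and_dvd hna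
    obtain ⟨i, hi⟩ := hprim p hp
    exact hi ((Int.natCast_dvd.2 hpd).trans (Finset.gcd_dvd (Finset.mem_univ i)))
  · rw [GlobalPart.qf_apply] at hx
    simpa using hx
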